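/- arXiv:math/0511506 — 7 statements merged into one kernel-verified Lean document; each statement's English description precedes it below -/
import Mathlib

section
/- Let τ>0, let ν be a finite Borel measure on (0,τ] that is either atomless or supported on finitely many points, and let a:[0,∞)×(0,τ]→ℝ be measurable with m₁ ≤ a(x,u) ≤ m₂ for all x,u, where 0<m₁≤m₂<∞, and |a(x,u)−a(x′,u)| ≤ L|x−x′| for all u and all x,x′, for some finite constant L. Then there exists exactly one nondecreasing right-continuous function Γ:[0,τ]→[0,∞) satisfying Γ(t)=∫_{(0,t]} a(Γ(u−),u)^{−1} ν(du) for every t∈[0,τ], where Γ(u−) denotes the left limit of Γ at u (with Γ(0−)=0); moreover this solution satisfies m₂^{−1}ν((0,t]) ≤ Γ(t) ≤ m₁^{−1}ν((0,t]) for all t∈[0,τ]. -/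
open MeasureTheory Set Function

/-- The property of being a solution of the nonlinear Volterra equation
`Γ(t) = ∫_{(0,t]} a(Γ(u−),u)⁻¹ ν(du)` on `[0,τ]`, encoded as a nondecreasing
right-continuous function on `ℝ` which vanishes on `(-∞,0]` and is constant after `τ`. -/
def IsVolterraSol (τ : ℝ) (ν : Measure ℝ) (a : ℝ → ℝ → ℝ) (Γ : ℝ → ℝ) : Prop :=
  Monotone Γ ∧ (∀ t, t ≤ 0 → Γ t = 0) ∧ (∀ t, τ ≤ t → Γ t = Γ τ) ∧
    (∀ t, ContinuousWithinAt Γ (Set.Ici t) t) ∧ (∀ t, 0 ≤ Γ t) ∧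
    (∀ t ∈ Set.Icc 0 τ, Γ t = ∫ u in Set.Ioc 0 t, (a (Function.leftLim Γ u) u)⁻¹ ∂ν)

lemma volterra_weight (ν : Measure ℝ) [IsFiniteMeasure ν] (K : ℝ) (hK : 0 ≤ K) :
    ∃ w : ℝ → ℝ, Measurable w ∧ (∃ B, ∀ u, w u ≤ B) ∧ (∀ u, 1 ≤ w u) ∧
      ∀ u, K * ∫ v in Iio u, w v ∂ν ≤ w u / 2 := by
  set T : ℝ := ν.real univ with hT
  have hT0 : 0 ≤ T := measureReal_nonneg
  set M : ℝ := 4 * (K + 1) * (T + 1) with hM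
  have hM1 : 1 ≤ M := by nlinarith [mul_nonneg hK hT0]
  have hM0 : 0 < M := by linarith
  set δ : ℝ := 1 / (4 * (K + 1)) with hδ
  have hδ0 : 0 < δ := by positivity
  set V : ℝ → ℝ := fun u => ν.real (Iio u) with hV
  have hVm : Monotone V := fun x y hxy => measureReal_mono (Iio_subset_Iio hxy)
  have hVT : ∀ u, V u ≤ T := fun u => measureReal_mono (subset_univ _)
  have hV0 : ∀ u, 0 ≤ V u := fun u => measureReal_nonneg
  set j : ℝ → ℕ := fun u => ⌊V u / δ⌋₊ with hj
  have hjmono : Monotone j := fun x y hxy =>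
    Nat.floor_mono (div_le_div_of_nonneg_right (hVm hxy) hδ0.le)
  have hjm : Measurable j := hjmono.measurable
  have hwmono : Monotone (fun u => M ^ j u) := fun x y hxy => pow_le_pow_right₀ hM1 (hjmono hxy)
  have hwB : ∀ u, M ^ j u ≤ M ^ ⌊T / δ⌋₊ := fun u =>
    pow_le_pow_right₀ hM1 (Nat.floor_mono (div_le_div_of_nonneg_right (hVT u) hδ0.le))
  have hw1 : ∀ u, 1 ≤ M ^ j u := fun u => one_le_pow₀ hM1
  refine ⟨fun u => M ^ j u, hwmono.measurable, ⟨_, hwB⟩, hw1, ?_⟩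
  intro u
  set A : Set ℝ := {v | v < u ∧ j v = j u} with hA
  have hAm : MeasurableSet A := measurableSet_Iio.inter (hjm (measurableSet_singleton (j u)))
  have hAδ : ν A ≤ ENNReal.ofReal δ := by
    rw [hAm.measure_eq_iSup_isCompact]
    refine iSup_le fun C => iSup_le fun hCA => iSup_le fun hC => ?_
    rcases C.eq_empty_or_nonempty with rfl | hne
    · simp
    obtain ⟨v, hvC, hv⟩ := hC.exists_isLeast hne
    have hvA := hCA hvC
    have hsub : C ⊆ Iio u \ Iio v := fun x hx => ⟨(hCA hx).1, not_lt.2 (hv hx)⟩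
    have h1 : ν.real (Iio u \ Iio v) = V u - V v :=
      measureReal_sdiff (Iio_subset_Iio hvA.1.le) measurableSet_Iio
    have h2 : V u / δ < j u + 1 := Nat.lt_floor_add_one _
    have h3 : (j v : ℝ) ≤ V v / δ := Nat.floor_le (div_nonneg (hV0 v) hδ0.le)
    rw [hvA.2] at h3
    have h4 : V u - V v ≤ δ := by
      rw [div_lt_iff₀ hδ0] at h2
      rw [le_div_iff₀ hδ0] at h3
      linarith
    refine (measure_mono hsub).trans ?_
    rw [← ofReal_measureReal, h1]
    exact ENNReal.ofReal_le_ofReal h4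
  have hAδ' : ν.real A ≤ δ := ENNReal.toReal_le_of_le_ofReal hδ0.le hAδ
  have hle : ∀ v ∈ Iio u, M ^ j v ≤ M ^ j u / M + A.indicator (fun _ => M ^ j u) v := by
    intro v hv
    by_cases hvA : v ∈ A
    · rw [indicator_of_mem hvA, hvA.2]
      have : 0 ≤ M ^ j u / M := by positivity
      linarith
    · rw [indicator_of_notMem hvA, add_zero]
      have hne : j v ≠ j u := fun h => hvA ⟨hv, h⟩
      have hlt : j v < j u := lt_of_le_of_ne (hjmono (le_of_lt hv)) hne
      rw [le_div_iff₀ hM0, ← pow_succ]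
      exact pow_le_pow_right₀ hM1 hlt
  have hint : Integrable (fun v => M ^ j v) ν :=
    Integrable.of_bound hwmono.measurable.aestronglyMeasurable (M ^ ⌊T / δ⌋₊)
      (Filter.Eventually.of_forall fun v => by
        rw [Real.norm_of_nonneg (by positivity)]; exact hwB v)
  have hint2 : Integrable (A.indicator (fun _ => M ^ j u)) ν :=
    (integrable_const _).indicator hAm
  have hI : ∫ v in Iio u, M ^ j v ∂ν ≤ M ^ j u / M * T + M ^ j u * δ := by
    calc ∫ v in Iio u, M ^ j v ∂ν
        ≤ ∫ v in Iio u, (M ^ j u / M + A.indicator (fun _ => M ^ j u) v) ∂ν :=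
          setIntegral_mono_on hint.integrableOn
            ((integrable_const _).add hint2).integrableOn measurableSet_Iio hle
      _ ≤ ∫ v, (M ^ j u / M + A.indicator (fun _ => M ^ j u) v) ∂ν := by
          refine setIntegral_le_integral ((integrable_const _).add hint2)
            (Filter.Eventually.of_forall fun v => ?_)
          have : 0 ≤ A.indicator (fun _ => M ^ j u) v :=
            indicator_nonneg (fun _ _ => by positivity) v
          have h2 : 0 ≤ M ^ j u / M := by positivity
          simpa using add_nonneg h2 this
      _ = M ^ j u / M * T + ν.real A * M ^ j u := by
          rw [integral_add (integrable_const _) hint2, integral_indicator_const _ hAm]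
          simp [hT, mul_comm]
      _ ≤ _ := by
          have : 0 ≤ M ^ j u := by positivity
          nlinarith
  have hP : 0 < M ^ j u := by positivity
  have e1 : K * (T / M) ≤ 1 / 4 := by
    rw [← mul_div_assoc, div_le_iff₀ hM0, hM]
    nlinarith [mul_nonneg hK hT0]
  have e2 : K * δ ≤ 1 / 4 := by
    rw [hδ, mul_one_div, div_le_iff₀ (by positivity)]
    linarith
  calc K * ∫ v in Iio u, M ^ j v ∂ν ≤ K * (M ^ j u / M * T + M ^ j u * δ) := by gcongr
    _ = M ^ j u * (K * (T / M) + K * δ) := by ring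
    _ ≤ M ^ j u * (1 / 4 + 1 / 4) := by gcongr
    _ = M ^ j u / 2 := by ring

lemma volterra_integrable (ν : Measure ℝ) [IsFiniteMeasure ν] (f : ℝ → ℝ) (hf : Measurable f)
    (B : ℝ) (hB : ∀ u, 0 ≤ f u ∧ f u ≤ B) : Integrable f ν :=
  Integrable.of_bound hf.aestronglyMeasurable B
    (Filter.Eventually.of_forall fun v => by
      rw [Real.norm_of_nonneg (hB v).1]; exact (hB v).2)

lemma volterra_mono (ν : Measure ℝ) (f : ℝ → ℝ) (hf : Integrable f ν)
    (h0 : ∀ u, 0 ≤ f u) : Monotone (fun t => ∫ u in Ioc 0 t, f u ∂ν) := by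
  intro x y hxy
  exact setIntegral_mono_set hf.integrableOn (Filter.Eventually.of_forall h0)
    (Filter.Eventually.of_forall (Ioc_subset_Ioc_right hxy))

lemma volterra_right (ν : Measure ℝ) (f : ℝ → ℝ) (hf : Integrable f ν) (t : ℝ) :
    ContinuousWithinAt (fun t => ∫ u in Ioc 0 t, f u ∂ν) (Ici t) t := by
  unfold ContinuousWithinAt
  simp only [← integral_indicator (measurableSet_Ioc)]
  refine tendsto_integral_filter_of_dominated_convergence (fun u => ‖f u‖) ?_ ?_ hf.norm ?_
  · exact Filter.Eventually.of_forall fun s => (hf.indicator measurableSet_Ioc).aestronglyMeasurable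
  · exact Filter.Eventually.of_forall fun s => Filter.Eventually.of_forall fun u =>
      norm_indicator_le_norm_self _ _
  · refine Filter.Eventually.of_forall fun v => ?_
    refine tendsto_const_nhds.congr' ?_
    by_cases hv : v ≤ t
    · filter_upwards [self_mem_nhdsWithin] with s hs
      have : v ≤ s := hv.trans hs
      by_cases h0 : 0 < v <;> simp [indicator, h0, hv, this]
    · have : Iio v ∈ nhdsWithin t (Ici t) := mem_nhdsWithin_of_mem_nhds (Iio_mem_nhds (not_le.1 hv))
      filter_upwards [this] with s hs
      have : ¬ v ≤ s := not_le.2 hs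
      simp [indicator, hv, this]

lemma volterra_left (ν : Measure ℝ) (f : ℝ → ℝ) (hf : Integrable f ν) (h0 : ∀ u, 0 ≤ f u)
    (t : ℝ) :
    leftLim (fun t => ∫ u in Ioc 0 t, f u ∂ν) t = ∫ u in Ioo 0 t, f u ∂ν := by
  refine tendsto_nhds_unique ((volterra_mono ν f hf h0).tendsto_leftLim t) ?_
  simp only [← integral_indicator (measurableSet_Ioc), ← integral_indicator (measurableSet_Ioo)]
  refine tendsto_integral_filter_of_dominated_convergence (fun u => ‖f u‖) ?_ ?_ hf.norm ?_
  · exact Filter.Eventually.of_forall fun s => (hf.indicator measurableSet_Ioc).aestronglyMeasurable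
  · exact Filter.Eventually.of_forall fun s => Filter.Eventually.of_forall fun u =>
      norm_indicator_le_norm_self _ _
  · refine Filter.Eventually.of_forall fun v => ?_
    refine tendsto_const_nhds.congr' ?_
    by_cases hv : v < t
    · have : Ioi v ∈ nhdsWithin t (Iio t) := mem_nhdsWithin_of_mem_nhds (Ioi_mem_nhds hv)
      filter_upwards [this] with s hs
      have : v ≤ s := le_of_lt hs
      by_cases h0 : 0 < v <;> simp [indicator, h0, hv, this]
    · filter_upwards [self_mem_nhdsWithin] with s hs
      have : ¬ v ≤ s := not_le.2 (lt_of_lt_of_le hs (not_lt.1 hv))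
      simp [indicator, hv, this]

lemma volterra_step (ν : Measure ℝ) [IsFiniteMeasure ν] (b : ℝ → ℝ → ℝ)
    (hb : Measurable fun p : ℝ × ℝ => b p.1 p.2) (B K : ℝ) (hK : 0 ≤ K)
    (hB : ∀ x u, 0 ≤ b x u ∧ b x u ≤ B)
    (hL : ∀ u x x', |b x u - b x' u| ≤ K * |x - x'|)
    (w : ℝ → ℝ) (hw : Measurable w) (W : ℝ) (hW : ∀ u, w u ≤ W) (hw1 : ∀ u, 1 ≤ w u)
    (hwK : ∀ u, K * ∫ v in Iio u, w v ∂ν ≤ w u / 2)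
    (g h : ℝ → ℝ) (hg : Measurable g) (hh : Measurable h) (C : ℝ) (hC : 0 ≤ C)
    (hgh : ∀ u, |g u - h u| ≤ C * w u) (u : ℝ) :
    |(∫ v in Ioo 0 u, b (g v) v ∂ν) - ∫ v in Ioo 0 u, b (h v) v ∂ν| ≤ C / 2 * w u := by
  have ig : Integrable (fun v => b (g v) v) ν := volterra_integrable ν _
    (hb.comp (hg.prodMk measurable_id)) B (fun v => hB _ _)
  have ih : Integrable (fun v => b (h v) v) ν := volterra_integrable ν _
    (hb.comp (hh.prodMk measurable_id)) B (fun v => hB _ _)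
  have iw : Integrable w ν := volterra_integrable ν w hw W
    (fun v => ⟨zero_le_one.trans (hw1 v), hW v⟩)
  rw [← integral_sub ig.integrableOn ih.integrableOn]
  calc |∫ v in Ioo 0 u, (b (g v) v - b (h v) v) ∂ν|
      ≤ ∫ v in Ioo 0 u, |b (g v) v - b (h v) v| ∂ν := abs_integral_le_integral_abs
    _ ≤ ∫ v in Ioo 0 u, K * C * w v ∂ν := by
        refine integral_mono (ig.sub ih).abs.integrableOn (iw.const_mul _).integrableOn ?_
        intro v
        calc |b (g v) v - b (h v) v| ≤ K * |g v - h v| := hL _ _ _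
          _ ≤ K * (C * w v) := by gcongr; exact hgh v
          _ = K * C * w v := by ring
    _ ≤ ∫ v in Iio u, K * C * w v ∂ν := by
        refine setIntegral_mono_set (iw.const_mul _).integrableOn
          (Filter.Eventually.of_forall fun v => ?_)
          (Filter.Eventually.of_forall (fun v hv => hv.2))
        have := hw1 v
        have : 0 ≤ K * C * w v := by positivity
        simpa using this
    _ = C * (K * ∫ v in Iio u, w v ∂ν) := by rw [integral_const_mul]; ring
    _ ≤ C * (w u / 2) := by gcongr; exact hwK u
    _ = _ := by ring

lemma volterra_int_bound (ν : Measure ℝ) [IsFiniteMeasure ν] (f : ℝ → ℝ) (hf : Measurable f)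
    (B : ℝ) (hB : ∀ u, 0 ≤ f u ∧ f u ≤ B) (s : Set ℝ) :
    0 ≤ ∫ v in s, f v ∂ν ∧ ∫ v in s, f v ∂ν ≤ B * ν.real univ := by
  have i := volterra_integrable ν f hf B hB
  refine ⟨integral_nonneg fun v => (hB v).1, ?_⟩
  calc ∫ v in s, f v ∂ν ≤ ∫ v, f v ∂ν :=
        setIntegral_le_integral i (Filter.Eventually.of_forall fun v => (hB v).1)
    _ ≤ ∫ v, B ∂ν := integral_mono i (integrable_const _) fun v => (hB v).2
    _ = _ := by simp [mul_comm]

lemma volterra_fixed (ν : Measure ℝ) [IsFiniteMeasure ν] (b : ℝ → ℝ → ℝ)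
    (hb : Measurable fun p : ℝ × ℝ => b p.1 p.2) (B K : ℝ) (hK : 0 ≤ K)
    (hB : ∀ x u, 0 ≤ b x u ∧ b x u ≤ B)
    (hL : ∀ u x x', |b x u - b x' u| ≤ K * |x - x'|) :
    (∃ g : ℝ → ℝ, Measurable g ∧ ∀ u, g u = ∫ v in Ioo 0 u, b (g v) v ∂ν) ∧
    ∀ g h : ℝ → ℝ, Measurable g → Measurable h →
      (∀ u, g u = ∫ v in Ioo 0 u, b (g v) v ∂ν) →
      (∀ u, h u = ∫ v in Ioo 0 u, b (h v) v ∂ν) → g = h := by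
  obtain ⟨w, hw, ⟨W, hW⟩, hw1, hwK⟩ := volterra_weight ν K hK
  have step := volterra_step ν b hb B K hK hB hL w hw W hW hw1 hwK
  have bnd : ∀ g : ℝ → ℝ, Measurable g → ∀ s : Set ℝ, 0 ≤ ∫ v in s, b (g v) v ∂ν ∧
      ∫ v in s, b (g v) v ∂ν ≤ B * ν.real univ := fun g hg s =>
    volterra_int_bound ν _ (hb.comp (hg.prodMk measurable_id)) B (fun v => hB _ _) s
  have hB0 : 0 ≤ B := (hB 0 0).1.trans (hB 0 0).2
  set C : ℝ := B * ν.real univ with hC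
  have hC0 : 0 ≤ C := mul_nonneg hB0 measureReal_nonneg
  constructor
  · have hmono : ∀ g : ℝ → ℝ, Measurable g →
        Monotone (fun u => ∫ v in Ioo 0 u, b (g v) v ∂ν) := by
      intro g hg x y hxy
      exact setIntegral_mono_set (volterra_integrable ν _ (hb.comp (hg.prodMk measurable_id)) B
        (fun v => hB _ _)).integrableOn (Filter.Eventually.of_forall fun v => (hB _ _).1)
        (Filter.Eventually.of_forall (Ioo_subset_Ioo_right hxy))
    let G : ℕ → ℝ → ℝ := fun n => Nat.rec (fun _ => 0)
      (fun _ g u => ∫ v in Ioo 0 u, b (g v) v ∂ν) n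
    have hG0 : G 0 = fun _ => 0 := rfl
    have hGs : ∀ n u, G (n + 1) u = ∫ v in Ioo 0 u, b (G n v) v ∂ν := fun n u => rfl
    have hGm : ∀ n, Measurable (G n) := by
      intro n
      induction n with
      | zero => rw [hG0]; exact measurable_const
      | succ n ih => exact (hmono _ ih).measurable
    have hdiff : ∀ n u, |G n u - G (n + 1) u| ≤ C * (1 / 2) ^ n * w u := by
      intro n
      induction n with
      | zero =>
        intro u
        rw [hGs, hG0]
        have h1 := bnd (fun _ => 0) measurable_const (Ioo 0 u)
        rw [zero_sub, abs_neg, abs_of_nonneg h1.1]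
        have := hw1 u
        simp only [pow_zero, mul_one]
        nlinarith [h1.2]
      | succ n ih =>
        intro u
        have := step (G n) (G (n + 1)) (hGm n) (hGm (n + 1)) (C * (1 / 2) ^ n) (by positivity) ih u
        rw [hGs, hGs (n + 1)]
        refine this.trans (le_of_eq ?_)
        ring
    have hlim : ∀ u, ∃ l, Filter.Tendsto (fun n => G n u) Filter.atTop (nhds l) := by
      intro u
      refine cauchySeq_tendsto_of_complete ?_
      refine cauchySeq_of_le_geometric (1 / 2) (C * w u) (by norm_num) fun n => ?_
      rw [Real.dist_eq]
      refine (hdiff n u).trans (le_of_eq ?_)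
      ring
    choose g hg using hlim
    have hgm : Measurable g := measurable_of_tendsto_metrizable hGm (tendsto_pi_nhds.2 hg)
    refine ⟨g, hgm, fun u => ?_⟩
    refine tendsto_nhds_unique ((Filter.tendsto_add_atTop_iff_nat 1).2 (hg u)) ?_
    simp only [hGs]
    refine tendsto_integral_of_dominated_convergence (fun _ => B) ?_ (integrable_const _) ?_ ?_
    · exact fun n => (hb.comp ((hGm n).prodMk measurable_id)).aestronglyMeasurable
    · refine fun n => Filter.Eventually.of_forall fun v => ?_
      rw [Real.norm_of_nonneg (hB _ _).1]
      exact (hB _ _).2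
    · refine Filter.Eventually.of_forall fun v => ?_
      rw [tendsto_iff_dist_tendsto_zero]
      have h1 : Filter.Tendsto (fun n => K * dist (G n v) (g v)) Filter.atTop (nhds (K * 0)) :=
        (tendsto_iff_dist_tendsto_zero.1 (hg v)).const_mul K
      rw [mul_zero] at h1
      exact squeeze_zero (fun n => dist_nonneg) (fun n => hL _ _ _) h1
  · intro g h hg hh eg eh
    have key : ∀ n : ℕ, ∀ u, |g u - h u| ≤ C * (1 / 2) ^ n * w u := by
      intro n
      induction n with
      | zero =>
        intro u
        have h1 := bnd g hg (Ioo 0 u)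
        have h2 := bnd h hh (Ioo 0 u)
        rw [← eg] at h1
        rw [← eh] at h2
        have := hw1 u
        have : |g u - h u| ≤ C := abs_le.2 ⟨by linarith, by linarith⟩
        simp only [pow_zero, mul_one]
        nlinarith
      | succ n ih =>
        intro u
        have := step g h hg hh (C * (1 / 2) ^ n) (by positivity) ih u
        rw [← eg, ← eh] at this
        refine this.trans (le_of_eq ?_)
        ring
    funext u
    have hz : Filter.Tendsto (fun n : ℕ => C * (1 / 2 : ℝ) ^ n * w u) Filter.atTop
        (nhds (C * 0 * w u)) :=
      ((tendsto_pow_atTop_nhds_zero_of_lt_one (by norm_num) (by norm_num)).const_mul C).mul_const _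
    have := ge_of_tendsto' hz (fun n => key n u)
    rw [mul_zero, zero_mul] at this
    exact sub_eq_zero.1 (abs_nonpos_iff.1 this)

theorem nonlinear_volterra_existence_uniqueness
    (τ : ℝ) (hτ : 0 < τ)
    (ν : Measure ℝ) [IsFiniteMeasure ν] (hνsupp : ν (Set.Ioc 0 τ)ᶜ = 0)
    (hνatoms : (∀ x : ℝ, ν {x} = 0) ∨ ∃ S : Finset ℝ, ν ((↑S : Set ℝ))ᶜ = 0)
    (a : ℝ → ℝ → ℝ) (hameas : Measurable fun p : ℝ × ℝ => a p.1 p.2)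
    (m₁ m₂ L : ℝ) (hm₁ : 0 < m₁) (hm₁₂ : m₁ ≤ m₂)
    (hbd : ∀ x u, m₁ ≤ a x u ∧ a x u ≤ m₂)
    (hLip : ∀ u x x', |a x u - a x' u| ≤ L * |x - x'|) :
    (∃! Γ : ℝ → ℝ, IsVolterraSol τ ν a Γ) ∧
      (∀ Γ : ℝ → ℝ, IsVolterraSol τ ν a Γ → ∀ t ∈ Set.Icc 0 τ,
        m₂⁻¹ * (ν (Set.Ioc 0 t)).toReal ≤ Γ t ∧
          Γ t ≤ m₁⁻¹ * (ν (Set.Ioc 0 t)).toReal) := by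
  have ha0 : ∀ x u, 0 < a x u := fun x u => hm₁.trans_le (hbd x u).1
  have hm₂ : 0 < m₂ := hm₁.trans_le hm₁₂
  have hL0 : 0 ≤ L := by
    have := (abs_nonneg _).trans (hLip 0 0 1)
    simpa using this
  set b : ℝ → ℝ → ℝ := fun x u => (a x u)⁻¹ with hbdef
  have hbm : Measurable fun p : ℝ × ℝ => b p.1 p.2 := hameas.inv
  have hbB : ∀ x u, 0 ≤ b x u ∧ b x u ≤ m₁⁻¹ := fun x u =>
    ⟨inv_nonneg.2 (ha0 x u).le, inv_anti₀ hm₁ (hbd x u).1⟩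
  have hbL : ∀ u x x', |b x u - b x' u| ≤ (m₁⁻¹ * m₁⁻¹ * L) * |x - x'| := by
    intro u x x'
    have e : b x u - b x' u = b x u * b x' u * (a x' u - a x u) := by
      simp only [hbdef]
      have := (ha0 x u).ne'
      have := (ha0 x' u).ne'
      field_simp
    rw [e, abs_mul, abs_of_nonneg (mul_nonneg (hbB x u).1 (hbB x' u).1), abs_sub_comm]
    calc b x u * b x' u * |a x u - a x' u| ≤ m₁⁻¹ * m₁⁻¹ * (L * |x - x'|) :=
          mul_le_mul (mul_le_mul (hbB x u).2 (hbB x' u).2 (hbB x' u).1 (by positivity))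
            (hLip u x x') (abs_nonneg _) (by positivity)
      _ = _ := by ring
  have hK : 0 ≤ m₁⁻¹ * m₁⁻¹ * L := by positivity
  obtain ⟨⟨g, hgm, hg⟩, huniq⟩ := volterra_fixed ν b hbm m₁⁻¹ _ hK hbB hbL
  have hmeas : ∀ g : ℝ → ℝ, Measurable g → Measurable (fun v => b (g v) v) :=
    fun g hg => hbm.comp (hg.prodMk measurable_id)
  have hint : ∀ g : ℝ → ℝ, Measurable g → Integrable (fun v => b (g v) v) ν := fun g hg =>
    volterra_integrable ν _ (hmeas g hg) m₁⁻¹ (fun v => hbB _ _)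
  have hconst : ∀ (f : ℝ → ℝ) (t : ℝ), τ ≤ t →
      ∫ u in Ioc 0 t, f u ∂ν = ∫ u in Ioc 0 τ, f u ∂ν := by
    intro f t ht
    refine setIntegral_congr_set ?_
    have hae : ∀ᵐ v ∂ν, v ∈ Ioc 0 τ := hνsupp
    filter_upwards [hae] with v hv
    refine propext ⟨fun _ => hv, fun _ => ⟨hv.1, hv.2.trans ht⟩⟩
  have hlm : ∀ Γ, IsVolterraSol τ ν a Γ → Measurable (leftLim Γ) := fun Γ h =>
    h.1.leftLim.measurable
  have hall : ∀ Γ, IsVolterraSol τ ν a Γ →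
      Γ = fun t => ∫ u in Ioc 0 t, b (leftLim Γ u) u ∂ν := by
    rintro Γ ⟨-, h2, h3, -, -, h6⟩
    funext t
    rcases le_total t 0 with ht | ht
    · rw [h2 t ht, Ioc_eq_empty (not_lt.2 ht)]; simp
    rcases le_total t τ with ht' | ht'
    · exact h6 t ⟨ht, ht'⟩
    · rw [h3 t ht', hconst _ t ht']
      exact h6 τ ⟨hτ.le, le_rfl⟩
  have hfix : ∀ Γ, IsVolterraSol τ ν a Γ →
      ∀ u, leftLim Γ u = ∫ v in Ioo 0 u, b (leftLim Γ v) v ∂ν := by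
    intro Γ h u
    rw [← volterra_left ν _ (hint _ (hlm Γ h)) (fun v => (hbB _ _).1) u, ← hall Γ h]
  refine ⟨⟨fun t => ∫ u in Ioc 0 t, b (g u) u ∂ν, ?_, ?_⟩, ?_⟩
  · refine ⟨volterra_mono ν _ (hint g hgm) (fun v => (hbB _ _).1), ?_, ?_,
      volterra_right ν _ (hint g hgm), fun t => integral_nonneg fun v => (hbB _ _).1, ?_⟩
    · intro t ht
      simp [Ioc_eq_empty (not_lt.2 ht)]
    · exact fun t ht => hconst _ t ht
    · intro t _
      have e : leftLim (fun t => ∫ u in Ioc 0 t, b (g u) u ∂ν) = g := by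
        funext u
        rw [volterra_left ν _ (hint g hgm) (fun v => (hbB _ _).1) u, ← hg u]
      rw [e]
  · intro Γ h
    have e : leftLim Γ = g := huniq _ _ (hlm Γ h) hgm (hfix Γ h) hg
    rw [hall Γ h, e]
  · intro Γ h t _
    have e := congrFun (hall Γ h) t
    have i := (hint _ (hlm Γ h)).integrableOn (s := Ioc 0 t)
    have hc : ∀ c : ℝ, ∫ _ in Ioc 0 t, c ∂ν = c * (ν (Ioc 0 t)).toReal := by
      intro c
      simp [mul_comm, Measure.real]
    rw [e, ← hc, ← hc]
    exact ⟨integral_mono (integrable_const _) i fun v => inv_anti₀ (ha0 _ _) (hbd _ _).2,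
      integral_mono i (integrable_const _) fun v => (hbB _ _).2⟩
end

section
/- In the setting of Proposition 2.3, define the kernel k(t,u)=c((0,t∧u]) for t,u∈(0,τ] and set Δ̃(t,u)=Ψ_0(0,τ)^{−1}·Ψ_1(0,t∧u)·Ψ_0(t∨u,τ) (note Ψ_0(0,τ)≥1>0). Then Δ̃ is the resolvent of k at λ=−1: for all t,u∈(0,τ], k(t,u) = Δ̃(t,u) + ∫_{(0,τ]} Δ̃(t,w) k(w,u) b(dw) and k(t,u) = Δ̃(t,u) + ∫_{(0,τ]} k(t,w) Δ̃(w,u) b(dw). -/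
open MeasureTheory Set

/-- `Ψ_{0n}(s,t−)`: the open-right-endpoint version of `Ψ_{0n}(s,t)`. -/
noncomputable def Psi0m (c b : Measure ℝ) : ℕ → ℝ → ℝ → ℝ
  | 0, _, _ => 1
  | n + 1, s, t =>
      ∫ u₂ in Set.Ioo s t, (∫ u₁ in Set.Ioc s u₂, Psi0m c b n s u₁ ∂c) ∂b

/-- `Ψ_{0n}(s,t)`. -/
noncomputable def Psi0n (c b : Measure ℝ) : ℕ → ℝ → ℝ → ℝ
  | 0, _, _ => 1
  | n + 1, s, t =>
      ∫ u₂ in Set.Ioc s t, (∫ u₁ in Set.Ioc s u₂, Psi0m c b n s u₁ ∂c) ∂b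

/-- `Ψ_{1n}(s,t−)`. -/
noncomputable def Psi1m (c b : Measure ℝ) (n : ℕ) (s t : ℝ) : ℝ :=
  ∫ u in Set.Ioo s t, Psi0m c b n s u ∂c

/-- `Ψ_{1n}(s,t)`, with the degenerate conventions `Ψ_{10}(t,t)=c({t})`,
`Ψ_{1n}(t,t)=0` for `n ≥ 1`. -/
noncomputable def Psi1n (c b : Measure ℝ) (n : ℕ) (s t : ℝ) : ℝ :=
  if s = t then (if n = 0 then (c {t}).toReal else 0)
  else ∫ u in Set.Ioc s t, Psi0m c b n s u ∂c

/-- `Ψ_{2n}(s,t)`. -/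
noncomputable def Psi2n (c b : Measure ℝ) : ℕ → ℝ → ℝ → ℝ
  | 0, _, _ => 1
  | n + 1, s, t => ∫ u in Set.Ico s t, Psi1m c b n u t ∂b

/-- `Ψ_{2n}(s,t+)`: the closed-right-endpoint version of `Ψ_{2n}(s,t)`. -/
noncomputable def Psi2p (c b : Measure ℝ) : ℕ → ℝ → ℝ → ℝ
  | 0, _, _ => 1
  | n + 1, s, t => ∫ u in Set.Icc s t, Psi1m c b n u t ∂b

/-- `Ψ_{3n}(s,t)`, with the degenerate conventions `Ψ_{30}(t,t)=b({t})`,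
`Ψ_{3n}(t,t)=0` for `n ≥ 1`. -/
noncomputable def Psi3n (c b : Measure ℝ) (n : ℕ) (s t : ℝ) : ℝ :=
  if s = t then (if n = 0 then (b {t}).toReal else 0)
  else ∫ u in Set.Ico s t, Psi2n c b n s u ∂b

/-- `Ψ_{3n}(s,t+)`. -/
noncomputable def Psi3p (c b : Measure ℝ) (n : ℕ) (s t : ℝ) : ℝ :=
  ∫ u in Set.Icc s t, Psi2n c b n s u ∂b

/-- `Ψ_0(s,t) = Σ_{n≥0} Ψ_{0n}(s,t)` (and `0` when `s > t`). -/
noncomputable def PsiS0 (c b : Measure ℝ) (s t : ℝ) : ℝ :=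
  if t < s then 0 else ∑' n, Psi0n c b n s t

/-- `Ψ_0(s,t−) = Σ_{n≥0} Ψ_{0n}(s,t−)`. -/
noncomputable def PsiS0m (c b : Measure ℝ) (s t : ℝ) : ℝ := ∑' n, Psi0m c b n s t

/-- `Ψ_1(s,t) = Σ_{n≥0} Ψ_{1n}(s,t)` (and `0` when `s > t`). -/
noncomputable def PsiS1 (c b : Measure ℝ) (s t : ℝ) : ℝ :=
  if t < s then 0 else ∑' n, Psi1n c b n s t

/-- `Ψ_1(s,t−) = Σ_{n≥0} Ψ_{1n}(s,t−)`. -/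
noncomputable def PsiS1m (c b : Measure ℝ) (s t : ℝ) : ℝ := ∑' n, Psi1m c b n s t

/-- `Ψ_2(s,t) = Σ_{n≥0} Ψ_{2n}(s,t)` (and `0` when `s > t`). -/
noncomputable def PsiS2 (c b : Measure ℝ) (s t : ℝ) : ℝ :=
  if t < s then 0 else ∑' n, Psi2n c b n s t

/-- `Ψ_2(s,t+) = Σ_{n≥0} Ψ_{2n}(s,t+)`. -/
noncomputable def PsiS2p (c b : Measure ℝ) (s t : ℝ) : ℝ := ∑' n, Psi2p c b n s t

/-- `Ψ_3(s,t) = Σ_{n≥0} Ψ_{3n}(s,t)` (and `0` when `s > t`). -/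
noncomputable def PsiS3 (c b : Measure ℝ) (s t : ℝ) : ℝ :=
  if t < s then 0 else ∑' n, Psi3n c b n s t

/-- `Ψ_3(s,t+) = Σ_{n≥0} Ψ_{3n}(s,t+)`. -/
noncomputable def PsiS3p (c b : Measure ℝ) (s t : ℝ) : ℝ := ∑' n, Psi3p c b n s t

/-- `κ(τ) = ∫_{(0,τ]} c((0,u]) b(du)`. -/
noncomputable def kappaC (c b : Measure ℝ) (τ : ℝ) : ℝ :=
  ∫ u in Set.Ioc 0 τ, (c (Set.Ioc 0 u)).toReal ∂b

/-- The kernel `k(t,u) = c((0, t∧u])`. -/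
noncomputable def kerK (c : Measure ℝ) (t u : ℝ) : ℝ := (c (Set.Ioc 0 (min t u))).toReal

/-- The resolvent `Δ̃(t,u) = Ψ_0(0,τ)⁻¹ · Ψ_1(0, t∧u) · Ψ_0(t∨u, τ)`. -/
noncomputable def resD (c b : Measure ℝ) (τ t u : ℝ) : ℝ :=
  (PsiS0 c b 0 τ)⁻¹ * PsiS1 c b 0 (min t u) * PsiS0 c b (max t u) τ

open scoped ENNReal

theorem hp_fubini (c b : Measure ℝ) [IsFiniteMeasure c] [IsFiniteMeasure b]
    (r : ℝ → ℝ → Prop) (hr : MeasurableSet {p : ℝ × ℝ | r p.1 p.2})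
    (f h : ℝ → ℝ≥0∞) (hf : Measurable f) (hh : Measurable h) :
    ∫⁻ v, f v * (∫⁻ w in {w | r v w}, h w ∂b) ∂c
      = ∫⁻ w, (∫⁻ v in {v | r v w}, f v ∂c) * h w ∂b := by
  have m1 : ∀ v, MeasurableSet {w | r v w} := fun v => measurable_prodMk_left hr
  have m2 : ∀ w, MeasurableSet {v | r v w} := fun w => measurable_prodMk_right hr
  have key : Measurable (fun p : ℝ × ℝ =>
      ({p : ℝ × ℝ | r p.1 p.2}).indicator (fun p => f p.1 * h p.2) p) :=
    ((hf.comp measurable_fst).mul (hh.comp measurable_snd)).indicator hr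
  have e1 : ∀ v, f v * (∫⁻ w in {w | r v w}, h w ∂b)
      = ∫⁻ w, ({p : ℝ × ℝ | r p.1 p.2}).indicator (fun p => f p.1 * h p.2) (v, w) ∂b := by
    intro v
    rw [← lintegral_const_mul _ hh, ← lintegral_indicator (m1 v)]
    rfl
  have e2 : ∀ w, (∫⁻ v in {v | r v w}, f v ∂c) * h w
      = ∫⁻ v, ({p : ℝ × ℝ | r p.1 p.2}).indicator (fun p => f p.1 * h p.2) (v, w) ∂c := by
    intro w
    rw [← lintegral_mul_const _ hf, ← lintegral_indicator (m2 w)]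
    rfl
  simp_rw [e1, e2]
  exact lintegral_lintegral_swap key.aemeasurable

theorem hp_F1 (c b : Measure ℝ) [IsFiniteMeasure c] [IsFiniteMeasure b] (s t : ℝ)
    (f h : ℝ → ℝ≥0∞) (hf : Measurable f) (hh : Measurable h) :
    ∫⁻ v in Ioc s t, f v * (∫⁻ w in Icc v t, h w ∂b) ∂c
      = ∫⁻ w in Ioc s t, (∫⁻ v in Ioc s w, f v ∂c) * h w ∂b := by
  have := hp_fubini (c.restrict (Ioc s t)) (b.restrict (Ioc s t)) (fun v w => v ≤ w)
    (measurableSet_le measurable_fst measurable_snd) f h hf hh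
  convert this using 1
  · refine setLIntegral_congr_fun measurableSet_Ioc fun v hv => ?_
    show _ = _
    rw [Measure.restrict_restrict (show MeasurableSet {w | v ≤ w} from measurableSet_Ici)]
    congr 3
    ext w; simp only [mem_Icc, mem_inter_iff, mem_ofPred_eq, mem_Ioc]
    constructor
    · rintro ⟨h1, h2⟩; exact ⟨h1, lt_of_lt_of_le hv.1 h1, h2⟩
    · rintro ⟨h1, h2⟩; exact ⟨h1, h2.2⟩
  · refine setLIntegral_congr_fun measurableSet_Ioc fun v hv => ?_
    show _ = _
    rw [Measure.restrict_restrict (show MeasurableSet {w | w ≤ v} from measurableSet_Iic)]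
    congr 3
    ext w; simp only [mem_inter_iff, mem_ofPred_eq, mem_Ioc]
    constructor
    · rintro ⟨h1, h2⟩; exact ⟨h2, h1, h2.trans hv.2⟩
    · rintro ⟨h1, h2⟩; exact ⟨h2.1, h1⟩

theorem hp_F2 (c b : Measure ℝ) [IsFiniteMeasure c] [IsFiniteMeasure b] (s t : ℝ)
    (f h : ℝ → ℝ≥0∞) (hf : Measurable f) (hh : Measurable h) :
    ∫⁻ v in Ioc s t, f v * (∫⁻ w in Ioc v t, h w ∂b) ∂c
      = ∫⁻ w in Ioc s t, (∫⁻ v in Ioo s w, f v ∂c) * h w ∂b := by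
  have := hp_fubini (c.restrict (Ioc s t)) (b.restrict (Ioc s t)) (fun v w => v < w)
    (measurableSet_lt measurable_fst measurable_snd) f h hf hh
  convert this using 1
  · refine setLIntegral_congr_fun measurableSet_Ioc fun v hv => ?_
    show _ = _
    rw [Measure.restrict_restrict (show MeasurableSet {w | v < w} from measurableSet_Ioi)]
    congr 3
    ext w; simp only [mem_inter_iff, mem_ofPred_eq, mem_Ioc]
    constructor
    · rintro ⟨h1, h2⟩; exact ⟨h1, lt_trans hv.1 h1, h2⟩
    · rintro ⟨h1, h2⟩; exact ⟨h1, h2.2⟩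
  · refine setLIntegral_congr_fun measurableSet_Ioc fun v hv => ?_
    show _ = _
    rw [Measure.restrict_restrict (show MeasurableSet {w | w < v} from measurableSet_Iio)]
    congr 3
    ext w; simp only [mem_inter_iff, mem_ofPred_eq, mem_Ioc, mem_Ioo]
    constructor
    · rintro ⟨h1, h2⟩; exact ⟨h2, h1, h2.le.trans hv.2⟩
    · rintro ⟨h1, h2⟩; exact ⟨h2.1, h1⟩

theorem hp_split (b : Measure ℝ) (f : ℝ → ℝ≥0∞) (S T U : Set ℝ) (hT : MeasurableSet T)
    (hU : S ∪ T = U) (hd : Disjoint S T) :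
    ∫⁻ x in U, f x ∂b = ∫⁻ x in S, f x ∂b + ∫⁻ x in T, f x ∂b := by
  rw [← hU, lintegral_union hT hd]

theorem hp_split_Icc (b : Measure ℝ) (f : ℝ → ℝ≥0∞) {v u t : ℝ} (h1 : v ≤ u) (h2 : u ≤ t) :
    ∫⁻ x in Icc v t, f x ∂b = ∫⁻ x in Icc v u, f x ∂b + ∫⁻ x in Ioc u t, f x ∂b := by
  refine hp_split b f _ _ _ measurableSet_Ioc (Icc_union_Ioc_eq_Icc h1 h2) ?_
  rw [Set.disjoint_left]; intro x hx hy; exact absurd hx.2 (not_le.2 hy.1)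

theorem hp_split_Ioc (b : Measure ℝ) (f : ℝ → ℝ≥0∞) {v u t : ℝ} (h1 : v ≤ u) (h2 : u ≤ t) :
    ∫⁻ x in Ioc v t, f x ∂b = ∫⁻ x in Ioc v u, f x ∂b + ∫⁻ x in Ioc u t, f x ∂b := by
  refine hp_split b f _ _ _ measurableSet_Ioc (Ioc_union_Ioc_eq_Ioc h1 h2) ?_
  rw [Set.disjoint_left]; intro x hx hy; exact absurd hx.2 (not_le.2 hy.1)

theorem hp_split_Ioo (b : Measure ℝ) (f : ℝ → ℝ≥0∞) {v u t : ℝ} (h1 : v < u) (h2 : u ≤ t) :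
    ∫⁻ x in Ioc v t, f x ∂b = ∫⁻ x in Ioo v u, f x ∂b + ∫⁻ x in Icc u t, f x ∂b := by
  refine hp_split b f _ _ _ measurableSet_Icc (Ioo_union_Icc_eq_Ioc h1 h2) ?_
  rw [Set.disjoint_left]; intro x hx hy; exact absurd hx.2 (not_lt.2 hy.1)

theorem hp_wronskian (c b : Measure ℝ) [IsFiniteMeasure c] [IsFiniteMeasure b] (s u τ : ℝ)
    (hsu : s ≤ u) (huτ : u ≤ τ)
    (P A G B : ℝ → ℝ≥0∞) (mP : Measurable P) (mA : Measurable A) (mG : Measurable G)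
    (mB : Measurable B)
    (hP : ∀ x, P x = 1 + ∫⁻ w in Ioo s x, A w ∂b) (hA : ∀ x, A x = ∫⁻ v in Ioc s x, P v ∂c)
    (hG : ∀ x, G x = 1 + ∫⁻ v in Ioc x τ, B v ∂c) (hB : ∀ x, B x = ∫⁻ w in Icc x τ, G w ∂b)
    (M N : ℝ≥0∞) (hM : M ≠ ∞) (hN : N ≠ ∞) (hPM : ∀ x, P x ≤ M) (hBN : ∀ x, B x ≤ N) :
    A u * (∫⁻ w in Ioc u τ, G w ∂b) + G u * (1 + ∫⁻ w in Ioc s u, A w ∂b) = G s := by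
  have E1 : ∫⁻ v in Ioc s u, P v * B v ∂c
      = A u * (∫⁻ w in Ioc u τ, G w ∂b) + ∫⁻ w in Ioc s u, A w * G w ∂b := by
    have : ∫⁻ v in Ioc s u, P v * B v ∂c = ∫⁻ v in Ioc s u,
        (P v * (∫⁻ w in Ioc u τ, G w ∂b) + P v * (∫⁻ w in Icc v u, G w ∂b)) ∂c := by
      refine setLIntegral_congr_fun measurableSet_Ioc fun v hv => ?_
      show _ = _
      rw [hB v, hp_split_Icc b G hv.2 huτ, mul_add, add_comm]
    rw [this, lintegral_add_left (mP.mul_const _), hp_F1 c b s u P G mP mG,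
      lintegral_mul_const _ mP, ← hA]
    simp_rw [← hA]
  have hGs : ∀ w, w ≤ u → G w = G u + ∫⁻ v in Ioc w u, B v ∂c := by
    intro w hw
    rw [hG w, hG u, hp_split_Ioc c B hw huτ]
    ring
  have E2 : ∫⁻ w in Ioc s u, A w * G w ∂b = (∫⁻ w in Ioc s u, A w ∂b) * G u
      + ∫⁻ v in Ioc s u, (∫⁻ w in Ioo s v, A w ∂b) * B v ∂c := by
    have : ∫⁻ w in Ioc s u, A w * G w ∂b = ∫⁻ w in Ioc s u,
        (A w * G u + A w * (∫⁻ v in Ioc w u, B v ∂c)) ∂b := by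
      refine setLIntegral_congr_fun measurableSet_Ioc fun v hv => ?_
      show _ = _
      rw [hGs v hv.2, mul_add]
    rw [this, lintegral_add_left (mA.mul_const _), hp_F2 b c s u A B mA mB,
      lintegral_mul_const _ mA]
  have E3 : ∫⁻ v in Ioc s u, P v * B v ∂c = ∫⁻ v in Ioc s u, B v ∂c
      + ∫⁻ v in Ioc s u, (∫⁻ w in Ioo s v, A w ∂b) * B v ∂c := by
    rw [← lintegral_add_left mB]
    refine lintegral_congr fun v => ?_
    rw [hP v]; ring
  have fin : ∫⁻ v in Ioc s u, (∫⁻ w in Ioo s v, A w ∂b) * B v ∂c ≠ ∞ := by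
    have : ∫⁻ v in Ioc s u, (∫⁻ w in Ioo s v, A w ∂b) * B v ∂c ≤ ∫⁻ v in Ioc s u, M * N ∂c := by
      refine lintegral_mono fun v => mul_le_mul' ?_ (hBN v)
      refine le_trans ?_ (hPM v)
      rw [hP v]; exact le_add_self
    refine ne_top_of_le_ne_top ?_ this
    rw [setLIntegral_const]
    exact ENNReal.mul_ne_top (ENNReal.mul_ne_top hM hN) (measure_ne_top _ _)
  have E4 : ∫⁻ v in Ioc s u, B v ∂c
      = A u * (∫⁻ w in Ioc u τ, G w ∂b) + (∫⁻ w in Ioc s u, A w ∂b) * G u := by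
    have := E3.symm.trans (E1.trans (by rw [E2, ← add_assoc]))
    exact (ENNReal.add_left_inj fin).1 this
  rw [hGs s hsu, E4]; ring

/-- iterated strict chains -/
noncomputable def hpI (b : Measure ℝ) (r : ℝ → ℝ → Prop) : ℕ → ℝ → ℝ≥0∞
  | 0, _ => 1
  | n + 1, t => ∫⁻ u in {u | r u t}, hpI b r n u ∂b

theorem hpI_meas (b : Measure ℝ) [IsFiniteMeasure b] (r : ℝ → ℝ → Prop)
    (hr : MeasurableSet {p : ℝ × ℝ | r p.1 p.2}) (n : ℕ) : Measurable (hpI b r n) := by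
  induction n with
  | zero => exact measurable_const
  | succ n ih =>
    have m2 : ∀ w, MeasurableSet {v | r v w} := fun w => measurable_prodMk_right hr
    have key : Measurable (fun p : ℝ × ℝ =>
        ({p : ℝ × ℝ | r p.1 p.2}).indicator (fun p => hpI b r n p.1) p) :=
      (ih.comp measurable_fst).indicator hr
    have := key.lintegral_prod_left' (μ := b)
    convert this using 2 with t
    rw [hpI, ← lintegral_indicator (m2 t)]
    rfl

theorem hpI_step (b : Measure ℝ) [IsFiniteMeasure b] (r : ℝ → ℝ → Prop)
    (hr : MeasurableSet {p : ℝ × ℝ | r p.1 p.2})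
    (htr : ∀ x y z, r x y → r y z → r x z) (has : ∀ x y, r x y → ¬ r y x) (n : ℕ) (t : ℝ) :
    ((n : ℝ≥0∞) + 1) * hpI b r (n + 1) t ≤ b {u | r u t} * hpI b r n t := by
  have m1 : ∀ v, MeasurableSet {w | r v w} := fun v => measurable_prodMk_left hr
  have m2 : ∀ w, MeasurableSet {v | r v w} := fun w => measurable_prodMk_right hr
  induction n generalizing t with
  | zero => simp [hpI]
  | succ n ih =>
    have mI := hpI_meas b r hr n
    have a1 : hpI b r (n + 2) t
        = ∫⁻ u in {u | r u t}, hpI b r n u * b ({v | r u v} ∩ {v | r v t}) ∂b := by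
      have := hp_fubini b (b.restrict {u | r u t}) r hr (hpI b r n) (fun _ => 1) mI
        measurable_const
      simp only [mul_one] at this
      rw [hpI]
      simp_rw [hpI]
      rw [← this, ← lintegral_indicator (m2 t)]
      refine lintegral_congr fun u => ?_
      rw [setLIntegral_const, Measure.restrict_apply (m1 u), one_mul]
      by_cases hu : r u t
      · rw [indicator_of_mem (by exact hu)]
      · rw [indicator_of_notMem (by exact hu)]
        have : {v | r u v} ∩ {v | r v t} = ∅ := by
          ext v; simp only [mem_inter_iff, mem_ofPred_eq, mem_empty_iff_false, iff_false]
          rintro ⟨h1, h2⟩; exact hu (htr _ _ _ h1 h2)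
        rw [this]; simp
    have a2 : ((n : ℝ≥0∞) + 1) * hpI b r (n + 2) t
        ≤ ∫⁻ u in {u | r u t}, hpI b r n u * b {v | r v u} ∂b := by
      rw [hpI, ← lintegral_const_mul _ (hpI_meas b r hr (n + 1))]
      refine lintegral_mono fun u => ?_
      rw [mul_comm (hpI b r n u)]
      exact ih u
    have hm : Measurable fun u => b {v | r v u} := by
      have := hpI_meas b r hr 1
      convert this using 2 with u
      simp [hpI]
    calc (((n + 1 : ℕ) : ℝ≥0∞) + 1) * hpI b r (n + 1 + 1) t
        = ((n : ℝ≥0∞) + 1) * hpI b r (n + 2) t + hpI b r (n + 2) t := by push_cast; ring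
      _ ≤ ∫⁻ u in {u | r u t}, hpI b r n u * b {v | r v u} ∂b
          + ∫⁻ u in {u | r u t}, hpI b r n u * b ({v | r u v} ∩ {v | r v t}) ∂b :=
        add_le_add a2 a1.le
      _ = ∫⁻ u in {u | r u t}, (hpI b r n u * b {v | r v u}
          + hpI b r n u * b ({v | r u v} ∩ {v | r v t})) ∂b :=
        (lintegral_add_left (mI.mul hm) _).symm
      _ ≤ ∫⁻ u in {u | r u t}, b {u | r u t} * hpI b r n u ∂b := by
        refine setLIntegral_mono (mI.const_mul _) fun u hu => ?_
        rw [← mul_add, mul_comm (b {u | r u t})]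
        gcongr
        rw [← measure_union _ ((m1 u).inter (m2 t))]
        · refine measure_mono ?_
          rintro v (hv | hv)
          · exact htr _ _ _ hv hu
          · exact hv.2
        · rw [Set.disjoint_left]
          intro v hv hv'
          exact has _ _ hv hv'.1
      _ = b {u | r u t} * hpI b r (n + 1) t := by
        rw [lintegral_const_mul _ mI, hpI]

theorem hpI_bound (b : Measure ℝ) [IsFiniteMeasure b] (r : ℝ → ℝ → Prop)
    (hr : MeasurableSet {p : ℝ × ℝ | r p.1 p.2})
    (htr : ∀ x y z, r x y → r y z → r x z) (has : ∀ x y, r x y → ¬ r y x) (n : ℕ) (t : ℝ) :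
    (n.factorial : ℝ≥0∞) * hpI b r n t ≤ (b univ) ^ n := by
  induction n with
  | zero => simp [hpI]
  | succ n ih =>
    calc ((n + 1).factorial : ℝ≥0∞) * hpI b r (n + 1) t
        = (n.factorial : ℝ≥0∞) * (((n : ℝ≥0∞) + 1) * hpI b r (n + 1) t) := by
          rw [Nat.factorial_succ]; push_cast; ring
      _ ≤ (n.factorial : ℝ≥0∞) * (b {u | r u t} * hpI b r n t) := by
          exact mul_le_mul_right (hpI_step b r hr htr has n t) _
      _ ≤ (n.factorial : ℝ≥0∞) * (b univ * hpI b r n t) := by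
          gcongr; exact subset_univ _
      _ = b univ * ((n.factorial : ℝ≥0∞) * hpI b r n t) := by ring
      _ ≤ b univ * (b univ) ^ n := by gcongr
      _ = _ := by ring

theorem hp_exp_fin (x : ℝ≥0∞) (hx : x ≠ ∞) : ∑' n : ℕ, x ^ n / (n.factorial : ℝ≥0∞) ≠ ∞ := by
  have h := (Real.summable_pow_div_factorial x.toReal).tsum_ofReal_ne_top
  convert h using 3 with n
  rw [ENNReal.ofReal_div_of_pos (by positivity), ENNReal.ofReal_pow ENNReal.toReal_nonneg,
    ENNReal.ofReal_toReal hx, ENNReal.ofReal_natCast]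

noncomputable def hpP (c b : Measure ℝ) (s : ℝ) : ℕ → ℝ → ℝ≥0∞
  | 0, _ => 1
  | n + 1, t => ∫⁻ w in Ioo s t, (∫⁻ u in Ioc s w, hpP c b s n u ∂c) ∂b

noncomputable def hpQ (c b : Measure ℝ) (τ : ℝ) : ℕ → ℝ → ℝ≥0∞
  | 0, _ => 1
  | n + 1, x => ∫⁻ u in Ioc x τ, (∫⁻ w in Icc u τ, hpQ c b τ n w ∂b) ∂c

theorem hp_mIoo (b : Measure ℝ) (f : ℝ → ℝ≥0∞) (s : ℝ) :
    Measurable fun t => ∫⁻ w in Ioo s t, f w ∂b :=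
  Monotone.measurable fun _ _ h => lintegral_mono_set (Ioo_subset_Ioo_right h)

theorem hp_mIoc (b : Measure ℝ) (f : ℝ → ℝ≥0∞) (s : ℝ) :
    Measurable fun t => ∫⁻ w in Ioc s t, f w ∂b :=
  Monotone.measurable fun _ _ h => lintegral_mono_set (Ioc_subset_Ioc_right h)

theorem hp_mIoc' (b : Measure ℝ) (f : ℝ → ℝ≥0∞) (t : ℝ) :
    Measurable fun s => ∫⁻ w in Ioc s t, f w ∂b :=
  Antitone.measurable fun _ _ h => lintegral_mono_set (Ioc_subset_Ioc_left h)

theorem hp_mIcc' (b : Measure ℝ) (f : ℝ → ℝ≥0∞) (t : ℝ) :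
    Measurable fun s => ∫⁻ w in Icc s t, f w ∂b :=
  Antitone.measurable fun _ _ h => lintegral_mono_set (Icc_subset_Icc_left h)

theorem hpP_meas (c b : Measure ℝ) (s : ℝ) (n : ℕ) : Measurable (hpP c b s n) := by
  cases n with
  | zero => exact measurable_const
  | succ n => exact hp_mIoo b _ s

theorem hpQ_meas (c b : Measure ℝ) (τ : ℝ) (n : ℕ) : Measurable (hpQ c b τ n) := by
  cases n with
  | zero => exact measurable_const
  | succ n => exact hp_mIoc' c _ τ

theorem hpP_le (c b : Measure ℝ) [IsFiniteMeasure c] [IsFiniteMeasure b] (s : ℝ) (n : ℕ) (t : ℝ) :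
    hpP c b s n t ≤ (c univ) ^ n * hpI b (fun x y => x < y) n t := by
  induction n generalizing t with
  | zero => simp [hpP, hpI]
  | succ n ih =>
    have hmono : Monotone (hpI b (fun x y => x < y) n) := by
      cases n with
      | zero => exact monotone_const
      | succ n => exact fun _ _ h => lintegral_mono_set (fun x (hx : x < _) => lt_of_lt_of_le hx h)
    have mI := hmono.measurable
    rw [hpP, hpI, ← lintegral_const_mul _ mI]
    refine le_trans (lintegral_mono_set (t := {u | u < t}) (fun x hx => hx.2)) ?_
    refine lintegral_mono fun w => ?_
    calc ∫⁻ u in Ioc s w, hpP c b s n u ∂c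
        ≤ ∫⁻ u in Ioc s w, (c univ) ^ n * hpI b (fun x y => x < y) n w ∂c := by
          refine setLIntegral_mono measurable_const fun u hu => (ih u).trans ?_
          exact mul_le_mul_right (hmono hu.2) _
      _ = ((c univ) ^ n * hpI b (fun x y => x < y) n w) * c (Ioc s w) := setLIntegral_const _ _
      _ ≤ ((c univ) ^ n * hpI b (fun x y => x < y) n w) * c univ := by
          gcongr; exact subset_univ _
      _ = _ := by ring

theorem hpQ_le (c b : Measure ℝ) [IsFiniteMeasure c] [IsFiniteMeasure b] (τ : ℝ) (n : ℕ) (t : ℝ) :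
    hpQ c b τ n t ≤ (c univ) ^ n * hpI b (fun x y => y < x) n t := by
  induction n generalizing t with
  | zero => simp [hpQ, hpI]
  | succ n ih =>
    have hmono : Antitone (hpI b (fun x y => y < x) n) := by
      cases n with
      | zero => exact antitone_const
      | succ n => exact fun _ _ h => lintegral_mono_set (fun x (hx : _ < x) => lt_of_le_of_lt h hx)
    have mI := hmono.measurable
    rw [hpQ, hpI]
    calc ∫⁻ u in Ioc t τ, (∫⁻ w in Icc u τ, hpQ c b τ n w ∂b) ∂c
        ≤ ∫⁻ u in Ioc t τ, ((c univ) ^ n * ∫⁻ w in {w | t < w}, hpI b (fun x y => y < x) n w ∂b) ∂c := by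
          refine setLIntegral_mono measurable_const fun u hu => ?_
          rw [← lintegral_const_mul _ mI]
          refine le_trans (lintegral_mono_set (t := {w | t < w})
            (fun x hx => lt_of_lt_of_le hu.1 hx.1)) ?_
          exact lintegral_mono fun w => ih w
      _ = ((c univ) ^ n * ∫⁻ w in {w | t < w}, hpI b (fun x y => y < x) n w ∂b) * c (Ioc t τ) :=
          setLIntegral_const _ _
      _ ≤ ((c univ) ^ n * ∫⁻ w in {w | t < w}, hpI b (fun x y => y < x) n w ∂b) * c univ := by
          gcongr; exact subset_univ _
      _ = _ := by ring

noncomputable def hpM (c b : Measure ℝ) : ℝ≥0∞ :=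
  ∑' n : ℕ, (c univ * b univ) ^ n / (n.factorial : ℝ≥0∞)

theorem hpM_fin (c b : Measure ℝ) [IsFiniteMeasure c] [IsFiniteMeasure b] : hpM c b ≠ ∞ :=
  hp_exp_fin _ (ENNReal.mul_ne_top (measure_ne_top _ _) (measure_ne_top _ _))

theorem hp_term_le (x y i : ℝ≥0∞) (n : ℕ) (h : (n.factorial : ℝ≥0∞) * i ≤ y ^ n) :
    x ^ n * i ≤ (x * y) ^ n / (n.factorial : ℝ≥0∞) := by
  rw [ENNReal.le_div_iff_mul_le (Or.inl (by exact_mod_cast n.factorial_ne_zero))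
    (Or.inl (ENNReal.natCast_ne_top _)), mul_pow, mul_assoc, mul_comm i]
  exact mul_le_mul_right h _

noncomputable def hpPs (c b : Measure ℝ) (s t : ℝ) : ℝ≥0∞ := ∑' n, hpP c b s n t
noncomputable def hpA (c b : Measure ℝ) (s t : ℝ) : ℝ≥0∞ := ∫⁻ u in Ioc s t, hpPs c b s u ∂c
noncomputable def hpG (c b : Measure ℝ) (τ x : ℝ) : ℝ≥0∞ := ∑' n, hpQ c b τ n x
noncomputable def hpB (c b : Measure ℝ) (τ x : ℝ) : ℝ≥0∞ := ∫⁻ w in Icc x τ, hpG c b τ w ∂b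

theorem hpPs_le (c b : Measure ℝ) [IsFiniteMeasure c] [IsFiniteMeasure b] (s t : ℝ) :
    hpPs c b s t ≤ hpM c b := by
  refine ENNReal.tsum_le_tsum fun n => (hpP_le c b s n t).trans (hp_term_le _ _ _ _ ?_)
  exact hpI_bound b (fun x y => x < y) (measurableSet_lt measurable_fst measurable_snd)
    (fun x y z h1 h2 => lt_trans h1 h2) (fun x y h => not_lt.2 h.le) n t

theorem hpG_le (c b : Measure ℝ) [IsFiniteMeasure c] [IsFiniteMeasure b] (s t : ℝ) :
    hpG c b s t ≤ hpM c b := by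
  refine ENNReal.tsum_le_tsum fun n => (hpQ_le c b s n t).trans (hp_term_le _ _ _ _ ?_)
  exact hpI_bound b (fun x y => y < x) (measurableSet_lt measurable_snd measurable_fst)
    (fun x y z h1 h2 => lt_trans (a := z) (b := y) (c := x) h2 h1) (fun x y h => not_lt.2 h.le) n t

theorem hpPs_meas (c b : Measure ℝ) (s : ℝ) : Measurable (hpPs c b s) :=
  Measurable.tsum fun n => hpP_meas c b s n
theorem hpG_meas (c b : Measure ℝ) (s : ℝ) : Measurable (hpG c b s) :=
  Measurable.tsum fun n => hpQ_meas c b s n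
theorem hpA_meas (c b : Measure ℝ) (s : ℝ) : Measurable (hpA c b s) := hp_mIoc c _ s
theorem hpB_meas (c b : Measure ℝ) (s : ℝ) : Measurable (hpB c b s) := hp_mIcc' b _ s

theorem hpA_tsum (c b : Measure ℝ) (s t : ℝ) :
    hpA c b s t = ∑' n, ∫⁻ u in Ioc s t, hpP c b s n u ∂c :=
  lintegral_tsum fun n => (hpP_meas c b s n).aemeasurable

theorem hpA_int (c b : Measure ℝ) (s : ℝ) (S : Set ℝ) :
    ∫⁻ w in S, hpA c b s w ∂b = ∑' n, ∫⁻ w in S, (∫⁻ u in Ioc s w, hpP c b s n u ∂c) ∂b := by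
  simp_rw [hpA_tsum]
  exact lintegral_tsum fun n => (hp_mIoc c _ s).aemeasurable

theorem hpPs_eq (c b : Measure ℝ) (s x : ℝ) :
    hpPs c b s x = 1 + ∫⁻ w in Ioo s x, hpA c b s w ∂b := by
  rw [hpA_int, hpPs, tsum_eq_zero_add' ENNReal.summable]
  rfl

theorem hpG_eq (c b : Measure ℝ) (τ x : ℝ) :
    hpG c b τ x = 1 + ∫⁻ v in Ioc x τ, hpB c b τ v ∂c := by
  have : ∀ v, hpB c b τ v = ∑' n, ∫⁻ w in Icc v τ, hpQ c b τ n w ∂b := fun v =>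
    lintegral_tsum fun n => (hpQ_meas c b τ n).aemeasurable
  simp_rw [this]
  rw [lintegral_tsum fun n => (hp_mIcc' b _ τ).aemeasurable, hpG,
    tsum_eq_zero_add' ENNReal.summable]
  rfl

theorem hpA_le (c b : Measure ℝ) [IsFiniteMeasure c] [IsFiniteMeasure b] (s t : ℝ) :
    hpA c b s t ≤ hpM c b * c univ := by
  refine (lintegral_mono fun u => hpPs_le c b s u).trans ?_
  rw [setLIntegral_const]; gcongr; exact subset_univ _

theorem hpB_le (c b : Measure ℝ) [IsFiniteMeasure c] [IsFiniteMeasure b] (s t : ℝ) :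
    hpB c b s t ≤ hpM c b * b univ := by
  refine (lintegral_mono fun u => hpG_le c b s u).trans ?_
  rw [setLIntegral_const]; gcongr; exact subset_univ _

theorem hpA_fin (c b : Measure ℝ) [IsFiniteMeasure c] [IsFiniteMeasure b] (s t : ℝ) :
    hpA c b s t ≠ ∞ :=
  ne_top_of_le_ne_top (ENNReal.mul_ne_top (hpM_fin c b) (measure_ne_top _ _)) (hpA_le c b s t)

theorem hp_W (c b : Measure ℝ) [IsFiniteMeasure c] [IsFiniteMeasure b] (s u τ : ℝ)
    (hsu : s ≤ u) (huτ : u ≤ τ) :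
    hpA c b s u * (∫⁻ w in Ioc u τ, hpG c b τ w ∂b)
      + hpG c b τ u * (1 + ∫⁻ w in Ioc s u, hpA c b s w ∂b) = hpG c b τ s :=
  hp_wronskian c b s u τ hsu huτ (hpPs c b s) (hpA c b s) (hpG c b τ) (hpB c b τ)
    (hpPs_meas c b s) (hpA_meas c b s) (hpG_meas c b τ) (hpB_meas c b τ) (hpPs_eq c b s)
    (fun _ => rfl) (hpG_eq c b τ) (fun _ => rfl) (hpM c b) (hpM c b * b univ) (hpM_fin c b)
    (ENNReal.mul_ne_top (hpM_fin c b) (measure_ne_top _ _)) (hpPs_le c b s) (hpB_le c b τ)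

theorem hp_G_eq_forward (c b : Measure ℝ) [IsFiniteMeasure c] [IsFiniteMeasure b] (s τ : ℝ)
    (hs : s ≤ τ) : 1 + ∫⁻ w in Ioc s τ, hpA c b s w ∂b = hpG c b τ s := by
  rw [← hp_W c b s τ τ hs le_rfl, hpG_eq c b τ τ]
  simp

theorem hpP_fin (c b : Measure ℝ) [IsFiniteMeasure c] [IsFiniteMeasure b] (s : ℝ) (n : ℕ) (t : ℝ) :
    hpP c b s n t < ∞ :=
  lt_of_le_of_lt ((ENNReal.le_tsum n).trans (hpPs_le c b s t)) (hpM_fin c b).lt_top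

theorem hp_inner_fin (c b : Measure ℝ) [IsFiniteMeasure c] [IsFiniteMeasure b] (s : ℝ) (n : ℕ)
    (t : ℝ) : ∫⁻ u in Ioc s t, hpP c b s n u ∂c < ∞ := by
  refine lt_of_le_of_lt ?_ (hpA_fin c b s t).lt_top
  rw [hpA_tsum]
  exact ENNReal.le_tsum n

theorem hp_inner_eq (c b : Measure ℝ) [IsFiniteMeasure c] [IsFiniteMeasure b] (s : ℝ) (n : ℕ)
    (h : ∀ t, Psi0m c b n s t = (hpP c b s n t).toReal) (t : ℝ) :
    ∫ u in Ioc s t, Psi0m c b n s u ∂c = (∫⁻ u in Ioc s t, hpP c b s n u ∂c).toReal := by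
  simp_rw [h]
  exact integral_toReal (hpP_meas c b s n).aemeasurable
    (Filter.Eventually.of_forall fun u => hpP_fin c b s n u)

theorem hp_Psi0m (c b : Measure ℝ) [IsFiniteMeasure c] [IsFiniteMeasure b] (s : ℝ) (n : ℕ)
    (t : ℝ) : Psi0m c b n s t = (hpP c b s n t).toReal := by
  induction n generalizing t with
  | zero => simp [Psi0m, hpP]
  | succ n ih =>
    rw [Psi0m, hpP]
    simp_rw [hp_inner_eq c b s n ih]
    exact integral_toReal (hp_mIoc c _ s).aemeasurable
      (Filter.Eventually.of_forall fun u => hp_inner_fin c b s n u)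

theorem hp_PsiS0 (c b : Measure ℝ) [IsFiniteMeasure c] [IsFiniteMeasure b] (s τ : ℝ)
    (hs : s ≤ τ) : PsiS0 c b s τ = (hpG c b τ s).toReal := by
  have hfin : 1 + ∫⁻ w in Ioc s τ, hpA c b s w ∂b ≠ ∞ := by
    rw [hp_G_eq_forward c b s τ hs]
    exact ne_top_of_le_ne_top (hpM_fin c b) (hpG_le c b τ s)
  rw [PsiS0, if_neg (not_lt.2 hs), ← hp_G_eq_forward c b s τ hs]
  have key : 1 + ∫⁻ w in Ioc s τ, hpA c b s w ∂b
      = ∑' n, (Nat.casesOn n 1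
        (fun n => ∫⁻ w in Ioc s τ, (∫⁻ u in Ioc s w, hpP c b s n u ∂c) ∂b) : ℝ≥0∞) := by
    rw [hpA_int, tsum_eq_zero_add' (f := fun n : ℕ => (Nat.casesOn n 1
        (fun n => ∫⁻ w in Ioc s τ, (∫⁻ u in Ioc s w, hpP c b s n u ∂c) ∂b) : ℝ≥0∞))
        ENNReal.summable]
    rfl
  rw [key] at hfin ⊢
  rw [ENNReal.tsum_toReal_eq (fun n => ne_top_of_le_ne_top hfin (ENNReal.le_tsum n))]
  refine tsum_congr fun n => ?_
  cases n with
  | zero => simp [Psi0n]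
  | succ n =>
    rw [Psi0n]
    simp_rw [hp_inner_eq c b s n (hp_Psi0m c b s n)]
    exact integral_toReal (hp_mIoc c _ s).aemeasurable
      (Filter.Eventually.of_forall fun u => hp_inner_fin c b s n u)

theorem hp_PsiS1 (c b : Measure ℝ) [IsFiniteMeasure c] [IsFiniteMeasure b] (s t : ℝ)
    (hs : s < t) : PsiS1 c b s t = (hpA c b s t).toReal := by
  rw [PsiS1, if_neg (not_lt.2 hs.le), hpA_tsum,
    ENNReal.tsum_toReal_eq (fun n => (hp_inner_fin c b s n t).ne)]
  refine tsum_congr fun n => ?_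
  rw [Psi1n, if_neg hs.ne, hp_inner_eq c b s n (hp_Psi0m c b s n)]

theorem hp_final (c b : Measure ℝ) [IsFiniteMeasure c] [IsFiniteMeasure b] (τ t u : ℝ)
    (ht : t ∈ Ioc 0 τ) (hu : u ∈ Ioc 0 τ) :
    hpA c b 0 (min t u) * hpG c b τ (max t u)
      + ∫⁻ w in Ioc 0 τ, c (Ioc 0 (min t w)) * (hpA c b 0 (min w u) * hpG c b τ (max w u)) ∂b
      = hpG c b τ 0 * c (Ioc 0 (min t u)) := by
  set g : ℝ → ℝ≥0∞ := fun w => hpA c b 0 (min w u) * hpG c b τ (max w u) with hg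
  have mg : Measurable g :=
    ((hpA_meas c b 0).comp (measurable_id.min measurable_const)).mul
      ((hpG_meas c b τ).comp (measurable_id.max measurable_const))
  have mA := hpA_meas c b 0
  have mG := hpG_meas c b τ
  -- Fubini
  have F : ∫⁻ w in Ioc 0 τ, c (Ioc 0 (min t w)) * g w ∂b
      = ∫⁻ v in Ioc 0 t, (∫⁻ w in Icc v τ, g w ∂b) ∂c := by
    have h := hp_F1 c b 0 τ ((Iic t).indicator 1) g (measurable_one.indicator measurableSet_Iic) mg
    have e1 : ∀ w, ∫⁻ v in Ioc 0 w, (Iic t).indicator 1 v ∂c = c (Ioc 0 (min t w)) := by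
      intro w
      rw [lintegral_indicator_one measurableSet_Iic, Measure.restrict_apply measurableSet_Iic]
      congr 1
      ext x; simp only [mem_inter_iff, mem_Iic, mem_Ioc, le_min_iff]; tauto
    simp_rw [e1] at h
    rw [← h]
    have e2 : ∀ v, (Iic t).indicator (1 : ℝ → ℝ≥0∞) v * (∫⁻ w in Icc v τ, g w ∂b)
        = (Iic t).indicator (fun v => ∫⁻ w in Icc v τ, g w ∂b) v := by
      intro v
      by_cases hv : v ∈ Iic t <;> simp [hv]
    simp_rw [e2]
    rw [lintegral_indicator measurableSet_Iic, Measure.restrict_restrict measurableSet_Iic]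
    congr 2
    ext x; simp only [mem_inter_iff, mem_Iic, mem_Ioc]
    constructor
    · rintro ⟨h1, h2, h3⟩; exact ⟨h2, h1⟩
    · rintro ⟨h1, h2⟩; exact ⟨h2, h1, h2.trans ht.2⟩
  have mJ : Measurable fun v => ∫⁻ w in Icc v τ, g w ∂b := hp_mIcc' b g τ
  have hI : ∀ v, u ≤ v → ∫⁻ w in Icc v τ, g w ∂b = hpA c b 0 u * hpB c b τ v := by
    intro v hv
    rw [hpB, ← lintegral_const_mul _ mG]
    refine setLIntegral_congr_fun measurableSet_Icc fun w hw => ?_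
    simp only [hg]
    rw [min_eq_right (hv.trans hw.1), max_eq_left (hv.trans hw.1)]
  have hgt : ∫⁻ w in Ioc u τ, g w ∂b = hpA c b 0 u * ∫⁻ w in Ioc u τ, hpG c b τ w ∂b := by
    rw [← lintegral_const_mul _ mG]
    refine setLIntegral_congr_fun measurableSet_Ioc fun w hw => ?_
    simp only [hg]
    rw [min_eq_right hw.1.le, max_eq_left hw.1.le]
  have hII : ∀ v ∈ Ioc 0 u,
      hpPs c b 0 v * hpG c b τ u + ∫⁻ w in Icc v τ, g w ∂b = hpG c b τ 0 := by
    intro v hv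
    have hlt : ∫⁻ w in Icc v u, g w ∂b = (∫⁻ w in Icc v u, hpA c b 0 w ∂b) * hpG c b τ u := by
      rw [← lintegral_mul_const _ mA]
      refine setLIntegral_congr_fun measurableSet_Icc fun w hw => ?_
      simp only [hg]
      rw [min_eq_left hw.2, max_eq_right hw.2]
    rw [hp_split_Icc b g hv.2 hu.2, hlt, hgt, hpPs_eq, ← hp_W c b 0 u τ hu.1.le hu.2,
      hp_split_Ioo b (hpA c b 0) hv.1 hv.2]
    ring
  have hIII : ∀ t', t' ≤ u → hpA c b 0 t' * hpG c b τ u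
      + ∫⁻ v in Ioc 0 t', (∫⁻ w in Icc v τ, g w ∂b) ∂c = hpG c b τ 0 * c (Ioc 0 t') := by
    intro t' ht'
    rw [hpA, ← lintegral_mul_const _ (hpPs_meas c b 0),
      ← lintegral_add_left ((hpPs_meas c b 0).mul_const _), ← setLIntegral_const]
    exact setLIntegral_congr_fun measurableSet_Ioc fun v hv => hII v ⟨hv.1, hv.2.trans ht'⟩
  rw [F]
  rcases le_total t u with h | h
  · rw [min_eq_left h, max_eq_right h]
    exact hIII t h
  · rw [min_eq_right h, max_eq_left h, ← hIII u le_rfl, hp_split_Ioc c _ hu.1.le h]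
    have e : ∫⁻ v in Ioc u t, (∫⁻ w in Icc v τ, g w ∂b) ∂c
        = hpA c b 0 u * ∫⁻ v in Ioc u t, hpB c b τ v ∂c := by
      rw [← lintegral_const_mul _ (hpB_meas c b τ)]
      exact setLIntegral_congr_fun measurableSet_Ioc fun v hv => hI v hv.1.le
    rw [e, hpG_eq c b τ u, hpG_eq c b τ t, hp_split_Ioc c _ h ht.2]
    ring

theorem hp_second (τ : ℝ) (hτ : 0 < τ) (c b : Measure ℝ) [IsFiniteMeasure c] [IsFiniteMeasure b]
    (t u : ℝ) (ht : t ∈ Ioc 0 τ) (hu : u ∈ Ioc 0 τ) (h1 : 1 ≤ PsiS0 c b 0 τ) :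
    kerK c t u = resD c b τ t u + ∫ w in Set.Ioc 0 τ, kerK c t w * resD c b τ w u ∂b := by
  have hGf : ∀ x, hpG c b τ x ≠ ∞ := fun x => ne_top_of_le_ne_top (hpM_fin c b) (hpG_le c b τ x)
  have hres : ∀ w ∈ Ioc 0 τ, resD c b τ w u = (PsiS0 c b 0 τ)⁻¹ *
      (hpA c b 0 (min w u) * hpG c b τ (max w u)).toReal := by
    intro w hw
    rw [resD, hp_PsiS1 c b 0 _ (lt_min hw.1 hu.1), hp_PsiS0 c b _ τ (max_le hw.2 hu.2),
      ENNReal.toReal_mul, mul_assoc]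
  have hint : ∫ w in Set.Ioc 0 τ, kerK c t w * resD c b τ w u ∂b = (PsiS0 c b 0 τ)⁻¹ *
      (∫⁻ w in Ioc 0 τ, c (Ioc 0 (min t w)) *
        (hpA c b 0 (min w u) * hpG c b τ (max w u)) ∂b).toReal := by
    rw [← integral_toReal, ← integral_const_mul]
    · refine setIntegral_congr_fun measurableSet_Ioc fun w hw => ?_
      rw [hres w hw, ENNReal.toReal_mul (a := c _), kerK]
      ring
    · have mc : Measurable fun w => c (Ioc 0 (min t w)) :=
        Monotone.measurable fun _ _ h =>
          measure_mono (Ioc_subset_Ioc_right (min_le_min_left t h))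
      exact (mc.mul (((hpA_meas c b 0).comp (measurable_id.min measurable_const)).mul
        ((hpG_meas c b τ).comp (measurable_id.max measurable_const)))).aemeasurable
    · exact Filter.Eventually.of_forall fun w => (ENNReal.mul_ne_top (measure_ne_top _ _)
        (ENNReal.mul_ne_top (hpA_fin c b _ _) (hGf _))).lt_top
  have hf := hp_final c b τ t u ht hu
  have hR : hpG c b τ 0 * c (Ioc 0 (min t u)) ≠ ∞ :=
    ENNReal.mul_ne_top (hGf 0) (measure_ne_top _ _)
  rw [← hf] at hR
  have hf' := congrArg ENNReal.toReal hf
  rw [ENNReal.toReal_add (ENNReal.add_ne_top.1 hR).1 (ENNReal.add_ne_top.1 hR).2,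
    ENNReal.toReal_mul (a := hpG c b τ 0), ← hp_PsiS0 c b 0 τ hτ.le] at hf'
  rw [hint, hres t ht, ← mul_add, hf', kerK, inv_mul_cancel_left₀ (by linarith)]

theorem resolvent_equations_for_brownian_kernel
    (τ : ℝ) (hτ : 0 < τ) (c b : Measure ℝ) [IsFiniteMeasure c] [IsFiniteMeasure b]
    (hcsupp : c (Set.Ioc 0 τ)ᶜ = 0) (hbsupp : b (Set.Ioc 0 τ)ᶜ = 0) :
    1 ≤ PsiS0 c b 0 τ ∧
    ∀ t ∈ Set.Ioc (0:ℝ) τ, ∀ u ∈ Set.Ioc (0:ℝ) τ,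
      kerK c t u = resD c b τ t u + ∫ w in Set.Ioc 0 τ, resD c b τ t w * kerK c w u ∂b ∧
      kerK c t u = resD c b τ t u + ∫ w in Set.Ioc 0 τ, kerK c t w * resD c b τ w u ∂b := by
  have h1 : 1 ≤ PsiS0 c b 0 τ := by
    rw [hp_PsiS0 c b 0 τ hτ.le, ← ENNReal.toReal_one]
    refine ENNReal.toReal_mono (ne_top_of_le_ne_top (hpM_fin c b) (hpG_le c b τ 0)) ?_
    rw [hpG_eq]; exact le_self_add
  refine ⟨h1, fun t ht u hu => ⟨?_, hp_second τ hτ c b t u ht hu h1⟩⟩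
  have h := hp_second τ hτ c b u t hu ht h1
  have hk : ∀ x y, kerK c x y = kerK c y x := fun x y => by rw [kerK, kerK, min_comm]
  have hr : ∀ x y, resD c b τ x y = resD c b τ y x := fun x y => by
    rw [resD, resD, min_comm, max_comm]
  rw [hk t u, hr t u, h]
  congr 1
  refine integral_congr_ae (Filter.Eventually.of_forall fun w => ?_)
  show _ = _
  simp only []
  rw [hk u w, hr w t, mul_comm]
end

section
/- Let m ≥ 1, let 0 < s₁ < … < s_m be real numbers, let 0 ≤ t ≤ u, and let c:[0,∞)→ℝ be a function with c(0)=0. Let D̄ be the (m+1)×(m+1) matrix with rows and columns indexed by 0,1,…,m and entries D̄₀₀ = c(t∧u), D̄_{0j} = c(t∧s_j), D̄_{i0} = c(s_i∧u), and D̄_{ij} = c(s_i∧s_j) for 1 ≤ i,j ≤ m. Then: (a) if t ≤ u < s₁, det D̄ = c(t)·(c(s₁)−c(u))·∏_{j=2}^m (c(s_j)−c(s_{j−1})); (b) if s_i < t ≤ u < s_{i+1} for some 1 ≤ i ≤ m−1, det D̄ = [∏_{j=1}^i (c(s_j)−c(s_{j−1}))]·(c(t)−c(s_i))·(c(s_{i+1})−c(u))·[∏_{j=i+2}^m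 (c(s_j)−c(s_{j−1}))], with c(s₀)=0 and empty products equal to 1; (c) if s_m < t ≤ u, det D̄ = [∏_{j=1}^m (c(s_j)−c(s_{j−1}))]·(c(t)−c(s_m)); (d) in all remaining cases (i.e., when t ≤ s_i ≤ u for some i), det D̄ = 0. -/
/-- The bordered min-matrix `D̄_m(t,u;s₁,…,s_m)`: indices `0,…,m`, with
`D̄₀₀ = c(t∧u)`, `D̄_{0j} = c(t∧s_j)`, `D̄_{i0} = c(s_i∧u)`, `D̄_{ij} = c(s_i∧s_j)`. -/
noncomputable def borderedMinMatrix (m : ℕ) (c : ℝ → ℝ) (s : ℕ → ℝ) (t u : ℝ) :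
    Matrix (Fin (m + 1)) (Fin (m + 1)) ℝ :=
  Matrix.of fun i j =>
    c (min (if i.val = 0 then t else s i.val) (if j.val = 0 then u else s j.val))

/-- Determinant of a "semi-separable" matrix. -/
lemma semisep_det (m : ℕ) (a b : ℕ → ℝ) :
    (Matrix.of fun i j : Fin (m + 1) =>
      if i.val ≤ j.val then a i.val else b j.val).det =
      a 0 * ∏ k ∈ Finset.range m, (a (k + 1) - b k) := by
  have h := Matrix.det_eq_of_forall_col_eq_smul_add_pred
    (A := Matrix.of fun i j : Fin (m + 1) => if i.val ≤ j.val then a i.val else b j.val)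
    (B := Matrix.of fun i j : Fin (m + 1) =>
      if j.val = 0 then (if i.val ≤ j.val then a i.val else b j.val)
      else (if i.val ≤ j.val then a i.val else b j.val) -
        (if i.val ≤ j.val - 1 then a i.val else b (j.val - 1)))
    (fun _ => 1) (by intro i; simp) (by
      intro i j
      simp only [Matrix.of_apply, Fin.val_succ, Fin.val_castSucc, Nat.add_sub_cancel,
        if_neg (Nat.succ_ne_zero j.val), Nat.add_one_ne_zero, if_false]
      ring)
  rw [h, Matrix.det_of_isLowerTriangular, Fin.prod_univ_succ, ← Fin.prod_univ_eq_prod_range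
    (fun k => a (k + 1) - b k)]
  · simp
  · intro i j hij
    have hij' : i.val < j.val := hij
    have h1 : j.val ≠ 0 := by omega
    have h2 : i.val ≤ j.val := by omega
    have h3 : i.val ≤ j.val - 1 := by omega
    simp only [Matrix.of_apply, if_neg h1, if_pos h2, if_pos h3, sub_self]

lemma bordered_aux (m p : ℕ) (hp : p ≤ m) (c : ℝ → ℝ) (s : ℕ → ℝ) (t u : ℝ)
    (hmono : StrictMonoOn s (Set.Icc 0 m)) (htu : t ≤ u)
    (h1 : ∀ k, 1 ≤ k → k ≤ p → s k ≤ t) (h2 : ∀ k, p < k → k ≤ m → u ≤ s k) :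
    (borderedMinMatrix m c s t u).det =
      (if p = 0 then c t else c (s 1)) * ∏ k ∈ Finset.range m,
        ((if k + 1 < p then c (s (k + 2)) else if k + 1 = p then c t else c (s (k + 1))) -
         (if k < p then c (s (k + 1)) else if k = p then c u else c (s k))) := by
  have key := semisep_det m
    (fun k => if k < p then c (s (k + 1)) else if k = p then c t else c (s k))
    (fun k => if k < p then c (s (k + 1)) else if k = p then c u else c (s k))
  have e0 : (if p = 0 then c t else c (s 1)) =
      (if 0 < p then c (s (0 + 1)) else if 0 = p then c t else c (s 0)) := by
    rcases Nat.eq_zero_or_pos p with h | h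
    · simp [h]
    · simp [h, h.ne']
  rw [e0]
  refine Eq.trans ?_ key
  rw [← Matrix.det_submatrix_equiv_self (Fin.cycleRange (⟨p, by omega⟩ : Fin (m + 1)))]
  congr 1
  have hv : ∀ i : Fin (m + 1), ((Fin.cycleRange (⟨p, by omega⟩ : Fin (m + 1))) i).val =
      if i.val < p then i.val + 1 else if i.val = p then 0 else i.val := by
    intro i
    rcases lt_trichotomy i.val p with h | h | h
    · rw [if_pos h, Fin.coe_cycleRange_of_lt (show i < ⟨p, _⟩ from h)]
    · have : i = ⟨p, by omega⟩ := Fin.ext h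
      rw [this, Fin.cycleRange_self]; simp
    · rw [if_neg (by omega), if_neg (by omega),
        Fin.cycleRange_of_gt (show (⟨p, _⟩ : Fin (m + 1)) < i from h)]
  have hm' : ∀ k l, k ≤ l → l ≤ m → s k ≤ s l := fun k l hkl hl =>
    hmono.monotoneOn ⟨by omega, by omega⟩ ⟨by omega, hl⟩ hkl
  ext i j
  simp only [Matrix.submatrix_apply, borderedMinMatrix, Matrix.of_apply, hv]
  have hi := i.isLt
  have hj := j.isLt
  generalize i.val = x at *
  generalize j.val = y at *
  have key2 : ∀ X Y : ℝ, (x ≤ y → X ≤ Y) → (y < x → Y ≤ X) →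
      c (min X Y) = if x ≤ y then c X else c Y := by
    intro X Y hX hY
    split_ifs with h
    · rw [min_eq_left (hX h)]
    · rw [min_eq_right (hY (by omega))]
  rw [key2]
  · rcases lt_trichotomy x p with h | h | h <;> rcases lt_trichotomy y p with h' | h' | h' <;>
      grind
  · intro hxy
    rcases lt_trichotomy x p with h | h | h <;> rcases lt_trichotomy y p with h' | h' | h' <;>
      grind
  · intro hxy
    rcases lt_trichotomy x p with h | h | h <;> rcases lt_trichotomy y p with h' | h' | h' <;>
      grind

lemma bordered_aux2 (m p : ℕ) (hp : p ≤ m) (c : ℝ → ℝ) (s : ℕ → ℝ) (t u : ℝ)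
    (hmono : StrictMonoOn s (Set.Icc 0 m)) (htu : t ≤ u)
    (hs0 : s 0 = 0) (hc0 : c 0 = 0)
    (h1 : ∀ k, 1 ≤ k → k ≤ p → s k ≤ t) (h2 : ∀ k, p < k → k ≤ m → u ≤ s k) :
    (borderedMinMatrix m c s t u).det =
      (∏ j ∈ Finset.Icc 1 p, (c (s j) - c (s (j - 1)))) * ((c t - c (s p)) *
        (if p = m then 1 else (c (s (p + 1)) - c u) *
          ∏ j ∈ Finset.Icc (p + 2) m, (c (s j) - c (s (j - 1))))) := by
  rw [bordered_aux m p hp c s t u hmono htu h1 h2]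
  set F : ℕ → ℝ := fun k => if k < p then c (s (k + 1)) - c (s k) else if k = p then c t - c (s p)
    else if k = p + 1 then c (s (p + 1)) - c u else c (s k) - c (s (k - 1)) with hF
  have hz : c (s 0) = 0 := by rw [hs0, hc0]
  trans ∏ k ∈ Finset.range (m + 1), F k
  · rw [Finset.prod_range_succ', mul_comm]
    congr 1
    · apply Finset.prod_congr rfl
      intro k _
      simp only [hF]
      rcases lt_trichotomy (k + 1) p with h | h | h
      · simp [h, show k < p by omega]
      · subst h; simp
      · rcases Nat.eq_or_lt_of_le (show p ≤ k by omega) with h' | h'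
        · subst h'; simp
        · simp [show ¬ k + 1 < p by omega, show ¬ k + 1 = p by omega, show ¬ k < p by omega,
            show ¬ k = p by omega]
    · rcases Nat.eq_zero_or_pos p with h | h
      · simp [hF, h, hz]
      · simp [hF, h, h.ne', hz]
  · have hA : ∏ j ∈ Finset.Icc 1 p, (c (s j) - c (s (j - 1))) = ∏ k ∈ Finset.range p, F k := by
      rw [← Finset.Ico_add_one_right_eq_Icc, Finset.prod_Ico_eq_prod_range]
      apply Finset.prod_congr rfl
      intro k hk
      have hk : k < p := by have := Finset.mem_range.1 hk; omega
      simp [hF, hk, add_comm 1 k]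
    have hP : F p = c t - c (s p) := by simp [hF]
    rw [hA, ← hP]
    split_ifs with h
    · subst h
      rw [Finset.prod_range_succ, mul_one]
    · have hQ : F (p + 1) = c (s (p + 1)) - c u := by simp [hF]
      have hB : ∏ j ∈ Finset.Icc (p + 2) m, (c (s j) - c (s (j - 1))) =
          ∏ k ∈ Finset.Ico (p + 2) (m + 1), F k := by
        rw [Finset.Ico_add_one_right_eq_Icc]
        apply Finset.prod_congr rfl
        intro k hk
        have hk := Finset.mem_Icc.1 hk
        simp [hF, show ¬ k < p by omega, show ¬ k = p by omega, show ¬ k = p + 1 by omega]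
      rw [hB, ← hQ, ← Finset.prod_range_mul_prod_Ico F (show p + 2 ≤ m + 1 by omega),
        Finset.prod_range_succ, Finset.prod_range_succ]
      ring

lemma bordered_zero (m : ℕ) (c : ℝ → ℝ) (s : ℕ → ℝ) (t u : ℝ)
    (hmono : StrictMonoOn s (Set.Icc 0 m)) (ht : 0 ≤ t) (hs0 : s 0 = 0) (hc0 : c 0 = 0)
    (h : ∃ i : ℕ, 1 ≤ i ∧ i ≤ m ∧ t ≤ s i ∧ s i ≤ u) :
    (borderedMinMatrix m c s t u).det = 0 := by
  classical
  have hm' : ∀ k l, k ≤ l → l ≤ m → s k ≤ s l := fun k l hkl hl =>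
    hmono.monotoneOn ⟨by omega, by omega⟩ ⟨by omega, hl⟩ hkl
  obtain ⟨a, ⟨ha1, ham, hta, hau⟩, hmin⟩ : ∃ a, (1 ≤ a ∧ a ≤ m ∧ t ≤ s a ∧ s a ≤ u) ∧
      ∀ k, 1 ≤ k → k < a → s k < t := by
    refine ⟨Nat.find h, Nat.find_spec h, fun k hk hka => ?_⟩
    have h3 := Nat.find_min h hka
    have h4 := Nat.find_spec h
    by_contra! hc
    exact h3 ⟨hk, by omega, hc, (hm' _ _ hka.le h4.2.1).trans h4.2.2.2⟩
  have hpt : s (a - 1) ≤ t := by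
    rcases Nat.eq_or_lt_of_le ha1 with h | h
    · rw [← h]; simpa [hs0] using ht
    · exact (hmin _ (by omega) (by omega)).le
  -- the rows `0`, `a`, `a - 1`
  have r0 : ∀ j : Fin (m + 1), borderedMinMatrix m c s t u 0 j =
      if 1 ≤ j.val ∧ j.val < a then c (s j.val) else c t := by
    intro j
    have hj := j.isLt
    simp only [borderedMinMatrix, Matrix.of_apply, Fin.val_zero, if_true]
    split_ifs with h1 h2 h2
    · omega
    · rw [min_eq_left (hta.trans hau)]
    · rw [min_eq_right (hmin _ h2.1 h2.2).le]
    · rw [min_eq_left (hta.trans (hm' _ _ (by omega) (by omega)))]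
  have ra : ∀ j : Fin (m + 1), borderedMinMatrix m c s t u ⟨a, by omega⟩ j =
      if 1 ≤ j.val ∧ j.val < a then c (s j.val) else c (s a) := by
    intro j
    have hj := j.isLt
    simp only [borderedMinMatrix, Matrix.of_apply, if_neg (show ¬ a = 0 by omega)]
    split_ifs with h1 h2 h2
    · omega
    · rw [min_eq_left hau]
    · rw [min_eq_right (hm' _ _ (by omega) (by omega))]
    · rw [min_eq_left (hm' _ _ (by omega) (by omega))]
  have rb : 2 ≤ a → ∀ j : Fin (m + 1), borderedMinMatrix m c s t u ⟨a - 1, by omega⟩ j =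
      if 1 ≤ j.val ∧ j.val < a then c (s j.val) else c (s (a - 1)) := by
    intro h2a j
    have hj := j.isLt
    simp only [borderedMinMatrix, Matrix.of_apply, if_neg (show ¬ a - 1 = 0 by omega)]
    split_ifs with h1 h2 h2
    · omega
    · rw [min_eq_left (hpt.trans (hta.trans hau))]
    · rw [min_eq_right (hm' _ _ (by omega) (by omega))]
    · rw [min_eq_left (hm' _ _ (by omega) (by omega))]
  have hne : (0 : Fin (m + 1)) ≠ ⟨a, by omega⟩ := by
    intro h; have := congrArg Fin.val h; simp at this; omega
  by_cases hα : c (s a) = c t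
  · apply Matrix.det_zero_of_row_eq hne
    ext j
    rw [r0, ra, hα]
  rw [← Matrix.exists_vecMul_eq_zero_iff]
  rcases Nat.eq_or_lt_of_le ha1 with h1 | h1
  · refine ⟨Pi.single 0 (c (s a)) + Pi.single ⟨a, by omega⟩ (- c t), ?_, ?_⟩
    · intro h0
      have e1 := congrFun h0 0
      have e2 := congrFun h0 ⟨a, by omega⟩
      simp [hne, hne.symm] at e1 e2
      exact hα (by rw [e1, e2])
    · ext j
      simp only [Matrix.add_vecMul, Matrix.single_vecMul, Pi.add_apply, Pi.smul_apply,
        Matrix.row, r0, ra, smul_eq_mul, Pi.zero_apply]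
      rw [if_neg (by omega), if_neg (by omega)]
      ring
  · have hne2 : (0 : Fin (m + 1)) ≠ ⟨a - 1, by omega⟩ := by
      intro h; have := congrArg Fin.val h; simp at this; omega
    have hne3 : (⟨a, by omega⟩ : Fin (m + 1)) ≠ ⟨a - 1, by omega⟩ := by
      intro h; have := congrArg Fin.val h; simp at this; omega
    refine ⟨Pi.single 0 (c (s a) - c (s (a - 1))) +
      Pi.single ⟨a, by omega⟩ (c (s (a - 1)) - c t) +
      Pi.single ⟨a - 1, by omega⟩ (c t - c (s a)), ?_, ?_⟩
    · intro h0
      have e1 := congrFun h0 ⟨a - 1, by omega⟩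
      simp only [Pi.add_apply, Pi.single_eq_of_ne hne2.symm, Pi.single_eq_of_ne hne3.symm,
        Pi.single_eq_same, Pi.zero_apply] at e1
      exact hα (by linarith)
    · ext j
      simp only [Matrix.add_vecMul, Matrix.single_vecMul, Pi.add_apply, Pi.smul_apply,
        Matrix.row, r0, ra, rb h1, smul_eq_mul, Pi.zero_apply]
      split_ifs <;> ring

theorem bordered_min_matrix_det
    (m : ℕ) (hm : 1 ≤ m) (s : ℕ → ℝ) (hs0 : s 0 = 0)
    (hmono : StrictMonoOn s (Set.Icc 0 m))
    (t u : ℝ) (ht : 0 ≤ t) (htu : t ≤ u)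
    (c : ℝ → ℝ) (hc0 : c 0 = 0) :
    (u < s 1 →
      (borderedMinMatrix m c s t u).det =
        c t * ((c (s 1) - c u) * ∏ j ∈ Finset.Icc 2 m, (c (s j) - c (s (j - 1))))) ∧
    (∀ i : ℕ, 1 ≤ i → i + 1 ≤ m → s i < t → u < s (i + 1) →
      (borderedMinMatrix m c s t u).det =
        (∏ j ∈ Finset.Icc 1 i, (c (s j) - c (s (j - 1)))) *
          ((c t - c (s i)) * ((c (s (i + 1)) - c u) *
            ∏ j ∈ Finset.Icc (i + 2) m, (c (s j) - c (s (j - 1)))))) ∧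
    (s m < t →
      (borderedMinMatrix m c s t u).det =
        (∏ j ∈ Finset.Icc 1 m, (c (s j) - c (s (j - 1)))) * (c t - c (s m))) ∧
    ((∃ i : ℕ, 1 ≤ i ∧ i ≤ m ∧ t ≤ s i ∧ s i ≤ u) →
      (borderedMinMatrix m c s t u).det = 0) := by
  have hm' : ∀ k l, k ≤ l → l ≤ m → s k ≤ s l := fun k l hkl hl =>
    hmono.monotoneOn ⟨by omega, by omega⟩ ⟨by omega, hl⟩ hkl
  refine ⟨fun h => ?_, fun i hi him hit hui => ?_, fun h => ?_, fun h => ?_⟩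
  · rw [bordered_aux2 m 0 (by omega) c s t u hmono htu hs0 hc0 (fun k _ _ => by omega)
      (fun k hk hkm => h.le.trans (hm' _ _ hk hkm)), if_neg (by omega)]
    simp [hs0, hc0]
  · rw [bordered_aux2 m i (by omega) c s t u hmono htu hs0 hc0
      (fun k _ hk => (hm' _ _ hk (by omega)).trans hit.le)
      (fun k hk hkm => hui.le.trans (hm' _ _ hk hkm)), if_neg (by omega)]
  · rw [bordered_aux2 m m le_rfl c s t u hmono htu hs0 hc0
      (fun k _ hk => (hm' _ _ hk le_rfl).trans h.le)
      (fun k hk hkm => by omega), if_pos rfl, mul_one]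
  · exact bordered_zero m c s t u hmono ht hs0 hc0 h
end

section
/- Let τ>0, let b be a finite Borel measure on (0,τ], and let c be a finite atomless Borel measure on (0,τ]; write c(s)=c((0,s]) with c(s₀)=0 for s₀=0. For m ≥ 1 define d_m = ∫_{(0,τ]^m} det[c(s_i ∧ s_j)]_{i,j=1}^m b(ds₁)⋯b(ds_m). Then d_m = m! · ∫_{0<s₁<…<s_m≤τ} ∏_{j=1}^m (c(s_j)−c(s_{j−1})) b(ds₁)⋯b(ds_m) = m! · Ψ_{0m}(0,τ), where Ψ_{0m} is defined by the recursion Ψ_{00}(s,t)=1 and Ψ_{0n}(s,t)=∬_{s<u₁≤u₂≤t} Ψ_{0,n−1}(s,u₁) c(du₁) b(du₂) for n ≥ 1. -/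
open MeasureTheory Set

/-- `Ψ_{0n}(s,t)` (atomless case: no distinction between open and closed endpoints). -/
noncomputable def Psi0c (c b : Measure ℝ) : ℕ → ℝ → ℝ → ℝ
  | 0, _, _ => 1
  | n + 1, s, t =>
      ∫ u₂ in Set.Ioc s t, (∫ u₁ in Set.Ioc s u₂, Psi0c c b n s u₁ ∂c) ∂b

/-- Extension of `s : Fin m → ℝ` to indices `0,…,m`, with `s₀ = 0`. -/
noncomputable def extSeq (m : ℕ) (s : Fin m → ℝ) (k : ℕ) : ℝ :=
  if h : 1 ≤ k ∧ k ≤ m then s ⟨k - 1, by omega⟩ else 0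


namespace FredAux

noncomputable def Cf (c : Measure ℝ) (t : ℝ) : ℝ := (c (Set.Ioc 0 t)).toReal

noncomputable def pr (c : Measure ℝ) (m : ℕ) (s : Fin m → ℝ) : ℝ :=
  ∏ k ∈ Finset.Icc 1 m, (Cf c (extSeq m s k) - Cf c (extSeq m s (k - 1)))

def SS (n : ℕ) : Set (Fin n → ℝ) := {s | StrictMono s ∧ ∀ i, 0 < s i}

lemma Cf_mono (c : Measure ℝ) [IsFiniteMeasure c] : Monotone (Cf c) := by
  intro x y h
  exact ENNReal.toReal_mono (measure_ne_top _ _) (measure_mono (Set.Ioc_subset_Ioc_right h))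

lemma Cf_meas (c : Measure ℝ) [IsFiniteMeasure c] : Measurable (Cf c) := (Cf_mono c).measurable

lemma Cf_nonneg (c : Measure ℝ) (t : ℝ) : 0 ≤ Cf c t := ENNReal.toReal_nonneg

lemma Cf_le (c : Measure ℝ) [IsFiniteMeasure c] (t : ℝ) : Cf c t ≤ (c univ).toReal :=
  ENNReal.toReal_mono (measure_ne_top _ _) (measure_mono (subset_univ _))

lemma Cf_zero (c : Measure ℝ) : Cf c 0 = 0 := by simp [Cf]

lemma ext_zero (m : ℕ) (s : Fin m → ℝ) : extSeq m s 0 = 0 := by simp [extSeq]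

lemma ext_succ (m : ℕ) (s : Fin m → ℝ) (i : Fin m) : extSeq m s (i + 1) = s i := by
  have : (i : ℕ) + 1 ≤ m := i.2
  simp [extSeq, this]

lemma ext_meas (m k : ℕ) : Measurable (fun s : Fin m → ℝ => extSeq m s k) := by
  by_cases h : 1 ≤ k ∧ k ≤ m
  · simp only [extSeq, h]
    exact measurable_pi_apply _
  · simp only [extSeq, h]
    exact measurable_const

lemma pr_meas (c : Measure ℝ) [IsFiniteMeasure c] (m : ℕ) : Measurable (pr c m) := by
  unfold pr
  refine Finset.measurable_fun_prod _ fun k _ => ?_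
  exact ((Cf_meas c).comp (ext_meas m k)).sub ((Cf_meas c).comp (ext_meas m (k-1)))

lemma pr_bound (c : Measure ℝ) [IsFiniteMeasure c] (m : ℕ) (s : Fin m → ℝ) :
    |pr c m s| ≤ (c univ).toReal ^ m := by
  unfold pr
  rw [Finset.abs_prod]
  calc _ ≤ ∏ k ∈ Finset.Icc 1 m, (c univ).toReal := by
        refine Finset.prod_le_prod (fun _ _ => abs_nonneg _) fun k _ => ?_
        rw [abs_le]
        constructor <;> linarith [Cf_le c (extSeq m s k), Cf_le c (extSeq m s (k-1)),
          Cf_nonneg c (extSeq m s k), Cf_nonneg c (extSeq m s (k-1))]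
    _ = _ := by simp

lemma SS_meas (n : ℕ) : MeasurableSet (SS n) := by
  have : SS n = (⋂ (i : Fin n) (j : Fin n) (_ : i < j), {s : Fin n → ℝ | s i < s j}) ∩
      ⋂ i : Fin n, {s : Fin n → ℝ | 0 < s i} := by
    ext s; simp [SS, StrictMono]
  rw [this]
  refine MeasurableSet.inter ?_ ?_
  · refine MeasurableSet.iInter fun i => MeasurableSet.iInter fun j => MeasurableSet.iInter fun _ => ?_
    exact measurableSet_lt (measurable_pi_apply _) (measurable_pi_apply _)
  · refine MeasurableSet.iInter fun i => ?_
    exact measurableSet_lt measurable_const (measurable_pi_apply _)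

lemma ext_snoc_le (n : ℕ) (s : Fin n → ℝ) (v : ℝ) (k : ℕ) (hk : k ≤ n) :
    extSeq (n+1) (Fin.snoc (α := fun _ => ℝ) s v) k = extSeq n s k := by
  rcases k with _ | k
  · simp [ext_zero]
  · have h1 := ext_succ n s ⟨k, hk⟩
    have h2 := ext_succ (n+1) (Fin.snoc (α := fun _ => ℝ) s v) (Fin.castSucc ⟨k, hk⟩)
    simp only [Fin.snoc_castSucc] at h2
    simp only [Fin.val_castSucc] at h1 h2
    rw [h1, h2]

lemma ext_snoc_last (n : ℕ) (s : Fin n → ℝ) (v : ℝ) :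
    extSeq (n+1) (Fin.snoc (α := fun _ => ℝ) s v) (n+1) = v := by
  have h2 := ext_succ (n+1) (Fin.snoc (α := fun _ => ℝ) s v) (Fin.last n)
  simpa using h2

lemma pr_snoc (c : Measure ℝ) (n : ℕ) (s : Fin n → ℝ) (v : ℝ) :
    pr c (n+1) (Fin.snoc (α := fun _ => ℝ) s v) = pr c n s * (Cf c v - Cf c (extSeq n s n)) := by
  unfold pr
  rw [Finset.prod_Icc_succ_top (by omega), ext_snoc_last]
  simp only [Nat.add_sub_cancel]
  rw [ext_snoc_le n s v n le_rfl]
  congr 1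
  refine Finset.prod_congr rfl fun k hk => ?_
  have := Finset.mem_Icc.1 hk
  rw [ext_snoc_le n s v k this.2, ext_snoc_le n s v (k-1) (by omega)]

/-- All entries of an element of `SS n` are bounded by the last one. -/
lemma SS_le (n : ℕ) (s : Fin n → ℝ) (hs : StrictMono s) (i : Fin n) : s i ≤ extSeq n s n := by
  rcases n with _ | n
  · exact i.elim0
  · have h2 := ext_succ (n+1) s (Fin.last n)
    simp only [Fin.val_last] at h2
    rw [h2]
    exact hs.monotone (Fin.le_last i)

lemma ext_last_cases (n : ℕ) (s : Fin n → ℝ) : (n = 0 ∧ extSeq n s n = 0) ∨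
    ∃ i, extSeq n s n = s i := by
  rcases n with _ | n
  · left; simp [ext_zero]
  · right
    have h2 := ext_succ (n+1) s (Fin.last n)
    exact ⟨_, h2⟩

lemma ext_last_nonneg (n : ℕ) (s : Fin n → ℝ) (hs : s ∈ SS n) : 0 ≤ extSeq n s n := by
  rcases ext_last_cases n s with ⟨_, h⟩ | ⟨i, h⟩
  · exact h.ge
  · rw [h]; exact (hs.2 i).le

lemma region_iff (n : ℕ) (t : ℝ) (ht : 0 < t) (s : Fin n → ℝ) :
    (StrictMono s ∧ ∀ i, s i ∈ Set.Ioc 0 t) ↔ s ∈ SS n ∧ extSeq n s n ≤ t := by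
  constructor
  · rintro ⟨h1, h2⟩
    refine ⟨⟨h1, fun i => (h2 i).1⟩, ?_⟩
    rcases ext_last_cases n s with ⟨_, h⟩ | ⟨i, h⟩
    · rw [h]; exact ht.le
    · rw [h]; exact (h2 i).2
  · rintro ⟨⟨h1, h2⟩, h3⟩
    exact ⟨h1, fun i => ⟨h2 i, (SS_le n s h1 i).trans h3⟩⟩

lemma SS_snoc (n : ℕ) (s : Fin n → ℝ) (v : ℝ) (hv : 0 < v) :
    Fin.snoc (α := fun _ => ℝ) s v ∈ SS (n+1) ↔ s ∈ SS n ∧ extSeq n s n < v := by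
  constructor
  · rintro ⟨h1, h2⟩
    refine ⟨⟨?_, ?_⟩, ?_⟩
    · intro i j hij
      have := h1 (Fin.castSucc_lt_castSucc_iff.2 hij)
      simpa using this
    · intro i
      simpa using h2 i.castSucc
    · rcases ext_last_cases n s with ⟨_, h⟩ | ⟨i, h⟩
      · rw [h]; exact hv
      · rw [h]
        have := h1 (Fin.castSucc_lt_last i)
        simpa using this
  · rintro ⟨⟨h1, h2⟩, h3⟩
    refine ⟨?_, ?_⟩
    · intro i j hij
      induction j using Fin.lastCases with
      | last =>
        induction i using Fin.lastCases with
        | last => exact absurd hij (lt_irrefl _)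
        | cast i => simpa using (SS_le n s h1 i).trans_lt h3
      | cast j =>
        induction i using Fin.lastCases with
        | last => exact absurd (hij.trans (Fin.castSucc_lt_last j)) (lt_irrefl _)
        | cast i => simpa using h1 (Fin.castSucc_lt_castSucc_iff.1 hij)
    · intro i
      induction i using Fin.lastCases with
      | last => simpa using hv
      | cast i => simpa using h2 i

lemma key (c : Measure ℝ) [IsFiniteMeasure c] (hc : ∀ x : ℝ, c {x} = 0) (w v : ℝ) (hw : 0 ≤ w) :
    (if w < v then Cf c v - Cf c w else 0) =
      ∫ u in Set.Ioc 0 v, (if w ≤ u then (1:ℝ) else 0) ∂c := by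
  have h1 : (fun u => if w ≤ u then (1:ℝ) else 0) = (Set.Ici w).indicator (fun _ => 1) := by
    ext u; simp [Set.indicator]
  rw [h1, integral_indicator measurableSet_Ici, Measure.restrict_restrict measurableSet_Ici]
  simp only [integral_const, smul_eq_mul, mul_one, Measure.real, Measure.restrict_apply_univ]
  have : NullSingletonClass c := ⟨hc⟩
  split_ifs with h
  · have hd : Set.Ioc 0 v = Set.Ioc 0 w ∪ Set.Ioc w v := (Set.Ioc_union_Ioc_eq_Ioc hw h.le).symm
    have e1 : c (Set.Ioc 0 v) = c (Set.Ioc 0 w) + c (Set.Ioc w v) := by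
      rw [hd]
      refine measure_union ?_ measurableSet_Ioc
      exact Set.Ioc_disjoint_Ioc_of_le le_rfl
    have e2 : c (Set.Ici w ∩ Set.Ioc 0 v) = c (Set.Ioc w v) := by
      apply le_antisymm
      · rw [measure_congr (Ioc_ae_eq_Icc (μ := c) (a := w) (b := v))]
        exact measure_mono fun x hx => ⟨hx.1, hx.2.2⟩
      · exact measure_mono fun x hx => ⟨hx.1.le, hw.trans_lt hx.1, hx.2⟩
    rw [e2]
    unfold Cf
    rw [e1, ENNReal.toReal_add (measure_ne_top _ _) (measure_ne_top _ _)]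
    ring
  · have : c (Set.Ici w ∩ Set.Ioc 0 v) = 0 := by
      refine measure_mono_null (fun x hx => ?_) (hc v)
      have h1 : w ≤ x := hx.1
      exact le_antisymm hx.2.2 ((not_lt.1 h).trans h1)
    rw [this]; rfl

/-- the integrand cut to ordered tuples -/
noncomputable def F (c : Measure ℝ) (n : ℕ) : (Fin n → ℝ) → ℝ := (SS n).indicator (pr c n)

lemma F_meas (c : Measure ℝ) [IsFiniteMeasure c] (n : ℕ) : Measurable (F c n) :=
  (pr_meas c n).indicator (SS_meas n)

lemma F_bound (c : Measure ℝ) [IsFiniteMeasure c] (n : ℕ) (s) :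
    |F c n s| ≤ (c univ).toReal ^ n := by
  unfold F Set.indicator
  split_ifs
  · exact pr_bound c n s
  · simp

lemma F_snoc (c : Measure ℝ) [IsFiniteMeasure c] (hc : ∀ x : ℝ, c {x} = 0) (n : ℕ)
    (s : Fin n → ℝ) (v : ℝ) (hv : 0 < v) :
    F c (n+1) (Fin.snoc (α := fun _ => ℝ) s v) =
      ∫ u in Set.Ioc 0 v, F c n s * (if extSeq n s n ≤ u then (1:ℝ) else 0) ∂c := by
  rw [integral_const_mul]
  by_cases hs : s ∈ SS n
  · rw [← key c hc _ _ (ext_last_nonneg n s hs)]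
    by_cases h : extSeq n s n < v
    · rw [if_pos h, F, F, Set.indicator_of_mem ((SS_snoc n s v hv).2 ⟨hs, h⟩),
        Set.indicator_of_mem hs, pr_snoc]
    · rw [if_neg h, F, Set.indicator_of_notMem (fun h' => h ((SS_snoc n s v hv).1 h').2), mul_zero]
  · rw [F, F, Set.indicator_of_notMem hs,
      Set.indicator_of_notMem (fun h' => hs ((SS_snoc n s v hv).1 h').1), zero_mul]

noncomputable def J (c b : Measure ℝ) (n : ℕ) (t : ℝ) : ℝ :=
  ∫ s, F c n s * (if extSeq n s n ≤ t then (1:ℝ) else 0) ∂(Measure.pi fun _ => b)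

lemma J_eq (c b : Measure ℝ) (n : ℕ) (t : ℝ) (ht : 0 < t) :
    J c b n t = ∫ s in {s : Fin n → ℝ | StrictMono s ∧ ∀ i, s i ∈ Set.Ioc 0 t}, pr c n s
      ∂(Measure.pi fun _ => b) := by
  have e : {s : Fin n → ℝ | StrictMono s ∧ ∀ i, s i ∈ Set.Ioc 0 t} =
      SS n ∩ {s | extSeq n s n ≤ t} := by
    ext s; exact region_iff n t ht s
  rw [e, ← integral_indicator ((SS_meas n).inter (measurableSet_le (ext_meas n n) measurable_const))]
  unfold J
  congr 1
  ext s
  by_cases h1 : s ∈ SS n <;> by_cases h2 : extSeq n s n ≤ t <;> simp [F, Set.indicator, h1, h2]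

lemma ite_meas {α : Type*} [MeasurableSpace α] {f g : α → ℝ} (hf : Measurable f) (hg : Measurable g) :
    Measurable (fun x => if f x ≤ g x then (1:ℝ) else 0) :=
  Measurable.ite (measurableSet_le hf hg) measurable_const measurable_const

lemma J_succ (c b : Measure ℝ) [IsFiniteMeasure c] [IsFiniteMeasure b]
    (hc : ∀ x : ℝ, c {x} = 0) (hb : b (Set.Iic 0) = 0) (n : ℕ) (t : ℝ) :
    J c b (n+1) t = ∫ v in Set.Ioc 0 t, (∫ u in Set.Ioc 0 v, J c b n u ∂c) ∂b := by
  unfold J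
  have mp := (measurePreserving_piFinSuccAbove (n := n) (α := fun _ => ℝ) (fun _ => b)
    (Fin.last n)).symm
  set G : (Fin (n+1) → ℝ) → ℝ := fun s => F c (n+1) s *
    (if extSeq (n+1) s (n+1) ≤ t then (1:ℝ) else 0) with hG
  have hGm : Measurable G := (F_meas c (n+1)).mul (ite_meas (ext_meas _ _) measurable_const)
  have hGb : ∀ s, ‖G s‖ ≤ (c univ).toReal ^ (n+1) := by
    intro s
    simp only [hG]
    have := F_bound c (n+1) s
    split_ifs
    · simpa using this
    · simp only [mul_zero, norm_zero]; positivity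
  rw [← mp.integral_comp (MeasurableEquiv.measurableEmbedding _)]
  rw [integral_prod]
  swap
  · refine Integrable.of_bound (hGm.comp (MeasurableEquiv.measurable _)).aestronglyMeasurable
      ((c univ).toReal ^ (n+1)) (Filter.Eventually.of_forall fun x => hGb _)
  rw [← integral_indicator measurableSet_Ioc]
  have hpos : ∀ᵐ v ∂b, 0 < v := by
    rw [ae_iff]; simpa [Set.Iic] using hb
  refine integral_congr_ae ?_
  filter_upwards [hpos] with v hv
  have hsn : ∀ s : Fin n → ℝ, (MeasurableEquiv.piFinSuccAbove (fun _ : Fin (n+1) => ℝ)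
      (Fin.last n)).symm (v, s) = Fin.snoc (α := fun _ => ℝ) s v := by
    intro s
    exact Fin.insertNth_last' v s
  simp only [hsn, hG, ext_snoc_last]
  by_cases hvt : v ≤ t
  · rw [Set.indicator_of_mem (show v ∈ Set.Ioc 0 t from ⟨hv, hvt⟩)]
    simp only [hvt, if_true, mul_one]
    simp only [F_snoc c hc n _ v hv]
    refine integral_integral_swap ?_
    refine Integrable.of_bound (Measurable.aestronglyMeasurable ?_) ((c univ).toReal ^ n)
      (Filter.Eventually.of_forall ?_)
    · exact ((F_meas c n).comp measurable_fst).mul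
        (ite_meas ((ext_meas n n).comp measurable_fst) measurable_snd)
    · rintro ⟨s, u⟩
      have := F_bound c n s
      simp only [Function.uncurry]
      split_ifs
      · simpa using this
      · simp only [mul_zero, norm_zero]; positivity
  · rw [Set.indicator_of_notMem (fun h => hvt h.2)]
    simp [hvt]

lemma J_eq_Psi (c b : Measure ℝ) [IsFiniteMeasure c] [IsFiniteMeasure b]
    (hc : ∀ x : ℝ, c {x} = 0) (hb : b (Set.Iic 0) = 0) (n : ℕ) :
    ∀ t, 0 < t → J c b n t = Psi0c c b n 0 t := by
  induction n with
  | zero =>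
    intro t ht
    have h0 : ∀ s : Fin 0 → ℝ, s ∈ SS 0 := fun s => ⟨fun i => i.elim0, fun i => i.elim0⟩
    simp [J, F, h0, pr, ext_zero, ht.le, Psi0c, Measure.real]
  | succ n ih =>
    intro t ht
    rw [J_succ c b hc hb, Psi0c]
    refine setIntegral_congr_fun measurableSet_Ioc fun v hv => ?_
    exact setIntegral_congr_fun measurableSet_Ioc fun u hu => ih u hu.1

/-- the determinant -/
noncomputable def dt (c : Measure ℝ) (m : ℕ) (s : Fin m → ℝ) : ℝ :=
  (Matrix.of fun i j : Fin m => Cf c (min (s i) (s j))).det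

lemma det_min (m : ℕ) (d : ℕ → ℝ) :
    (Matrix.of fun i j : Fin m => ∑ k ∈ Finset.range (min (i:ℕ) j + 1), d k).det =
      ∏ k ∈ Finset.range m, d k := by
  set L : Matrix (Fin m) (Fin m) ℝ := Matrix.of fun i k => if k ≤ i then 1 else 0 with hL
  have hdet : L.det = 1 := by
    rw [Matrix.det_of_isLowerTriangular]
    · simp [hL]
    · intro i j hij
      have : i < j := hij
      simp [hL, this]
  have : (Matrix.of fun i j : Fin m => ∑ k ∈ Finset.range (min (i:ℕ) j + 1), d k) =
      L * Matrix.diagonal (fun k : Fin m => d k) * L.transpose := by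
    ext i j
    rw [Matrix.mul_apply]
    simp only [Matrix.mul_diagonal, Matrix.transpose_apply, Matrix.of_apply, hL]
    have e : ∀ k : Fin m, ((if k ≤ i then (1:ℝ) else 0) * d k * (if k ≤ j then 1 else 0)) =
        (fun k : ℕ => if k ∈ Finset.range (min (i:ℕ) j + 1) then d k else 0) k := by
      intro k
      simp only [Finset.mem_range, Fin.le_def]
      by_cases h1 : (k:ℕ) ≤ i <;> by_cases h2 : (k:ℕ) ≤ j <;> simp [h1, h2, Nat.lt_succ_iff]
    simp only [e]
    rw [Fin.sum_univ_eq_sum_range (fun k : ℕ => if k ∈ Finset.range (min (i:ℕ) j + 1) then d k else 0) m]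
    rw [Finset.sum_ite_mem]
    congr 1
    have := i.2
    ext k
    simp only [Finset.mem_range, Finset.mem_inter]
    omega
  rw [this, Matrix.det_mul, Matrix.det_mul, Matrix.det_transpose, hdet, Matrix.det_diagonal,
    Fin.prod_univ_eq_prod_range]
  ring

lemma dt_eq_pr (c : Measure ℝ) (m : ℕ) (s : Fin m → ℝ) (hs : StrictMono s) :
    dt c m s = pr c m s := by
  have h := det_min m (fun k => Cf c (extSeq m s (k+1)) - Cf c (extSeq m s k))
  have e : pr c m s = ∏ k ∈ Finset.range m, (Cf c (extSeq m s (k+1)) - Cf c (extSeq m s k)) := by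
    unfold pr
    rw [Finset.range_eq_Ico]
    have h2 := Finset.prod_Ico_add' (fun k => Cf c (extSeq m s k) -
      Cf c (extSeq m s (k-1))) 0 m 1
    simp only [Nat.add_sub_cancel] at h2
    rw [h2]
    refine Finset.prod_congr ?_ fun _ _ => rfl
    ext k
    simp only [Finset.mem_Icc, Finset.mem_Ico]
    omega
  rw [e, ← h]
  unfold dt
  congr 1
  ext i j
  simp only [Matrix.of_apply]
  rw [Finset.sum_range_sub (fun k => Cf c (extSeq m s k)), ext_zero, Cf_zero, sub_zero]
  rw [← hs.monotone.map_min, ← ext_succ m s (min i j)]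
  rcases le_total i j with h | h
  · have : (i:ℕ) ≤ j := h
    simp [h, this]
  · have : (j:ℕ) ≤ i := h
    simp [h, this]

lemma dt_meas (c : Measure ℝ) [IsFiniteMeasure c] (m : ℕ) : Measurable (dt c m) := by
  unfold dt
  simp only [Matrix.det_apply, Matrix.of_apply]
  refine Finset.measurable_fun_sum _ fun σ _ => ?_
  refine Measurable.const_smul ?_ _
  refine Finset.measurable_fun_prod _ fun k _ => ?_
  exact (Cf_meas c).comp ((measurable_pi_apply _).min (measurable_pi_apply _))

lemma dt_bound (c : Measure ℝ) [IsFiniteMeasure c] (m : ℕ) (s) :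
    ‖dt c m s‖ ≤ m.factorial • (c univ).toReal ^ m := by
  have := Matrix.det_le (A := Matrix.of fun i j : Fin m => Cf c (min (s i) (s j)))
    (abv := AbsoluteValue.abs) (x := (c univ).toReal) (fun i j => by
      simp only [Matrix.of_apply, AbsoluteValue.abs_apply]
      rw [abs_of_nonneg (Cf_nonneg _ _)]; exact Cf_le _ _)
  simpa [dt] using this

lemma dt_perm (c : Measure ℝ) (m : ℕ) (s : Fin m → ℝ) (σ : Equiv.Perm (Fin m)) :
    dt c m (s ∘ σ) = dt c m s := by
  unfold dt
  exact Matrix.det_submatrix_equiv_self σ (Matrix.of fun i j : Fin m => Cf c (min (s i) (s j)))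

lemma dt_zero (c : Measure ℝ) (m : ℕ) (s : Fin m → ℝ) (h : ¬ Function.Injective s) :
    dt c m s = 0 := by
  simp only [Function.Injective, not_forall] at h
  obtain ⟨i, j, hij, hne⟩ := h
  unfold dt
  refine Matrix.det_zero_of_row_eq hne ?_
  ext k
  simp [hij]

def SM (m : ℕ) : Set (Fin m → ℝ) := {s | StrictMono s}

lemma SM_meas (n : ℕ) : MeasurableSet (SM n) := by
  have : SM n = (⋂ (i : Fin n) (j : Fin n) (_ : i < j), {s : Fin n → ℝ | s i < s j}) := by
    ext s; simp [SM, StrictMono]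
  rw [this]
  refine MeasurableSet.iInter fun i => MeasurableSet.iInter fun j => MeasurableSet.iInter fun _ => ?_
  exact measurableSet_lt (measurable_pi_apply _) (measurable_pi_apply _)

lemma dt_sum (c : Measure ℝ) (m : ℕ) (s : Fin m → ℝ) :
    dt c m s = ∑ σ : Equiv.Perm (Fin m), (SM m).indicator (dt c m) (s ∘ σ) := by
  by_cases h : Function.Injective s
  · have hsort : StrictMono (s ∘ Tuple.sort s) :=
      (Tuple.monotone_sort s).strictMono_of_injective (h.comp (Tuple.sort s).injective)
    rw [Finset.sum_eq_single (Tuple.sort s)]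
    · rw [Set.indicator_of_mem (show s ∘ Tuple.sort s ∈ SM m from hsort), dt_perm]
    · intro σ _ hσ
      refine Set.indicator_of_notMem (fun h' => hσ ?_) _
      have h'' : StrictMono (s ∘ σ) := h'
      have := Tuple.unique_monotone h''.monotone hsort.monotone
      ext i
      exact congrArg Fin.val (h (congrFun this i))
    · simp
  · rw [dt_zero c m s h]
    symm
    refine Finset.sum_eq_zero fun σ _ => ?_
    refine Set.indicator_of_notMem (fun h' => h ?_) _
    have h'' : StrictMono (s ∘ σ) := h'
    exact (Equiv.injective_comp σ s).1 h''.injective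

lemma perm_mp (b : Measure ℝ) [IsFiniteMeasure b] (m : ℕ) (σ : Equiv.Perm (Fin m)) :
    MeasurePreserving (fun s : Fin m → ℝ => s ∘ σ) (Measure.pi fun _ => b)
      (Measure.pi fun _ => b) := by
  have := measurePreserving_piCongrLeft (α := fun _ : Fin m => ℝ) (fun _ => b) σ.symm
  convert this using 1
  ext s i
  have h := Equiv.piCongrLeft_apply_apply (fun _ : Fin m => ℝ) σ.symm s (σ i)
  simp only [Equiv.symm_apply_apply] at h
  exact h.symm

lemma int_dt (c b : Measure ℝ) [IsFiniteMeasure c] [IsFiniteMeasure b] (m : ℕ) :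
    ∫ s, dt c m s ∂(Measure.pi fun _ => b) = (m.factorial : ℝ) *
      ∫ s in SM m, dt c m s ∂(Measure.pi fun _ => b) := by
  have hm : Measurable ((SM m).indicator (dt c m)) := (dt_meas c m).indicator (SM_meas m)
  have hi : Integrable ((SM m).indicator (dt c m)) (Measure.pi fun _ : Fin m => b) :=
    (Integrable.of_bound (dt_meas c m).aestronglyMeasurable _
      (Filter.Eventually.of_forall (dt_bound c m))).indicator (SM_meas m)
  have e : dt c m = fun s => ∑ σ : Equiv.Perm (Fin m), (SM m).indicator (dt c m) (s ∘ σ) :=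
    funext (dt_sum c m)
  conv_lhs => rw [e]
  rw [integral_finsetSum]
  · have : ∀ σ : Equiv.Perm (Fin m), ∫ s, (SM m).indicator (dt c m) (s ∘ σ)
        ∂(Measure.pi fun _ => b) = ∫ s in SM m, dt c m s ∂(Measure.pi fun _ => b) := by
      intro σ
      rw [← integral_indicator (SM_meas m)]
      have mp := perm_mp b m σ
      conv_rhs => rw [← mp.map_eq]
      rw [integral_map mp.measurable.aemeasurable hm.aestronglyMeasurable]
    simp [this, Fintype.card_perm]
  · intro σ _
    exact (perm_mp b m σ).integrable_comp_of_integrable hi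

end FredAux

theorem fredholm_determinant_coefficient
    (τ : ℝ) (hτ : 0 < τ) (c b : Measure ℝ) [IsFiniteMeasure c] [IsFiniteMeasure b]
    (hcatomless : ∀ x : ℝ, c {x} = 0)
    (hcsupp : c (Set.Ioc 0 τ)ᶜ = 0) (hbsupp : b (Set.Ioc 0 τ)ᶜ = 0)
    (m : ℕ) (hm : 1 ≤ m) :
    (∫ s : Fin m → ℝ,
        (Matrix.of fun i j : Fin m => (c (Set.Ioc 0 (min (s i) (s j)))).toReal).det
        ∂(Measure.pi fun _ => b)) =
      (m.factorial : ℝ) *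
        ∫ s in {s : Fin m → ℝ | StrictMono s ∧ ∀ i, s i ∈ Set.Ioc 0 τ},
          (∏ k ∈ Finset.Icc 1 m,
            ((c (Set.Ioc 0 (extSeq m s k))).toReal -
              (c (Set.Ioc 0 (extSeq m s (k - 1)))).toReal))
          ∂(Measure.pi fun _ => b) ∧
    (∫ s : Fin m → ℝ,
        (Matrix.of fun i j : Fin m => (c (Set.Ioc 0 (min (s i) (s j)))).toReal).det
        ∂(Measure.pi fun _ => b)) =
      (m.factorial : ℝ) * Psi0c c b m 0 τ := by
  have hb0 : b (Set.Iic 0) = 0 := by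
    refine measure_mono_null (t := (Set.Ioc 0 τ)ᶜ) ?_ hbsupp
    intro x hx h
    exact absurd h.1 (not_lt.2 hx)
  have hJ := FredAux.J_eq_Psi c b hcatomless hb0 m τ hτ
  have hJ2 := FredAux.J_eq c b m τ hτ
  have hmain : ∫ s, FredAux.dt c m s ∂(Measure.pi fun _ => b) =
      (m.factorial : ℝ) * FredAux.J c b m τ := by
    rw [FredAux.int_dt, hJ2]
    congr 1
    have hae : ∀ᵐ s ∂(Measure.pi fun _ : Fin m => b), ∀ i, s i ∈ Set.Ioc 0 τ := by
      rw [ae_all_iff]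
      intro i
      have hb1 : ∀ᵐ x ∂b, x ∈ Set.Ioc 0 τ := by
        rw [ae_iff]; exact hbsupp
      exact (Measure.quasiMeasurePreserving_eval (μ := fun _ : Fin m => b) i).ae hb1
    have hset : {s : Fin m → ℝ | StrictMono s ∧ ∀ i, s i ∈ Set.Ioc 0 τ}
        =ᵐ[Measure.pi fun _ : Fin m => b] FredAux.SM m := by
      filter_upwards [hae] with s hs
      exact propext ⟨fun h => h.1, fun h => ⟨h, hs⟩⟩
    rw [setIntegral_congr_set hset]
    exact setIntegral_congr_fun (FredAux.SM_meas m) fun s hs => FredAux.dt_eq_pr c m s hs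
  refine ⟨?_, ?_⟩
  · rw [hJ2] at hmain
    exact hmain
  · rw [hJ] at hmain
    exact hmain
end

section
/- Let τ>0, let b be a finite Borel measure on (0,τ], let c be a finite atomless Borel measure on (0,τ] with c(s)=c((0,s]), and let t,u ∈ (0,τ]. For m ≥ 1 define D_m(t,u) = ∫_{(0,τ]^m} det D̄_m(t,u;s₁,…,s_m) b(ds₁)⋯b(ds_m), where D̄_m(t,u;s₁,…,s_m) is the (m+1)×(m+1) matrix with corner entry c(t∧u), first row (c(t∧s_j))_{j=1}^m, first column (c(s_i∧u))_{i=1}^m, and lower-right block [c(s_i∧s_j)]_{i,j=1}^m. Then D_m(t,u) = m! · Σ_{l=0}^m Ψ_{1l}(0, t∧u) · Ψ_{0,m−l}(t∨u, τ), where Ψ_{0n}(s,t) is defined by Ψ_{00}(s,t)=1 and Ψ_{0n}(s,t)=∬_{s<u₁≤u₂≤t} Ψ_{0,n−1}(s,u₁) c(du₁) b(du₂) for n ≥ 1, and Ψ_{1n}(s,t)=∫_{(s,t]} Ψ_{0n}(s,v) c(dv) for n ≥ 0. -/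
open MeasureTheory Set

/-- `Ψ_{1n}(s,t) = ∫_{(s,t]} Ψ_{0n}(s,v) c(dv)`. -/
noncomputable def Psi1c (c b : Measure ℝ) (n : ℕ) (s t : ℝ) : ℝ :=
  ∫ v in Set.Ioc s t, Psi0c c b n s v ∂c

/-- The vector `(x, s₁, …, s_m)` indexed by `Fin (m+1)`. -/
def borderVec (m : ℕ) (x : ℝ) (s : Fin m → ℝ) : Fin (m + 1) → ℝ :=
  fun i => if h : i.val = 0 then x else s ⟨i.val - 1, by have := i.isLt; omega⟩


/-- bounded measurable real functions -/
def Bd {α : Type*} [MeasurableSpace α] (f : α → ℝ) : Prop :=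
  Measurable f ∧ ∃ C, ∀ x, ‖f x‖ ≤ C

namespace Bd
variable {α β : Type*} [MeasurableSpace α] [MeasurableSpace β] {f g : α → ℝ}

theorem const (r : ℝ) : Bd (fun _ : α => r) := ⟨measurable_const, ‖r‖, fun _ => le_rfl⟩

theorem comp (hf : Bd f) {φ : β → α} (hφ : Measurable φ) : Bd (fun x => f (φ x)) :=
  ⟨hf.1.comp hφ, hf.2.choose, fun _ => hf.2.choose_spec _⟩

theorem mul (hf : Bd f) (hg : Bd g) : Bd (fun x => f x * g x) := by
  obtain ⟨hf, C, hC⟩ := hf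
  obtain ⟨hg, D, hD⟩ := hg
  refine ⟨hf.mul hg, C * D, fun x => ?_⟩
  rw [norm_mul]
  exact mul_le_mul (hC x) (hD x) (norm_nonneg _) ((norm_nonneg _).trans (hC x))

theorem add (hf : Bd f) (hg : Bd g) : Bd (fun x => f x + g x) := by
  obtain ⟨hf, C, hC⟩ := hf
  obtain ⟨hg, D, hD⟩ := hg
  exact ⟨hf.add hg, C + D, fun x => (norm_add_le _ _).trans (add_le_add (hC x) (hD x))⟩

theorem sum {ι : Type*} (s : Finset ι) {F : ι → α → ℝ} (h : ∀ i, Bd (F i)) :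
    Bd (fun x => ∑ i ∈ s, F i x) := by
  classical
  induction s using Finset.induction_on with
  | empty => simpa using const 0
  | insert a s ha ih => simpa [Finset.sum_insert ha] using (h a).add ih

theorem prod {ι : Type*} (s : Finset ι) {F : ι → α → ℝ} (h : ∀ i, Bd (F i)) :
    Bd (fun x => ∏ i ∈ s, F i x) := by
  classical
  induction s using Finset.induction_on with
  | empty => simpa using const 1
  | insert a s ha ih => simpa [Finset.prod_insert ha] using (h a).mul ih

theorem ind (hf : Bd f) {p : α → Prop} [DecidablePred p] (hp : MeasurableSet {x | p x}) :
    Bd (fun x => if p x then f x else 0) := by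
  refine ⟨Measurable.ite hp hf.1 measurable_const, hf.2.choose, fun x => ?_⟩
  dsimp only
  split_ifs
  · exact hf.2.choose_spec x
  · simpa using (norm_nonneg _).trans (hf.2.choose_spec x)

theorem integrable (hf : Bd f) (μ : Measure α) [IsFiniteMeasure μ] : Integrable f μ :=
  Integrable.of_bound hf.1.aestronglyMeasurable hf.2.choose
    (Filter.Eventually.of_forall hf.2.choose_spec)

theorem integral {F : α × β → ℝ} (hF : Bd F) (μ : Measure β) [IsFiniteMeasure μ] :
    Bd (fun x => ∫ y, F (x, y) ∂μ) := by
  refine ⟨(hF.1.stronglyMeasurable.integral_prod_right').measurable,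
    hF.2.choose * μ.real univ, fun x => ?_⟩
  exact norm_integral_le_of_norm_le_const (Filter.Eventually.of_forall fun y => hF.2.choose_spec _)

theorem integralIoc {F : α × ℝ → ℝ} (hF : Bd F) (μ : Measure ℝ) [IsFiniteMeasure μ]
    {lo hi : α → ℝ} (hlo : Measurable lo) (hhi : Measurable hi) :
    Bd (fun x => ∫ y in Ioc (lo x) (hi x), F (x, y) ∂μ) := by
  classical
  have : (fun x => ∫ y in Ioc (lo x) (hi x), F (x, y) ∂μ) =
      fun x => ∫ y, (if lo x < y ∧ y ≤ hi x then F (x, y) else 0) ∂μ := by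
    funext x
    rw [← integral_indicator measurableSet_Ioc]
    refine integral_congr_ae (Filter.Eventually.of_forall fun y => ?_)
    simp [indicator_apply]
  rw [this]
  refine integral (F := fun q : α × ℝ => if lo q.1 < q.2 ∧ q.2 ≤ hi q.1 then F q else 0)
    (hF.ind ?_) μ
  exact (measurableSet_lt (hlo.comp measurable_fst) measurable_snd).inter
    (measurableSet_le measurable_snd (hhi.comp measurable_fst))

end Bd

/-- bordered determinant -/
noncomputable def BDet (K : ℝ → ℝ → ℝ) (m : ℕ) (t u : ℝ) (s : Fin m → ℝ) : ℝ :=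
  (Matrix.of fun i j : Fin (m + 1) =>
    K ((Fin.cons t s : Fin (m + 1) → ℝ) i) ((Fin.cons u s : Fin (m + 1) → ℝ) j)).det

theorem BDet_symm (K : ℝ → ℝ → ℝ) (hK : ∀ x y, K x y = K y x) (m : ℕ) (t u : ℝ)
    (s : Fin m → ℝ) : BDet K m t u s = BDet K m u t s := by
  unfold BDet
  rw [← Matrix.det_transpose]
  congr 1
  ext i j
  simp [hK]

theorem BDet_succ (K : ℝ → ℝ → ℝ) (m : ℕ) (t u : ℝ) (s : Fin (m + 1) → ℝ) :
    BDet K (m + 1) t u s = K t u * BDet K m (s 0) (s 0) (Fin.removeNth 0 s)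
      - ∑ j, K t (s j) * BDet K m (s j) u (Fin.removeNth j s) := by
  have h0 : (Fin.cons (s 0) (Fin.removeNth 0 s) : Fin (m + 1) → ℝ) = s := by
    simp [Fin.removeNth_zero]
  conv_lhs => unfold BDet
  rw [Matrix.det_succ_row_zero, Fin.sum_univ_succ, sub_eq_add_neg, ← Finset.sum_neg_distrib]
  congr 1
  · unfold BDet
    rw [h0]
    simp
    left
    rfl
  · refine Finset.sum_congr rfl fun j _ => ?_
    have hsub : (Matrix.submatrix (Matrix.of fun i j : Fin (m + 1 + 1) =>
        K ((Fin.cons t s : Fin (m + 1 + 1) → ℝ) i) ((Fin.cons u s : Fin (m + 1 + 1) → ℝ) j))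
          Fin.succ j.succ.succAbove) =
        (Matrix.of fun i k : Fin (m + 1) =>
          K ((Fin.cons (s j) (Fin.removeNth j s) : Fin (m + 1) → ℝ) i)
            ((Fin.cons u (Fin.removeNth j s) : Fin (m + 1) → ℝ) k)).submatrix j.cycleRange id := by
      ext i k
      simp only [Matrix.submatrix_apply, Matrix.of_apply, id, Fin.cons_succ]
      congr 1
      · rw [Fin.cons_apply_cycleRange]
        simp
      · refine Fin.cases ?_ (fun k => ?_) k
        · simp
        · simp [Fin.succ_succAbove_succ, Fin.removeNth]
    rw [hsub, Matrix.det_permute, Fin.sign_cycleRange]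
    unfold BDet
    have : ((-1 : ℝ) ^ (j : ℕ)) * (-1) ^ (j : ℕ) = 1 := by
      rw [← mul_pow]; simp
    simp only [Matrix.of_apply, Fin.cons_zero, Fin.cons_succ, Fin.val_succ, pow_succ]
    push_cast
    linear_combination (-(K t (s j)) * (Matrix.of fun i k : Fin (m + 1) =>
          K ((Fin.cons (s j) (Fin.removeNth j s) : Fin (m + 1) → ℝ) i)
            ((Fin.cons u (Fin.removeNth j s) : Fin (m + 1) → ℝ) k)).det) * this

theorem BDet_bd (K : ℝ → ℝ → ℝ) (hK : Bd fun p : ℝ × ℝ => K p.1 p.2) (m : ℕ) :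
    Bd (fun q : (ℝ × ℝ) × (Fin m → ℝ) => BDet K m q.1.1 q.1.2 q.2) := by
  unfold BDet
  simp only [Matrix.det_apply']
  refine Bd.sum _ fun σ => (Bd.const _).mul (Bd.prod _ fun i => ?_)
  simp only [Matrix.of_apply]
  refine hK.comp (φ := fun q : (ℝ × ℝ) × (Fin m → ℝ) =>
    (((Fin.cons q.1.1 q.2 : Fin (m + 1) → ℝ) (σ i)), (Fin.cons q.1.2 q.2 : Fin (m + 1) → ℝ) i)) ?_
  refine Measurable.prodMk ?_ ?_
  · refine Fin.cases ?_ (fun k => ?_) (σ i)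
    · simp only [Fin.cons_zero]; fun_prop
    · simp only [Fin.cons_succ]; fun_prop
  · refine Fin.cases ?_ (fun k => ?_) i
    · simp only [Fin.cons_zero]; fun_prop
    · simp only [Fin.cons_succ]; fun_prop

/-- Fredholm numerator coefficient -/
noncomputable def DD (K : ℝ → ℝ → ℝ) (b : Measure ℝ) (m : ℕ) (t u : ℝ) : ℝ :=
  ∫ s : Fin m → ℝ, BDet K m t u s ∂(Measure.pi fun _ => b)

theorem integral_removeNth (b : Measure ℝ) [IsFiniteMeasure b] (m : ℕ) (j : Fin (m + 1))
    (G : ℝ × (Fin m → ℝ) → ℝ) (hG : Bd G) :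
    Integrable (fun s : Fin (m + 1) → ℝ => G (s j, Fin.removeNth j s)) (Measure.pi fun _ => b) ∧
    ∫ s : Fin (m + 1) → ℝ, G (s j, Fin.removeNth j s) ∂(Measure.pi fun _ => b) =
      ∫ x, ∫ s, G (x, s) ∂(Measure.pi fun _ => b) ∂b := by
  have h := measurePreserving_piFinSuccAbove (fun _ : Fin (m + 1) => b) j
  have hm : Measurable (fun s : Fin (m + 1) → ℝ => (s j, Fin.removeNth j s)) :=
    (MeasurableEquiv.piFinSuccAbove (fun _ => ℝ) j).measurable
  refine ⟨(hG.comp hm).integrable _, ?_⟩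
  rw [← integral_prod _ (hG.integrable _), ← h.integral_comp']
  rfl

theorem DD_succ (K : ℝ → ℝ → ℝ) (hK : Bd fun p : ℝ × ℝ => K p.1 p.2)
    (b : Measure ℝ) [IsFiniteMeasure b] (m : ℕ) (t u : ℝ) :
    DD K b (m + 1) t u = K t u * ∫ x, DD K b m x x ∂b
      - (m + 1) * ∫ x, K t x * DD K b m x u ∂b := by
  have h1 : Bd (fun q : ℝ × (Fin m → ℝ) => BDet K m q.1 q.1 q.2) :=
    (BDet_bd K hK m).comp (φ := fun q : ℝ × (Fin m → ℝ) => ((q.1, q.1), q.2)) (by fun_prop)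
  have h2 : Bd (fun q : ℝ × (Fin m → ℝ) => K t q.1 * BDet K m q.1 u q.2) :=
    (hK.comp (φ := fun q : ℝ × (Fin m → ℝ) => (t, q.1)) (by fun_prop)).mul
    ((BDet_bd K hK m).comp (φ := fun q : ℝ × (Fin m → ℝ) => ((q.1, u), q.2)) (by fun_prop))
  have i1 := integral_removeNth b m 0 _ h1
  have i2 := fun j => integral_removeNth b m j _ h2
  simp only at i1 i2
  conv_lhs => unfold DD
  simp only [BDet_succ]
  rw [integral_sub (i1.1.const_mul _) (integrable_finsetSum _ fun j _ => (i2 j).1),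
    integral_const_mul, i1.2, integral_finsetSum _ (fun j _ => (i2 j).1)]
  simp only [(i2 _).2, Finset.sum_const, integral_const_mul]
  simp [DD]

theorem setInt_ite (μ : Measure ℝ) (a x : ℝ) (f : ℝ → ℝ) :
    ∫ s in Ioc a x, f s ∂μ = ∫ s, (if a < s ∧ s ≤ x then f s else 0) ∂μ := by
  rw [← integral_indicator measurableSet_Ioc]
  refine integral_congr_ae (Filter.Eventually.of_forall fun y => ?_)
  simp [indicator_apply]

theorem tri_swap (μ ν : Measure ℝ) [IsFiniteMeasure μ] [IsFiniteMeasure ν] (g : ℝ × ℝ → ℝ)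
    (hg : Bd g) (hd : ∀ᵐ w ∂ν, μ {w} = 0 ∨ g (w, w) = 0) (a x : ℝ) :
    ∫ s in Ioc a x, ∫ w in Ioc s x, g (s, w) ∂ν ∂μ =
      ∫ w in Ioc a x, ∫ s in Ioc a w, g (s, w) ∂μ ∂ν := by
  have hL : ∫ s in Ioc a x, ∫ w in Ioc s x, g (s, w) ∂ν ∂μ =
      ∫ s, ∫ w, (if (a < s ∧ s ≤ x) ∧ (s < w ∧ w ≤ x) then g (s, w) else 0) ∂ν ∂μ := by
    rw [setInt_ite]
    congr 1; funext s
    rw [setInt_ite]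
    split_ifs with h <;> simp [h]
  have hR : ∫ w in Ioc a x, ∫ s in Ioc a w, g (s, w) ∂μ ∂ν =
      ∫ w, ∫ s, (if (a < w ∧ w ≤ x) ∧ (a < s ∧ s ≤ w) then g (s, w) else 0) ∂μ ∂ν := by
    rw [setInt_ite]
    congr 1; funext w
    rw [setInt_ite]
    split_ifs with h <;> simp [h]
  rw [hL, hR, integral_integral_swap]
  · refine integral_congr_ae ?_
    filter_upwards [hd] with w hw
    refine integral_congr_ae ?_
    rcases hw with hw | hw
    · have : ∀ᵐ s ∂μ, s ≠ w := by
        rw [ae_iff]; simpa using hw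
      filter_upwards [this] with s hs
      refine if_congr ?_ rfl rfl
      constructor
      · rintro ⟨⟨h1, h2⟩, h3, h4⟩
        exact ⟨⟨by linarith, h4⟩, h1, h3.le⟩
      · rintro ⟨⟨h1, h2⟩, h3, h4⟩
        exact ⟨⟨h3, by linarith⟩, lt_of_le_of_ne h4 hs, h2⟩
    · refine Filter.Eventually.of_forall fun s => ?_
      dsimp only
      by_cases hs : s = w
      · subst hs
        simp [hw]
      refine if_congr ?_ rfl rfl
      constructor
      · rintro ⟨⟨h1, h2⟩, h3, h4⟩
        exact ⟨⟨by linarith, h4⟩, h1, h3.le⟩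
      · rintro ⟨⟨h1, h2⟩, h3, h4⟩
        exact ⟨⟨h3, by linarith⟩, lt_of_le_of_ne h4 hs, h2⟩
  · refine Bd.integrable (f := fun q : ℝ × ℝ =>
      if (a < q.1 ∧ q.1 ≤ x) ∧ (q.1 < q.2 ∧ q.2 ≤ x) then g q else 0) (hg.ind ?_) _
    measurability

theorem ae_no_atom (b c : Measure ℝ) [IsFiniteMeasure b] (hc : ∀ x : ℝ, c {x} = 0) :
    ∀ᵐ w ∂c, b {w} = 0 := by
  have : NullSingletonClass c := ⟨hc⟩
  have h : {w : ℝ | 0 < b {w}}.Countable :=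
    Measure.countable_meas_pos_of_disjoint_iUnion (μ := b) (As := fun w : ℝ => {w})
      (fun w => measurableSet_singleton w) (fun x y hxy => by simpa using hxy)
  rw [ae_iff]
  have h2 : {w : ℝ | ¬ b {w} = 0} = {w : ℝ | 0 < b {w}} := by
    ext w; simp [pos_iff_ne_zero]
  rw [h2]
  exact h.measure_zero c

set_option linter.unusedSectionVars false

section Psi
variable (c b : Measure ℝ) [IsFiniteMeasure c] [IsFiniteMeasure b]

theorem psi0_bd (n : ℕ) : Bd (fun p : ℝ × ℝ => Psi0c c b n p.1 p.2) := by
  induction n with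
  | zero => simpa [Psi0c] using Bd.const 1
  | succ n ih =>
    simp only [Psi0c]
    have h1 : Bd (fun q : (ℝ × ℝ) × ℝ => ∫ v in Ioc q.1.1 q.2, Psi0c c b n q.1.1 v ∂c) :=
      Bd.integralIoc (F := fun r : ((ℝ × ℝ) × ℝ) × ℝ => Psi0c c b n r.1.1.1 r.2)
        (ih.comp (φ := fun r : ((ℝ × ℝ) × ℝ) × ℝ => (r.1.1.1, r.2)) (by fun_prop)) c
        (lo := fun q : (ℝ × ℝ) × ℝ => q.1.1) (hi := fun q => q.2) (by fun_prop) (by fun_prop)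
    exact Bd.integralIoc h1 b (lo := fun q : ℝ × ℝ => q.1) (hi := fun q => q.2)
      (by fun_prop) (by fun_prop)

theorem psi1_bd (n : ℕ) : Bd (fun p : ℝ × ℝ => Psi1c c b n p.1 p.2) := by
  unfold Psi1c
  exact Bd.integralIoc (F := fun r : (ℝ × ℝ) × ℝ => Psi0c c b n r.1.1 r.2)
        ((psi0_bd c b n).comp (φ := fun r : (ℝ × ℝ) × ℝ => (r.1.1, r.2)) (by fun_prop)) c
        (lo := fun q : ℝ × ℝ => q.1) (hi := fun q => q.2) (by fun_prop) (by fun_prop)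

theorem psi0_succ (n : ℕ) (a x : ℝ) :
    Psi0c c b (n + 1) a x = ∫ w in Ioc a x, Psi1c c b n a w ∂b := rfl

/-- the iterated integration operator -/
noncomputable def TT (u : ℝ) (f : ℝ → ℝ) (x : ℝ) : ℝ :=
  ∫ w in Ioc u x, ∫ v in Ioc u w, f v ∂c ∂b

theorem TT_psi (n : ℕ) (a x : ℝ) : TT c b a (fun v => Psi0c c b n a v) x = Psi0c c b (n + 1) a x :=
  rfl

theorem inner_bd (u : ℝ) {f : ℝ → ℝ} (hf : Bd f) : Bd (fun w => ∫ v in Ioc u w, f v ∂c) :=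
  Bd.integralIoc (F := fun r : ℝ × ℝ => f r.2) (hf.comp measurable_snd) c
    (lo := fun _ => u) (hi := fun q => q) (by fun_prop) (by fun_prop)

theorem TT_add (u x : ℝ) {f g : ℝ → ℝ} (hf : Bd f) (hg : Bd g) :
    TT c b u (fun v => f v + g v) x = TT c b u f x + TT c b u g x := by
  unfold TT
  rw [← integral_add ((inner_bd c u hf).integrable _) ((inner_bd c u hg).integrable _)]
  congr 1; funext w
  rw [← integral_add (hf.integrable _) (hg.integrable _)]

theorem TT_mul (u x r : ℝ) (f : ℝ → ℝ) :
    TT c b u (fun v => r * f v) x = r * TT c b u f x := by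
  unfold TT
  simp only [integral_const_mul]

theorem TT_sum (u x : ℝ) {ι : Type*} (s : Finset ι) {f : ι → ℝ → ℝ} (hf : ∀ i, Bd (f i)) :
    TT c b u (fun v => ∑ i ∈ s, f i v) x = ∑ i ∈ s, TT c b u (f i) x := by
  classical
  induction s using Finset.induction_on with
  | empty => simp [TT]
  | insert a s ha ih =>
    simp only [Finset.sum_insert ha]
    rw [TT_add c b u x (hf a) (Bd.sum s hf), ih]

theorem psi_conv (hc : ∀ x : ℝ, c {x} = 0) (h : ℝ → ℝ) (hh : Bd h) (n : ℕ) (a x : ℝ) :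
    ∫ s in Ioc a x, h s * Psi0c c b (n + 1) s x ∂b =
      TT c b a (fun v => ∫ s in Ioc a v, h s * Psi0c c b n s v ∂b) x := by
  unfold TT
  have e1 : ∫ s in Ioc a x, h s * Psi0c c b (n + 1) s x ∂b =
      ∫ s in Ioc a x, ∫ w in Ioc s x, h s * Psi1c c b n s w ∂b ∂b := by
    simp only [psi0_succ, integral_const_mul]
  rw [e1, tri_swap b b (fun q => h q.1 * Psi1c c b n q.1 q.2)
    ((hh.comp measurable_fst).mul (psi1_bd c b n))
    (Filter.Eventually.of_forall fun w => Or.inr (by simp [Psi1c]))]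
  congr 1; funext w
  have e2 : ∫ s in Ioc a w, h s * Psi1c c b n s w ∂b =
      ∫ s in Ioc a w, ∫ v in Ioc s w, h s * Psi0c c b n s v ∂c ∂b := by
    simp only [Psi1c, integral_const_mul]
  dsimp only
  rw [e2, tri_swap b c (fun q => h q.1 * Psi0c c b n q.1 q.2)
    ((hh.comp measurable_fst).mul (psi0_bd c b n))
    ((ae_no_atom b c hc).mono fun w hw => Or.inl hw)]

theorem psi_A (hc : ∀ x : ℝ, c {x} = 0) (l n : ℕ) (a x : ℝ) :
    ∫ s in Ioc a x, Psi1c c b l a s * Psi0c c b n s x ∂b = Psi0c c b (l + n + 1) a x := by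
  induction n generalizing x with
  | zero => simp [Psi0c, Psi1c]
  | succ n ih =>
    rw [psi_conv c b hc (fun s => Psi1c c b l a s)
      ((psi1_bd c b l).comp (φ := fun s : ℝ => (a, s)) (by fun_prop))]
    simp only [ih, TT_psi]
    rfl

/-- auxiliary -/
noncomputable def GG (n : ℕ) (u x : ℝ) : ℝ := ∫ s in Ioc u x, Psi0c c b n s x ∂b

theorem GG_bd (n : ℕ) (u : ℝ) : Bd (fun x => GG c b n u x) :=
  Bd.integralIoc (F := fun r : ℝ × ℝ => Psi0c c b n r.2 r.1)
    ((psi0_bd c b n).comp (φ := fun r : ℝ × ℝ => (r.2, r.1)) (by fun_prop)) b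
    (lo := fun _ => u) (hi := fun q => q) (by fun_prop) (by fun_prop)

theorem TT_GG (hc : ∀ x : ℝ, c {x} = 0) (n : ℕ) (u x : ℝ) :
    TT c b u (fun v => GG c b n u v) x = GG c b (n + 1) u x := by
  have := psi_conv c b hc (fun _ => 1) (Bd.const 1) n u x
  simp only [one_mul] at this
  unfold GG
  rw [this]

theorem split_Ioc (μ : Measure ℝ) [IsFiniteMeasure μ] {f : ℝ → ℝ} (hf : Bd f) {a u x : ℝ}
    (h1 : a ≤ u) (h2 : u ≤ x) :
    ∫ s in Ioc a x, f s ∂μ = ∫ s in Ioc a u, f s ∂μ + ∫ s in Ioc u x, f s ∂μ := by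
  rw [← Ioc_union_Ioc_eq_Ioc h1 h2, setIntegral_union (Ioc_disjoint_Ioc_of_le le_rfl)
    measurableSet_Ioc (hf.integrable _).integrableOn (hf.integrable _).integrableOn]

theorem psi_CK (hc : ∀ x : ℝ, c {x} = 0) (m : ℕ) (a u x : ℝ) (hau : a ≤ u) (hux : u ≤ x) :
    Psi0c c b m a x =
      ∑ l ∈ Finset.range (m + 1), Psi0c c b l a u * Psi0c c b (m - l) u x +
      ∑ l ∈ Finset.range m, Psi1c c b l a u * GG c b (m - 1 - l) u x := by
  induction m generalizing x with
  | zero => simp [Psi0c]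
  | succ m ih =>
    have b0 : ∀ n a, Bd (fun v => Psi0c c b n a v) := fun n a =>
      (psi0_bd c b n).comp (φ := fun s : ℝ => (a, s)) (by fun_prop)
    have b1 : ∀ n a, Bd (fun v => Psi1c c b n a v) := fun n a =>
      (psi1_bd c b n).comp (φ := fun s : ℝ => (a, s)) (by fun_prop)
    have hT : ∫ w in Ioc u x, Psi1c c b m a w ∂b =
        Psi1c c b m a u * GG c b 0 u x + TT c b u (fun v => Psi0c c b m a v) x := by
      have : ∫ w in Ioc u x, Psi1c c b m a w ∂b = ∫ w in Ioc u x, (Psi1c c b m a u * 1 +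
          ∫ v in Ioc u w, Psi0c c b m a v ∂c) ∂b := by
        refine setIntegral_congr_fun measurableSet_Ioc fun w hw => ?_
        unfold Psi1c
        rw [split_Ioc c (b0 m a) hau hw.1.le, mul_one]
      rw [this, integral_add (integrable_const _) ((inner_bd c u (b0 m a)).integrable _),
        integral_const_mul]
      simp [TT, GG, Psi0c]
    have hT2 : TT c b u (fun v => Psi0c c b m a v) x =
        TT c b u (fun v =>
          (∑ l ∈ Finset.range (m + 1), Psi0c c b l a u * Psi0c c b (m - l) u v) +
          ∑ l ∈ Finset.range m, Psi1c c b l a u * GG c b (m - 1 - l) u v) x := by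
      unfold TT
      refine setIntegral_congr_fun measurableSet_Ioc fun w hw => ?_
      refine setIntegral_congr_fun measurableSet_Ioc fun v hv => ?_
      exact ih v hv.1.le
    rw [TT_add c b u x (Bd.sum _ fun l => (Bd.const _).mul (b0 _ _))
        (Bd.sum _ fun l => (Bd.const _).mul (GG_bd c b _ _)),
      TT_sum c b u x _ (fun l => (Bd.const _).mul (b0 _ _)),
      TT_sum c b u x _ (fun l => (Bd.const _).mul (GG_bd c b _ _))] at hT2
    simp only [TT_mul, TT_psi, TT_GG c b hc] at hT2
    rw [psi0_succ, split_Ioc b (b1 m a) hau hux, hT, hT2, ← psi0_succ,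
      Finset.sum_range_succ (fun l => Psi0c c b l a u * Psi0c c b (m + 1 - l) u x) (m + 1),
      Finset.sum_range_succ (fun l => Psi1c c b l a u * GG c b (m + 1 - 1 - l) u x) m]
    have s1 : ∑ l ∈ Finset.range (m + 1), Psi0c c b l a u * Psi0c c b (m + 1 - l) u x =
        ∑ l ∈ Finset.range (m + 1), Psi0c c b l a u * Psi0c c b (m - l + 1) u x :=
      Finset.sum_congr rfl fun l hl => by
        rw [Nat.sub_add_comm (by simp at hl; omega)]
    have s2 : ∑ l ∈ Finset.range m, Psi1c c b l a u * GG c b (m + 1 - 1 - l) u x =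
        ∑ l ∈ Finset.range m, Psi1c c b l a u * GG c b (m - 1 - l + 1) u x :=
      Finset.sum_congr rfl fun l hl => by
        have : m + 1 - 1 - l = m - 1 - l + 1 := by simp at hl; omega
        rw [this]
    rw [s1, s2, Nat.sub_self, Nat.add_sub_cancel, Nat.sub_self]
    simp only [Psi0c]
    ring

/-- distribution function -/
noncomputable def FF (x : ℝ) : ℝ := (c (Ioc 0 x)).toReal

theorem FF_bd : Bd (fun x => FF c x) := by
  have : (fun x => FF c x) = fun x => ∫ v in Ioc 0 x, (1 : ℝ) ∂c := by
    funext x; simp [FF, measureReal_def]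
  rw [this]
  exact inner_bd c 0 (Bd.const 1)

theorem FF_sub (s t : ℝ) (hs : 0 ≤ s) :
    FF c t - FF c (min t s) = c.real (Ioc s t) := by
  have hF : ∀ x, FF c x = ∫ v in Ioc 0 x, (1 : ℝ) ∂c := fun x => by simp [FF, measureReal_def]
  rcases le_total s t with h | h
  · rw [min_eq_right h, hF, hF, split_Ioc c (Bd.const 1) hs h]
    simp
  · rw [min_eq_left h, Ioc_eq_empty (by simpa using h)]
    simp

theorem J0 (hc : ∀ x : ℝ, c {x} = 0) (l : ℕ) (t u : ℝ) (ht : 0 ≤ t) (htu : t ≤ u) :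
    ∫ s in Ioc 0 u, FF c (min t s) * Psi1c c b l 0 s ∂b =
      FF c t * Psi0c c b (l + 1) 0 u - Psi1c c b (l + 1) 0 t := by
  have b1 : ∀ n a, Bd (fun v => Psi1c c b n a v) := fun n a =>
    (psi1_bd c b n).comp (φ := fun s : ℝ => (a, s)) (by fun_prop)
  have bR : Bd (fun s => c.real (Ioc s t)) := by
    have : (fun s => c.real (Ioc s t)) = fun s => ∫ v in Ioc s t, (1 : ℝ) ∂c := by
      funext x; simp
    rw [this]
    exact Bd.integralIoc (F := fun _ : ℝ × ℝ => (1 : ℝ)) (Bd.const 1) c (lo := fun s : ℝ => s)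
      (hi := fun _ => t) (by fun_prop) (by fun_prop)
  have e1 : ∫ s in Ioc 0 u, FF c (min t s) * Psi1c c b l 0 s ∂b =
      ∫ s in Ioc 0 u, (FF c t * Psi1c c b l 0 s - c.real (Ioc s t) * Psi1c c b l 0 s) ∂b := by
    refine setIntegral_congr_fun measurableSet_Ioc fun s hs => ?_
    rw [← FF_sub c s t hs.1.le]
    ring
  rw [e1, integral_sub (((Bd.const _).mul (b1 l 0)).integrable _) ((bR.mul (b1 l 0)).integrable _),
    integral_const_mul, ← psi0_succ, split_Ioc b (bR.mul (b1 l 0)) ht htu]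
  have e2 : ∫ s in Ioc t u, c.real (Ioc s t) * Psi1c c b l 0 s ∂b = 0 := by
    refine setIntegral_eq_zero_of_forall_eq_zero fun s hs => ?_
    rw [Ioc_eq_empty (by simpa using hs.1.le)]
    simp
  have e3 : ∫ s in Ioc 0 t, c.real (Ioc s t) * Psi1c c b l 0 s ∂b = Psi1c c b (l + 1) 0 t := by
    have : ∫ s in Ioc 0 t, c.real (Ioc s t) * Psi1c c b l 0 s ∂b =
        ∫ s in Ioc 0 t, ∫ w in Ioc s t, Psi1c c b l 0 s ∂c ∂b := by simp
    rw [this, tri_swap b c (fun q => Psi1c c b l 0 q.1) ((b1 l 0).comp measurable_fst)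
      ((ae_no_atom b c hc).mono fun w hw => Or.inl hw)]
    rfl
  rw [e2, e3, add_zero]

/-- right hand side sum -/
noncomputable def EE (τ : ℝ) (m : ℕ) (t u : ℝ) : ℝ :=
  ∑ l ∈ Finset.range (m + 1), Psi1c c b l 0 (min t u) * Psi0c c b (m - l) (max t u) τ

theorem EE_symm (τ : ℝ) (m : ℕ) (t u : ℝ) : EE c b τ m t u = EE c b τ m u t := by
  unfold EE
  rw [min_comm, max_comm]

theorem EE_term_bd (τ : ℝ) (m l : ℕ) (t u : ℝ) :
    Bd (fun s => FF c (min t s) * (Psi1c c b l 0 (min s u) * Psi0c c b m (max s u) τ)) :=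
  ((FF_bd c).comp (φ := fun s : ℝ => min t s) (by fun_prop)).mul
    (((psi1_bd c b l).comp (φ := fun s : ℝ => (0, min s u)) (by fun_prop)).mul
      ((psi0_bd c b m).comp (φ := fun s : ℝ => (max s u, τ)) (by fun_prop)))

theorem EE_rec (hc : ∀ x : ℝ, c {x} = 0) (τ : ℝ) (m : ℕ) (t u : ℝ) (ht : 0 ≤ t) (htu : t ≤ u)
    (hu : u ≤ τ) :
    EE c b τ (m + 1) t u = FF c t * Psi0c c b (m + 1) 0 τ -
      ∫ s in Ioc 0 τ, FF c (min t s) * EE c b τ m s u ∂b := by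
  have hJ : ∀ l, ∫ s in Ioc 0 τ, FF c (min t s) *
      (Psi1c c b l 0 (min s u) * Psi0c c b (m - l) (max s u) τ) ∂b =
      (FF c t * Psi0c c b (l + 1) 0 u - Psi1c c b (l + 1) 0 t) * Psi0c c b (m - l) u τ +
        FF c t * Psi1c c b l 0 u * GG c b (m - l) u τ := by
    intro l
    rw [split_Ioc b (EE_term_bd c b τ (m - l) l t u) (ht.trans htu) hu]
    congr 1
    · rw [← J0 c b hc l t u ht htu, ← integral_mul_const]
      refine setIntegral_congr_fun measurableSet_Ioc fun s hs => ?_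
      rw [min_eq_left hs.2, max_eq_right hs.2, mul_assoc]
    · unfold GG
      rw [← integral_const_mul]
      refine setIntegral_congr_fun measurableSet_Ioc fun s hs => ?_
      rw [min_eq_right hs.1.le, max_eq_left hs.1.le, min_eq_left (htu.trans hs.1.le), mul_assoc]
  have hI : ∫ s in Ioc 0 τ, FF c (min t s) * EE c b τ m s u ∂b =
      ∑ l ∈ Finset.range (m + 1),
        ((FF c t * Psi0c c b (l + 1) 0 u - Psi1c c b (l + 1) 0 t) * Psi0c c b (m - l) u τ +
        FF c t * Psi1c c b l 0 u * GG c b (m - l) u τ) := by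
    unfold EE
    simp only [Finset.mul_sum]
    rw [integral_finsetSum _ fun l _ => (EE_term_bd c b τ (m - l) l t u).integrable _]
    exact Finset.sum_congr rfl fun l _ => hJ l
  rw [hI, psi_CK c b hc (m + 1) 0 u τ (ht.trans htu) hu]
  unfold EE
  rw [min_eq_left htu, max_eq_right htu, Finset.sum_range_succ' _ (m + 1),
    Finset.sum_range_succ' _ (m + 1)]
  have h10 : Psi1c c b 0 0 t = FF c t := by simp [Psi1c, Psi0c, FF, measureReal_def]
  have h00 : Psi0c c b 0 0 u = 1 := rfl
  rw [h10, h00]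
  simp only [Nat.add_sub_add_right, Nat.sub_zero, Nat.add_sub_cancel, Finset.sum_add_distrib,
    sub_mul, Finset.sum_sub_distrib, mul_add, Finset.mul_sum, mul_assoc]
  ring

theorem EE_diag (hc : ∀ x : ℝ, c {x} = 0) (τ : ℝ) (m : ℕ) :
    ∫ s in Ioc 0 τ, EE c b τ m s s ∂b = (m + 1) * Psi0c c b (m + 1) 0 τ := by
  unfold EE
  simp only [min_self, max_self]
  rw [integral_finsetSum _ fun l _ => (((psi1_bd c b l).comp (φ := fun s : ℝ => (0, s))
    (by fun_prop)).mul ((psi0_bd c b (m - l)).comp (φ := fun s : ℝ => (s, τ))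
    (by fun_prop))).integrable _]
  have : ∀ l ∈ Finset.range (m + 1), ∫ s in Ioc 0 τ, Psi1c c b l 0 s * Psi0c c b (m - l) s τ ∂b =
      Psi0c c b (m + 1) 0 τ := by
    intro l hl
    rw [psi_A c b hc]
    congr 1
    simp at hl
    omega
  rw [Finset.sum_congr rfl this]
  simp

theorem DD_eq (hc : ∀ x : ℝ, c {x} = 0) (τ : ℝ) (hb : b (Ioc 0 τ)ᶜ = 0) (m : ℕ) :
    ∀ t ∈ Ioc 0 τ, ∀ u ∈ Ioc 0 τ,
      DD (fun x y => FF c (min x y)) b m t u = m.factorial * EE c b τ m t u := by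
  have hr : b.restrict (Ioc 0 τ) = b := Measure.restrict_eq_self_of_ae_mem (by
    rw [ae_iff]; exact hb)
  have hr' : ∀ f : ℝ → ℝ, ∫ s, f s ∂b = ∫ s in Ioc 0 τ, f s ∂b := fun f => by rw [hr]
  have hK : Bd fun p : ℝ × ℝ => FF c (min p.1 p.2) :=
    (FF_bd c).comp (φ := fun p : ℝ × ℝ => min p.1 p.2) (by fun_prop)
  have hsym : ∀ n t u, DD (fun x y => FF c (min x y)) b n t u =
      DD (fun x y => FF c (min x y)) b n u t := by
    intro n t u
    unfold DD
    congr 1; funext s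
    exact BDet_symm _ (fun x y => by rw [min_comm]) _ _ _ _
  induction m with
  | zero =>
    intro t ht u hu
    simp [DD, BDet, EE, Psi1c, Psi0c, FF, measureReal_def]
  | succ m ih =>
    have key : ∀ t ∈ Ioc 0 τ, ∀ u ∈ Ioc 0 τ, t ≤ u →
        DD (fun x y => FF c (min x y)) b (m + 1) t u = (m + 1).factorial * EE c b τ (m + 1) t u := by
      intro t ht u hu htu
      rw [DD_succ _ hK]
      have e1 : ∫ x, DD (fun x y => FF c (min x y)) b m x x ∂b =
          m.factorial * ((m + 1) * Psi0c c b (m + 1) 0 τ) := by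
        rw [← EE_diag c b hc τ m, ← integral_const_mul]
        rw [hr']
        exact setIntegral_congr_fun measurableSet_Ioc fun s hs => ih s hs s hs
      have e2 : ∫ x, FF c (min t x) * DD (fun x y => FF c (min x y)) b m x u ∂b =
          m.factorial * ∫ s in Ioc 0 τ, FF c (min t s) * EE c b τ m s u ∂b := by
        rw [← integral_const_mul]
        rw [hr']
        refine setIntegral_congr_fun measurableSet_Ioc fun s hs => ?_
        rw [ih s hs u hu]
        ring
      rw [e1, e2, EE_rec c b hc τ m t u ht.1.le htu hu.2, min_eq_left htu, Nat.factorial_succ]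
      push_cast
      ring
    intro t ht u hu
    rcases le_total t u with h | h
    · exact key t ht u hu h
    · rw [hsym, EE_symm]
      exact key u hu t ht h

end Psi

theorem borderVec_eq (m : ℕ) (x : ℝ) (s : Fin m → ℝ) : borderVec m x s = Fin.cons x s := by
  funext i
  refine Fin.cases ?_ (fun k => ?_) i
  · simp [borderVec]
  · simp [borderVec]

theorem fredholm_numerator_coefficient
    (τ : ℝ) (hτ : 0 < τ) (c b : Measure ℝ) [IsFiniteMeasure c] [IsFiniteMeasure b]
    (hcatomless : ∀ x : ℝ, c {x} = 0)
    (hcsupp : c (Set.Ioc 0 τ)ᶜ = 0) (hbsupp : b (Set.Ioc 0 τ)ᶜ = 0)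
    (t u : ℝ) (ht : t ∈ Set.Ioc 0 τ) (hu : u ∈ Set.Ioc 0 τ)
    (m : ℕ) (hm : 1 ≤ m) :
    (∫ s : Fin m → ℝ,
        (Matrix.of fun i j : Fin (m + 1) =>
          (c (Set.Ioc 0 (min (borderVec m t s i) (borderVec m u s j)))).toReal).det
        ∂(Measure.pi fun _ => b)) =
      (m.factorial : ℝ) *
        ∑ l ∈ Finset.range (m + 1),
          Psi1c c b l 0 (min t u) * Psi0c c b (m - l) (max t u) τ := by
  have h := DD_eq c b hcatomless τ hbsupp m t ht u hu
  unfold DD BDet EE FF at h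
  simp only [borderVec_eq]
  exact h
end

section
/- Let τ>0, let b be a finite (nonnegative) Borel measure on (0,τ], let y:[0,τ]→ℝ be a bounded right-continuous function with left limits, and let x:[0,τ]→[0,∞) be a right-continuous function with left limits satisfying x(t) ≤ y(t) + ∫_{(0,t]} x(u−) b(du) for all t∈[0,τ], where x(u−) denotes the left limit of x at u. Then x(t) ≤ M·exp(b((0,t])) for all t∈[0,τ], where M = sup_{u∈[0,τ]} max(|y(u)|, |y(u−)|). In particular, sup_{t∈[0,τ]} e^{−b((0,t])} x(t) ≤ M. -/
open MeasureTheory Set Function Filter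

theorem gron_aux (μ : Measure ℝ) [IsFiniteMeasure μ] (t : ℝ) (hμ : μ (Set.Ioc 0 t)ᶜ = 0) :
    Integrable (fun u => Real.exp (μ.real (Iio u))) μ ∧
    ∫ u, Real.exp (μ.real (Iio u)) ∂μ ≤ Real.exp (μ.real univ) - 1 := by
  have hmonoF : Monotone (fun u => Real.exp (μ.real (Iio u))) := by
    intro a c hac
    exact Real.exp_le_exp.2 (measureReal_mono (Iio_subset_Iio hac))
  have hmeas : Measurable (fun u => Real.exp (μ.real (Iio u))) := hmonoF.measurable
  have hint : Integrable (fun u => Real.exp (μ.real (Iio u))) μ := by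
    refine Integrable.of_bound hmeas.aestronglyMeasurable (Real.exp (μ.real univ)) ?_
    refine Eventually.of_forall fun u => ?_
    rw [Real.norm_eq_abs, abs_of_pos (Real.exp_pos _)]
    exact Real.exp_le_exp.2 (measureReal_mono (subset_univ _))
  refine ⟨hint, ?_⟩
  set m := μ.real univ with hm
  have hm0 : 0 ≤ m := measureReal_nonneg
  set F : ℝ → ℝ := fun u => μ.real (Iic u) with hF
  have hFmono : Monotone F := fun a c hac => measureReal_mono (Iic_subset_Iic.2 hac)
  have hFm : ∀ u, F u ≤ m := fun u => measureReal_mono (subset_univ _)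
  have hFt : F t = m := by
    have h1 : μ (Iic t)ᶜ = 0 :=
      measure_mono_null (show (Iic t)ᶜ ⊆ (Ioc 0 t)ᶜ from
        compl_subset_compl.2 (fun u hu => hu.2)) hμ
    have := measureReal_add_measureReal_compl (μ := μ) (measurableSet_Iic (a := t))
    have h2 : μ.real (Iic t)ᶜ = 0 := by rw [Measure.real, h1]; rfl
    simp only [hF, hm]; linarith
  have hF0 : ∀ u ≤ 0, F u = 0 := by
    intro u hu
    have : μ (Iic u) = 0 :=
      measure_mono_null (show Iic u ⊆ (Ioc 0 t)ᶜ from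
        fun w hw hw' => absurd hw'.1 (not_lt.2 (le_trans hw hu))) hμ
    simp [hF, Measure.real, this]
  have hFrc : ∀ s, ∀ v, (∀ r, s < r → v ≤ F r) → v ≤ F s := by
    intro s v h
    have h1 : Tendsto (fun n : ℕ => μ (Iic (s + 1 / ((n : ℝ) + 1)))) atTop
        (nhds (μ (⋂ n : ℕ, Iic (s + 1 / ((n : ℝ) + 1))))) := by
      refine tendsto_measure_iInter_atTop (fun _ => measurableSet_Iic.nullMeasurableSet) ?_
        ⟨0, measure_ne_top _ _⟩
      intro a c hac
      refine Iic_subset_Iic.2 ?_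
      have := Nat.one_div_le_one_div (α := ℝ) hac
      linarith
    have h2 : (⋂ n : ℕ, Iic (s + 1 / ((n : ℝ) + 1))) = Iic s := by
      ext w
      simp only [mem_iInter, mem_Iic]
      constructor
      · intro hw
        refine le_of_forall_pos_le_add fun ε hε => ?_
        obtain ⟨n, hn⟩ := exists_nat_one_div_lt hε
        linarith [hw n]
      · intro hw n
        have : (0:ℝ) < 1 / ((n : ℝ) + 1) := by positivity
        linarith
    rw [h2] at h1
    have h3 := (ENNReal.tendsto_toReal (measure_ne_top μ (Iic s))).comp h1
    refine ge_of_tendsto' h3 fun n => h _ ?_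
    have : (0:ℝ) < 1 / ((n : ℝ) + 1) := by positivity
    linarith
  set Q : ℝ → ℝ := fun v => sInf {u | v ≤ F u} with hQ
  have hbdd : ∀ v, 0 < v → BddBelow {u | v ≤ F u} := by
    intro v hv
    refine ⟨0, fun u hu => ?_⟩
    by_contra hc
    have := hF0 u (not_le.1 hc).le
    simp only [mem_ofPred_eq] at hu
    linarith
  have hgal : ∀ v ∈ Ioc 0 m, ∀ s, Q v ≤ s ↔ v ≤ F s := by
    intro v hv s
    constructor
    · intro h
      refine hFrc s v fun r hr => ?_
      obtain ⟨w, hw, hwr⟩ := exists_lt_of_csInf_lt ⟨t, by simpa [hFt] using hv.2⟩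
        (lt_of_le_of_lt h hr)
      exact le_trans hw (hFmono hwr.le)
    · intro h
      exact csInf_le (hbdd v hv.1) h
  have hQmono : MonotoneOn Q (Ioc 0 m) := by
    intro a ha c hc hac
    rw [hgal a ha]
    exact hac.trans ((hgal c hc _).1 le_rfl)
  have hQm : AEMeasurable Q (volume.restrict (Ioc 0 m)) :=
    aemeasurable_restrict_of_monotoneOn measurableSet_Ioc hQmono
  have hmap : (volume.restrict (Ioc 0 m)).map Q = μ := by
    refine Measure.ext_of_Iic _ _ fun s => ?_
    rw [Measure.map_apply_of_aemeasurable hQm measurableSet_Iic,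
      Measure.restrict_apply' measurableSet_Ioc]
    have : Q ⁻¹' Iic s ∩ Ioc 0 m = Ioc 0 (F s) := by
      ext v
      constructor
      · rintro ⟨h1, h2⟩
        exact ⟨h2.1, (hgal v h2 s).1 h1⟩
      · intro h
        have h2 : v ∈ Ioc 0 m := ⟨h.1, h.2.trans (hFm s)⟩
        exact ⟨(hgal v h2 s).2 h.2, h2⟩
    rw [this, Real.volume_Ioc, sub_zero]
    exact ENNReal.ofReal_toReal (measure_ne_top _ _)
  have hlt : ∀ v ∈ Ioc 0 m, μ.real (Iio (Q v)) ≤ v := by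
    intro v hv
    have h1 : μ (Iio (Q v)) ≤ ENNReal.ofReal v := by
      conv_lhs => rw [← hmap]
      rw [Measure.map_apply_of_aemeasurable hQm measurableSet_Iio,
        Measure.restrict_apply' measurableSet_Ioc]
      calc _ ≤ volume (Ioc 0 v) := by
            refine measure_mono ?_
            rintro w ⟨h1, h2⟩
            refine ⟨h2.1, ?_⟩
            by_contra hc
            exact absurd (hQmono hv h2 (not_le.1 hc).le) (not_le.2 h1)
        _ = _ := by rw [Real.volume_Ioc, sub_zero]
    exact ENNReal.toReal_le_of_le_ofReal hv.1.le h1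
  have hI : ∫ u, Real.exp (μ.real (Iio u)) ∂μ
      = ∫ v in Ioc 0 m, Real.exp (μ.real (Iio (Q v))) := by
    have := integral_map hQm (f := fun u => Real.exp (μ.real (Iio u)))
      hmeas.aestronglyMeasurable
    rw [← this, hmap]
  rw [hI]
  calc _ ≤ ∫ v in Ioc 0 m, Real.exp v := by
        refine integral_mono_of_nonneg (Eventually.of_forall fun v => (Real.exp_pos _).le) ?_ ?_
        · exact (Real.continuous_exp.integrableOn_Icc).mono_set Ioc_subset_Icc_self
        · filter_upwards [ae_restrict_mem measurableSet_Ioc] with v hv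
          exact Real.exp_le_exp.2 (hlt v hv)
    _ = Real.exp m - 1 := by
        rw [← intervalIntegral.integral_of_le hm0, integral_exp, Real.exp_zero]

theorem measure_gronwall_inequality
    (τ : ℝ) (hτ : 0 < τ)
    (b : Measure ℝ) [IsFiniteMeasure b] (hbsupp : b (Set.Ioc 0 τ)ᶜ = 0)
    (y : ℝ → ℝ)
    (hybd : ∃ C : ℝ, ∀ t ∈ Set.Icc 0 τ, |y t| ≤ C)
    (hyrc : ∀ t ∈ Set.Ico 0 τ, Tendsto y (nhdsWithin t (Set.Ici t)) (nhds (y t)))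
    (hyll : ∀ t ∈ Set.Ioc 0 τ, ∃ l : ℝ, Tendsto y (nhdsWithin t (Set.Iio t)) (nhds l))
    (x : ℝ → ℝ) (hxnn : ∀ t ∈ Set.Icc 0 τ, 0 ≤ x t)
    (hxrc : ∀ t ∈ Set.Ico 0 τ, Tendsto x (nhdsWithin t (Set.Ici t)) (nhds (x t)))
    (hxll : ∀ t ∈ Set.Ioc 0 τ, ∃ l : ℝ, Tendsto x (nhdsWithin t (Set.Iio t)) (nhds l))
    (hineq : ∀ t ∈ Set.Icc 0 τ,
      x t ≤ y t + ∫ u in Set.Ioc 0 t, Function.leftLim x u ∂b) :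
    (∀ t ∈ Set.Icc 0 τ,
      x t ≤ sSup (((fun u => |y u|) '' Set.Icc 0 τ) ∪
              ((fun u => |Function.leftLim y u|) '' Set.Ioc 0 τ)) *
            Real.exp ((b (Set.Ioc 0 t)).toReal)) ∧
    (∀ t ∈ Set.Icc 0 τ,
      Real.exp (-(b (Set.Ioc 0 t)).toReal) * x t ≤
        sSup (((fun u => |y u|) '' Set.Icc 0 τ) ∪
          ((fun u => |Function.leftLim y u|) '' Set.Ioc 0 τ))) := by
  set S := (((fun u => |y u|) '' Set.Icc 0 τ) ∪
          ((fun u => |Function.leftLim y u|) '' Set.Ioc 0 τ)) with hS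
  have hev : ∀ u ∈ Ioc 0 τ, ∀ᶠ s in nhdsWithin u (Iio u), s ∈ Ioo 0 u := fun u hu =>
    Ioo_mem_nhdsLT hu.1
  have hlim : ∀ (f : ℝ → ℝ) (u : ℝ), (∃ l : ℝ, Tendsto f (nhdsWithin u (Iio u)) (nhds l)) →
      Tendsto f (nhdsWithin u (Iio u)) (nhds (leftLim f u)) := by
    rintro f u ⟨l, hl⟩
    rwa [leftLim_eq_of_tendsto hl]
  have hbdd : BddAbove S := by
    obtain ⟨C, hC⟩ := hybd
    refine ⟨C, ?_⟩
    rintro _ (⟨u, hu, rfl⟩ | ⟨u, hu, rfl⟩)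
    · exact hC u hu
    · refine le_of_tendsto (hlim y u (hyll u hu)).abs ?_
      filter_upwards [hev u hu] with s hs
      exact hC s ⟨hs.1.le, hs.2.le.trans hu.2⟩
  set M := sSup S with hM
  have hyM : ∀ u ∈ Icc 0 τ, |y u| ≤ M := fun u hu => le_csSup hbdd (Or.inl ⟨u, hu, rfl⟩)
  have hM0 : 0 ≤ M := (abs_nonneg _).trans (hyM 0 ⟨le_rfl, hτ.le⟩)
  set B : ℝ → ℝ := fun t => (b (Ioc 0 t)).toReal with hB
  have hBmono : Monotone B := fun a c hac =>
    measureReal_mono (μ := b) (Ioc_subset_Ioc_right hac)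
  have hxl0 : ∀ u ∈ Ioc 0 τ, 0 ≤ leftLim x u := by
    intro u hu
    refine ge_of_tendsto (hlim x u (hxll u hu)) ?_
    filter_upwards [hev u hu] with s hs
    exact hxnn s ⟨hs.1.le, hs.2.le.trans hu.2⟩
  have step : ∀ ε > 0, ∀ t ∈ Icc 0 τ, (∀ s ∈ Icc 0 τ, s < t → x s ≤ (M + ε) * Real.exp (B s)) →
      x t ≤ (M + ε) * Real.exp (B t) - ε := by
    intro ε hε t ht h
    obtain ⟨hint, hle⟩ := gron_aux (b.restrict (Ioc 0 t)) t
      (by rw [Measure.restrict_apply measurableSet_Ioc.compl]; simp)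
    have hBt : (b.restrict (Ioc 0 t)).real univ = B t := by
      simp [hB, Measure.real]
    rw [hBt] at hle
    have h1 : ∫ u in Ioc 0 t, leftLim x u ∂b
        ≤ ∫ u in Ioc 0 t, (M + ε) * Real.exp ((b.restrict (Ioc 0 t)).real (Iio u)) ∂b := by
      refine integral_mono_of_nonneg ?_ (hint.const_mul _) ?_
      · filter_upwards [ae_restrict_mem measurableSet_Ioc] with u hu
        exact hxl0 u ⟨hu.1, hu.2.trans ht.2⟩
      · filter_upwards [ae_restrict_mem measurableSet_Ioc] with u hu
        have hu' : u ∈ Ioc 0 τ := ⟨hu.1, hu.2.trans ht.2⟩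
        refine le_of_tendsto (hlim x u (hxll u hu')) ?_
        filter_upwards [hev u hu'] with s hs
        refine (h s ⟨hs.1.le, hs.2.le.trans hu'.2⟩ (hs.2.trans_le hu.2)).trans ?_
        refine mul_le_mul_of_nonneg_left (Real.exp_le_exp.2 ?_) (by linarith)
        rw [measureReal_restrict_apply measurableSet_Iio]
        exact measureReal_mono (μ := b) (fun w hw =>
          ⟨lt_of_le_of_lt hw.2 hs.2, hw.1, hw.2.trans (hs.2.le.trans hu.2)⟩)
    rw [integral_const_mul] at h1
    have h2 := mul_le_mul_of_nonneg_left hle (by linarith : 0 ≤ M + ε)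
    have h3 := (le_abs_self _).trans (hyM t ht)
    have h4 := hineq t ht
    linarith
  have key : ∀ ε > 0, ∀ t ∈ Icc 0 τ, x t ≤ (M + ε) * Real.exp (B t) := by
    intro ε hε
    by_contra! hcon
    obtain ⟨t0, ht0, hbad0⟩ := hcon
    set A := {t | t ∈ Icc 0 τ ∧ (M + ε) * Real.exp (B t) < x t} with hA
    have hAne : A.Nonempty := ⟨t0, ht0, hbad0⟩
    have hAb : BddBelow A := ⟨0, fun t ht => ht.1.1⟩
    set T := sInf A with hT
    have hT0 : 0 ≤ T := le_csInf hAne fun t ht => ht.1.1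
    have hTt0 : T ≤ t0 := csInf_le hAb ⟨ht0, hbad0⟩
    have hTτ : T ∈ Icc 0 τ := ⟨hT0, hTt0.trans ht0.2⟩
    have hst := step ε hε T hTτ (by
      intro s hs hsT
      by_contra hc
      exact absurd (csInf_le hAb ⟨hs, not_le.1 hc⟩) (not_le.2 hsT))
    have hTlt : T < τ := by
      rcases hTt0.lt_or_eq with h | h
      · exact h.trans_le ht0.2
      · rw [← h] at hbad0; linarith
    have hev2 : ∀ᶠ s in nhdsWithin T (Ici T), x s < x T + ε :=
      (hxrc T ⟨hT0, hTlt⟩).eventually (gt_mem_nhds (by linarith))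
    obtain ⟨d, hd, hsub⟩ := mem_nhdsGE_iff_exists_Ico_subset.1 hev2
    obtain ⟨s, hs, hsd⟩ := exists_lt_of_csInf_lt hAne (show sInf A < d from hd)
    have hTs : T ≤ s := csInf_le hAb hs
    have h5 : x s < x T + ε := hsub ⟨hTs, hsd⟩
    have h6 := mul_le_mul_of_nonneg_left (Real.exp_le_exp.2 (hBmono hTs))
      (by linarith : 0 ≤ M + ε)
    have h7 := hs.2
    linarith
  have main : ∀ t ∈ Icc 0 τ, x t ≤ M * Real.exp (B t) := by
    intro t ht
    refine le_of_forall_pos_le_add fun δ hδ => ?_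
    have h := key (δ / Real.exp (B t)) (div_pos hδ (Real.exp_pos _)) t ht
    rwa [add_mul, div_mul_cancel₀ _ (Real.exp_pos _).ne'] at h
  refine ⟨main, fun t ht => ?_⟩
  have h := mul_le_mul_of_nonneg_left (main t ht) (Real.exp_pos (-(B t))).le
  have h2 : Real.exp (-(B t)) * (M * Real.exp (B t)) = M := by
    rw [mul_left_comm, ← Real.exp_add]; simp
  rw [h2] at h
  exact h
end

section
/- Let τ>0 and let b be a finite signed Borel measure on (0,τ]. For every right-continuous function y:[0,τ]→ℝ with left limits there exists exactly one right-continuous function x:[0,τ]→ℝ with left limits satisfying the linear Volterra equation x(t) = y(t) + ∫_{(0,t]} x(u−) b(du) for all t∈[0,τ], where x(u−) denotes the left limit of x at u. -/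
open MeasureTheory Set Function Filter

/-- A function is cadlag on `[0,τ]`: right-continuous on `[0,τ)` and possessing
left limits on `(0,τ]`. -/
def CadlagOn (τ : ℝ) (f : ℝ → ℝ) : Prop :=
  (∀ t ∈ Set.Ico 0 τ, Tendsto f (nhdsWithin t (Set.Ici t)) (nhds (f t))) ∧
  (∀ t ∈ Set.Ioc 0 τ, ∃ l : ℝ, Tendsto f (nhdsWithin t (Set.Iio t)) (nhds l))

/-- Integral with respect to a signed measure, via its Jordan decomposition. -/
noncomputable def signedIntegral (b : MeasureTheory.SignedMeasure ℝ) (S : Set ℝ) (f : ℝ → ℝ) : ℝ :=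
  (∫ u in S, f u ∂b.toJordanDecomposition.posPart) -
    ∫ u in S, f u ∂b.toJordanDecomposition.negPart


namespace Volt

noncomputable def F (μ : Measure ℝ) (t : ℝ) : ℝ := μ.real (Iio t)
noncomputable def w (μ : Measure ℝ) (t : ℝ) : ℝ := Real.exp (2 * F μ t)

variable (μ : Measure ℝ) [IsFiniteMeasure μ]

lemma F_mono : Monotone (F μ) := fun _ _ h => measureReal_mono (Iio_subset_Iio h)

lemma F_nonneg (t : ℝ) : 0 ≤ F μ t := measureReal_nonneg

lemma w_pos (t : ℝ) : 0 < w μ t := Real.exp_pos _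

lemma w_one_le (t : ℝ) : 1 ≤ w μ t := Real.one_le_exp (by have := F_nonneg μ t; linarith)

lemma w_le (t : ℝ) : w μ t ≤ Real.exp (2 * μ.real univ) :=
  Real.exp_le_exp.2 (by
    have : F μ t ≤ μ.real univ := measureReal_mono (subset_univ _)
    linarith)

lemma w_meas : Measurable (w μ) := by
  have := (F_mono μ).measurable
  unfold w
  fun_prop

lemma level (t r : ℝ) : μ ({u | r < F μ u} ∩ Iio t) ≤ ENNReal.ofReal (F μ t - r) := by
  have hm : MeasurableSet ({u | r < F μ u} ∩ Iio t) :=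
    (measurableSet_lt measurable_const (F_mono μ).measurable).inter measurableSet_Iio
  rw [hm.measure_eq_iSup_isCompact]
  refine iSup_le fun K => iSup_le fun hK => iSup_le fun hc => ?_
  rcases K.eq_empty_or_nonempty with rfl | hne
  · simp
  obtain ⟨k, hk, hmin⟩ := hc.exists_isLeast hne
  have hkA := hK hk
  have hsub : K ⊆ Iio t \ Iio k := fun x hx => ⟨(hK hx).2, not_lt.2 (hmin hx)⟩
  refine (measure_mono hsub).trans ?_
  rw [← ofReal_measureReal, measureReal_sdiff (Iio_subset_Iio (le_of_lt hkA.2)) measurableSet_Iio]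
  apply ENNReal.ofReal_le_ofReal
  have : r < F μ k := hkA.1
  unfold F at *
  linarith

lemma intw (t : ℝ) : ∫ u in Iio t, w μ u ∂μ ≤ w μ t / 2 := by
  have hg : ∀ x : ℝ, ∫ r in (0:ℝ)..x, 2 * Real.exp (2 * r) = Real.exp (2 * x) - 1 := by
    intro x
    rw [intervalIntegral.integral_eq_sub_of_hasDerivAt (f := fun r => Real.exp (2 * r))]
    · simp
    · intro r _
      have := ((hasDerivAt_id r).const_mul 2).exp
      simpa [mul_comm] using this
    · apply Continuous.intervalIntegrable; fun_prop
  have h1 := lintegral_comp_eq_lintegral_meas_lt_mul (μ.restrict (Iio t)) (f := F μ)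
    (g := fun r => 2 * Real.exp (2 * r)) (Eventually.of_forall (F_nonneg μ))
    (F_mono μ).measurable.aemeasurable
    (fun s _ => by apply Continuous.intervalIntegrable; fun_prop)
    (Eventually.of_forall fun r => by positivity)
  simp only [hg] at h1
  have hFt := F_nonneg μ t
  have h2 : ∫⁻ r in Ioi (0:ℝ), (μ.restrict (Iio t)) {a | r < F μ a} * ENNReal.ofReal (2 * Real.exp (2 * r))
      ≤ ENNReal.ofReal (Real.exp (2 * F μ t) / 2 - F μ t - 1/2) := by
    calc _ ≤ ∫⁻ r in Ioi (0:ℝ), (Ioc 0 (F μ t)).indicator (fun r => ENNReal.ofReal ((F μ t - r) * (2 * Real.exp (2 * r)))) r := by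
          apply setLIntegral_mono' measurableSet_Ioi
          intro r hr
          rw [Measure.restrict_apply (measurableSet_lt measurable_const (F_mono μ).measurable)]
          have := level μ t r
          by_cases hrF : r ≤ F μ t
          · rw [indicator_of_mem (show r ∈ Ioc 0 (F μ t) from ⟨hr, hrF⟩), ENNReal.ofReal_mul (p := F μ t - r) (by linarith)]
            exact mul_le_mul' this le_rfl
          · rw [ENNReal.ofReal_of_nonpos (by linarith)] at this
            rw [le_antisymm this (zero_le)]
            simp
      _ ≤ ∫⁻ r in Ioc 0 (F μ t), ENNReal.ofReal ((F μ t - r) * (2 * Real.exp (2 * r))) := by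
          rw [← lintegral_indicator measurableSet_Ioc]
          exact setLIntegral_le_lintegral _ _
      _ = ENNReal.ofReal (∫ r in Ioc 0 (F μ t), (F μ t - r) * (2 * Real.exp (2 * r))) := by
          rw [ofReal_integral_eq_lintegral_ofReal]
          · apply IntegrableOn.mono_set (t := Icc 0 (F μ t)) _ Ioc_subset_Icc_self
            apply Continuous.integrableOn_Icc; fun_prop
          · filter_upwards [ae_restrict_mem measurableSet_Ioc] with r hr
            have : 0 ≤ F μ t - r := by linarith [hr.2]
            simp only [Pi.zero_apply]; positivity
      _ = _ := by
          rw [← intervalIntegral.integral_of_le hFt]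
          rw [intervalIntegral.integral_eq_sub_of_hasDerivAt (f := fun r => (F μ t - r) * Real.exp (2 * r) + Real.exp (2 * r) / 2)]
          · congr 1; simp; ring
          · intro r _
            have e := ((hasDerivAt_id r).const_mul 2).exp
            have := (((hasDerivAt_id r).const_sub (F μ t)).mul e).add (e.div_const 2)
            refine this.congr_deriv ?_
            simp only [id]; ring
          · apply Continuous.intervalIntegrable; fun_prop
  rw [← h1] at h2
  have hint : Integrable (w μ) (μ.restrict (Iio t)) :=
    Integrable.of_bound (w_meas μ).aestronglyMeasurable (Real.exp (2 * μ.real univ))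
      (Eventually.of_forall fun u => by
        rw [Real.norm_of_nonneg (w_pos μ u).le]; exact w_le μ u)
  have h3 : ∫ u in Iio t, (w μ u - 1) ∂μ ≤ Real.exp (2 * F μ t) / 2 - F μ t - 1/2 := by
    rw [integral_eq_lintegral_of_nonneg_ae (Eventually.of_forall fun u => by
        have := w_one_le μ u; simp only [Pi.zero_apply]; linarith)
      (((w_meas μ).sub_const 1).aestronglyMeasurable)]
    refine ENNReal.toReal_le_of_le_ofReal ?_ h2
    have := Real.add_one_le_exp (2 * F μ t)
    linarith
  rw [integral_sub hint (integrable_const _)] at h3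
  simp only [integral_const, smul_eq_mul, mul_one, measureReal_restrict_apply_univ] at h3
  change _ - F μ t ≤ _ at h3
  unfold w at *
  linarith


/-! Integral operators -/

lemma tendsto_right (p : Measure ℝ) (z : ℝ → ℝ) (hz : Integrable z p) (t : ℝ) :
    Tendsto (fun s => ∫ u in Ioc 0 s, z u ∂p) (nhdsWithin t (Ici t))
      (nhds (∫ u in Ioc 0 t, z u ∂p)) := by
  simp_rw [← integral_indicator measurableSet_Ioc]
  refine tendsto_integral_filter_of_dominated_convergence (fun u => ‖z u‖)
    (Eventually.of_forall fun s => (hz.indicator measurableSet_Ioc).aestronglyMeasurable)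
    (Eventually.of_forall fun s => Eventually.of_forall fun u => norm_indicator_le_norm_self _ _)
    hz.norm (Eventually.of_forall fun u => ?_)
  apply tendsto_nhds_of_eventually_eq
  rcases le_or_gt u t with h | h
  · filter_upwards [self_mem_nhdsWithin] with s hs
    have hs : t ≤ s := hs
    have : u ≤ s := h.trans hs
    simp [indicator, h, this]
  · filter_upwards [mem_nhdsWithin_of_mem_nhds (Iio_mem_nhds h)] with s hs
    have hs : s < u := hs
    simp [indicator, not_le.2 h, not_le.2 hs]

lemma tendsto_left (p : Measure ℝ) (z : ℝ → ℝ) (hz : Integrable z p) (t : ℝ) :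
    Tendsto (fun s => ∫ u in Ioc 0 s, z u ∂p) (nhdsWithin t (Iio t))
      (nhds (∫ u in Ioo 0 t, z u ∂p)) := by
  simp_rw [← integral_indicator measurableSet_Ioc, ← integral_indicator measurableSet_Ioo]
  refine tendsto_integral_filter_of_dominated_convergence (fun u => ‖z u‖)
    (Eventually.of_forall fun s => (hz.indicator measurableSet_Ioc).aestronglyMeasurable)
    (Eventually.of_forall fun s => Eventually.of_forall fun u => norm_indicator_le_norm_self _ _)
    hz.norm (Eventually.of_forall fun u => ?_)
  apply tendsto_nhds_of_eventually_eq
  rcases lt_or_ge u t with h | h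
  · filter_upwards [mem_nhdsWithin_of_mem_nhds (Ioi_mem_nhds h)] with s hs
    have hs : u < s := hs
    simp [indicator, h, hs.le]
  · filter_upwards [self_mem_nhdsWithin] with s hs
    have hs : s < t := hs
    have : s < u := hs.trans_le h
    simp [indicator, not_lt.2 h, not_le.2 this]

lemma meas_op (p : Measure ℝ) [IsFiniteMeasure p] (z : ℝ → ℝ) (hz : Measurable z) :
    Measurable (fun t => ∫ u in Ioo 0 t, z u ∂p) := by
  simp_rw [← integral_indicator measurableSet_Ioo]
  have h : Measurable (fun q : ℝ × ℝ => (Ioo 0 q.1).indicator z q.2) := by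
    have hs : MeasurableSet {q : ℝ × ℝ | q.2 ∈ Ioo 0 q.1} :=
      (measurableSet_lt measurable_const measurable_snd).inter
        (measurableSet_lt measurable_snd measurable_fst)
    exact (hz.comp measurable_snd).indicator hs
  exact (h.stronglyMeasurable.integral_prod_right).measurable

variable (p n : Measure ℝ) [IsFiniteMeasure p] [IsFiniteMeasure n]

/-- The Volterra operator. -/
noncomputable def K (z : ℝ → ℝ) (t : ℝ) : ℝ := (∫ u in Ioo 0 t, z u ∂p) - ∫ u in Ioo 0 t, z u ∂n

lemma K_meas (z : ℝ → ℝ) (hz : Measurable z) : Measurable (K p n z) :=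
  (meas_op p z hz).sub (meas_op n z hz)

lemma int_of_bd (ν : Measure ℝ) [IsFiniteMeasure ν] (z : ℝ → ℝ) (hz : Measurable z) (C : ℝ)
    (hC : ∀ u, |z u| ≤ C * w μ u) : Integrable z ν := by
  refine Integrable.of_bound hz.aestronglyMeasurable (|C| * Real.exp (2 * μ.real univ))
    (Eventually.of_forall fun u => (hC u).trans ?_)
  have := w_le μ u
  have := (w_pos μ u).le
  gcongr
  exact le_abs_self C

lemma K_bound (z : ℝ → ℝ) (hz : Measurable z) (C : ℝ) (hC0 : 0 ≤ C)
    (hC : ∀ u, |z u| ≤ C * w (p + n) u) (t : ℝ) :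
    |K p n z t| ≤ C * (1 / 2) * w (p + n) t := by
  have hp := int_of_bd (p + n) p z hz C hC
  have hn := int_of_bd (p + n) n z hz C hC
  have hw : Integrable (w (p + n)) (p + n) :=
    int_of_bd (p + n) (p + n) _ (w_meas _) 1 (fun u => by rw [abs_of_pos (w_pos _ _), one_mul])
  calc |K p n z t| ≤ |∫ u in Ioo 0 t, z u ∂p| + |∫ u in Ioo 0 t, z u ∂n| := abs_sub _ _
    _ ≤ (∫ u in Ioo 0 t, |z u| ∂p) + ∫ u in Ioo 0 t, |z u| ∂n :=
        add_le_add (abs_integral_le_integral_abs) (abs_integral_le_integral_abs)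
    _ = ∫ u in Ioo 0 t, |z u| ∂(p + n) := by
        rw [Measure.restrict_add, integral_add_measure hp.abs.integrableOn hn.abs.integrableOn]
    _ ≤ ∫ u in Ioo 0 t, C * w (p + n) u ∂(p + n) := by
        apply integral_mono (hp.add_measure hn).abs.integrableOn (hw.const_mul C).integrableOn hC
    _ ≤ ∫ u in Iio t, C * w (p + n) u ∂(p + n) := by
        apply setIntegral_mono_set (hw.const_mul C).integrableOn
        · exact Eventually.of_forall fun u => mul_nonneg hC0 (w_pos _ _).le
        · exact (Ioo_subset_Iio_self).eventuallyLE
    _ ≤ _ := by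
        rw [integral_const_mul]
        have := intw (p + n) t
        calc _ ≤ C * (w (p + n) t / 2) := by gcongr
          _ = _ := by ring

/-- Uniqueness for the left-limit equation. -/
lemma K_unique (τ : ℝ) (d : ℝ → ℝ) (hd : Measurable d) (C : ℝ) (hC : ∀ u, |d u| ≤ C)
    (h0 : ∀ u, u ∉ Ioc 0 τ → d u = 0) (hK : ∀ u ∈ Ioc 0 τ, d u = K p n d u) : ∀ u, d u = 0 := by
  have hC0 : 0 ≤ C := (abs_nonneg _).trans (hC 0)
  have key : ∀ m : ℕ, ∀ u, |d u| ≤ C * (1 / 2) ^ m * w (p + n) u := by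
    intro m
    induction m with
    | zero =>
      intro u
      have := w_one_le (p + n) u
      have := hC u
      nlinarith
    | succ m ih =>
      intro u
      by_cases hu : u ∈ Ioc 0 τ
      · rw [hK u hu, pow_succ, ← mul_assoc]
        exact K_bound p n d hd _ (by positivity) ih u
      · rw [h0 u hu, abs_zero]
        have := w_pos (p + n) u
        positivity
  intro u
  have hl : Tendsto (fun m : ℕ => C * (1 / 2 : ℝ) ^ m * w (p + n) u) atTop (nhds (C * 0 * w (p + n) u)) :=
    ((tendsto_pow_atTop_nhds_zero_of_lt_one (by norm_num) (by norm_num)).const_mul C).mul_const _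
  have := ge_of_tendsto' hl (fun m => key m u)
  simpa using this

/-- Existence for the left-limit equation. -/
lemma K_exists (g : ℝ → ℝ) (hg : Measurable g) (C : ℝ) (hC : ∀ u, |g u| ≤ C) :
    ∃ z : ℝ → ℝ, Measurable z ∧ (∃ D, ∀ u, |z u| ≤ D) ∧ ∀ u, z u = g u + K p n z u := by
  have hC0 : 0 ≤ C := (abs_nonneg _).trans (hC 0)
  let e : ℕ → ℝ → ℝ := fun m => (K p n)^[m] g
  have es : ∀ m, e (m + 1) = K p n (e m) := fun m => Function.iterate_succ_apply' _ _ _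
  have em : ∀ m, Measurable (e m) := by
    intro m
    induction m with
    | zero => exact hg
    | succ m ih => rw [es]; exact K_meas p n _ ih
  have eb : ∀ m u, |e m u| ≤ C * (1 / 2) ^ m * w (p + n) u := by
    intro m
    induction m with
    | zero =>
      intro u
      have := w_one_le (p + n) u
      have : |e 0 u| ≤ C := hC u
      nlinarith
    | succ m ih =>
      intro u
      rw [es, pow_succ, ← mul_assoc]
      exact K_bound p n _ (em m) _ (by positivity) ih u
  set W := Real.exp (2 * (p + n).real univ) with hW
  have eb' : ∀ m u, ‖e m u‖ ≤ C * W * (1 / 2) ^ m := by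
    intro m u
    have h1 := w_le (p + n) u
    calc _ ≤ C * (1 / 2) ^ m * w (p + n) u := eb m u
      _ ≤ C * (1 / 2) ^ m * W := by gcongr
      _ = _ := by ring
  have hgeo : Summable (fun m : ℕ => C * W * (1 / 2 : ℝ) ^ m) :=
    (summable_geometric_of_lt_one (by norm_num) (by norm_num)).mul_left _
  have hsum : ∀ u, Summable (fun m => e m u) := fun u =>
    Summable.of_norm_bounded hgeo (fun m => eb' m u)
  have hswap : ∀ (ν : Measure ℝ) [IsFiniteMeasure ν] (t : ℝ),
      HasSum (fun m => ∫ u in Ioo 0 t, e m u ∂ν) (∫ u in Ioo 0 t, ∑' m, e m u ∂ν) := by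
    intro ν _ t
    refine hasSum_integral_of_dominated_convergence (fun m _ => C * W * (1 / 2 : ℝ) ^ m)
      (fun m => (em m).aestronglyMeasurable) (fun m => Eventually.of_forall (eb' m))
      (Eventually.of_forall fun _ => hgeo) (integrable_const _)
      (Eventually.of_forall fun u => (hsum u).hasSum)
  refine ⟨fun u => ∑' m, e m u, ?_, ⟨∑' m : ℕ, C * W * (1 / 2 : ℝ) ^ m, fun u => ?_⟩, fun u => ?_⟩
  · refine measurable_of_tendsto_metrizable (f := fun N : ℕ => fun u => ∑ m ∈ Finset.range N, e m u)
      (fun N => Finset.measurable_fun_sum _ fun m _ => em m) ?_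
    exact tendsto_pi_nhds.2 fun u => (hsum u).hasSum.tendsto_sum_nat
  · exact tsum_of_norm_bounded hgeo.hasSum (fun m => eb' m u)
  · beta_reduce
    rw [(hsum u).tsum_eq_zero_add]
    congr 1
    have := (hswap p u).sub (hswap n u)
    simp_rw [es]
    exact this.tsum_eq

/-! Cadlag functions -/

/-- Left limit extended by zero. -/
noncomputable def LL (τ : ℝ) (y : ℝ → ℝ) : ℝ → ℝ := (Ioc 0 τ).indicator (leftLim y)

lemma ll_tendsto {τ : ℝ} {y : ℝ → ℝ} (hy : CadlagOn τ y) {t : ℝ} (ht : t ∈ Ioc 0 τ) :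
    Tendsto y (nhdsWithin t (Iio t)) (nhds (leftLim y t)) :=
  tendsto_leftLim_of_tendsto (hy.2 t ht)

lemma LL_meas {τ : ℝ} {y : ℝ → ℝ} (hy : CadlagOn τ y) : Measurable (LL τ y) := by
  refine measurable_of_tendsto_metrizable
    (f := fun N : ℕ => (Ioc 0 τ).indicator (fun u => y ((⌈(N + 1 : ℝ) * u⌉ - 1) / (N + 1)))) ?_ ?_
  · intro N
    refine Measurable.indicator ?_ measurableSet_Ioc
    have h1 : Measurable (fun k : ℤ => y (((k : ℝ) - 1) / (N + 1))) := Measurable.of_discrete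
    exact h1.comp (Int.measurable_ceil.comp (measurable_const_mul (N + 1 : ℝ)))
  · refine tendsto_pi_nhds.2 fun u => ?_
    by_cases hu : u ∈ Ioc 0 τ
    · simp only [LL, indicator_of_mem hu]
      refine (ll_tendsto hy hu).comp ?_
      refine tendsto_nhdsWithin_iff.2 ⟨?_, Eventually.of_forall fun N => ?_⟩
      · have hl : Tendsto (fun N : ℕ => u - 1 / ((N : ℝ) + 1)) atTop (nhds (u - 0)) :=
          tendsto_const_nhds.sub tendsto_one_div_add_atTop_nhds_zero_nat
        rw [sub_zero] at hl
        refine tendsto_of_tendsto_of_tendsto_of_le_of_le hl tendsto_const_nhds (fun N => ?_) (fun N => ?_)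
        · have hN : (0:ℝ) < N + 1 := by positivity
          have := Int.le_ceil ((N + 1 : ℝ) * u)
          simp only
          rw [le_div_iff₀ hN, sub_mul, one_div, inv_mul_cancel₀ hN.ne']
          linarith
        · have hN : (0:ℝ) < N + 1 := by positivity
          have := Int.ceil_lt_add_one ((N + 1 : ℝ) * u)
          simp only
          rw [div_le_iff₀ hN]
          linarith
      · have hN : (0:ℝ) < N + 1 := by positivity
        have := Int.ceil_lt_add_one ((N + 1 : ℝ) * u)
        simp only [mem_Iio]
        rw [div_lt_iff₀ hN]
        linarith
    · simp [LL, indicator_of_notMem hu]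

lemma bdd_of_tendsto {f : ℝ → ℝ} {l : Filter ℝ} {a : ℝ} (h : Tendsto f l (nhds a)) :
    ∀ᶠ u in l, |f u| ≤ |a| + 1 := by
  have := (h.abs).eventually (Iio_mem_nhds (show |a| < |a| + 1 by linarith))
  exact this.mono fun u hu => le_of_lt hu

lemma cadlag_bdd {τ : ℝ} {y : ℝ → ℝ} (hy : CadlagOn τ y) : ∃ C, ∀ u ∈ Icc 0 τ, |y u| ≤ C := by
  refine IsCompact.induction_on (p := fun s => ∃ C, ∀ u ∈ s, |y u| ≤ C) isCompact_Icc
    ⟨0, by simp⟩ (fun s t hst ⟨C, hC⟩ => ⟨C, fun u hu => hC u (hst hu)⟩) ?_ ?_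
  · rintro s t ⟨C, hC⟩ ⟨D, hD⟩
    refine ⟨max C D, ?_⟩
    rintro u (hu | hu)
    · exact (hC u hu).trans (le_max_left _ _)
    · exact (hD u hu).trans (le_max_right _ _)
  · intro t ht
    have hr : ∃ C, ∀ᶠ u in nhdsWithin t (Ici t), u ∈ Icc 0 τ → |y u| ≤ C := by
      rcases lt_or_eq_of_le ht.2 with h | h
      · exact ⟨_, (bdd_of_tendsto (hy.1 t ⟨ht.1, h⟩)).mono fun u hu _ => hu⟩
      · refine ⟨|y t|, ?_⟩
        filter_upwards [self_mem_nhdsWithin] with u hu hu'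
        have : u = t := le_antisymm (h ▸ hu'.2) hu
        rw [this]
    have hl : ∃ C, ∀ᶠ u in nhdsWithin t (Iio t), u ∈ Icc 0 τ → |y u| ≤ C := by
      rcases lt_or_eq_of_le ht.1 with h | h
      · exact ⟨_, (bdd_of_tendsto (ll_tendsto hy ⟨h, ht.2⟩)).mono fun u hu _ => hu⟩
      · refine ⟨0, ?_⟩
        filter_upwards [self_mem_nhdsWithin] with u hu hu'
        have hu : u < t := hu
        exact absurd hu (not_lt.2 (h ▸ hu'.1))
    obtain ⟨C, hC⟩ := hr
    obtain ⟨D, hD⟩ := hl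
    refine ⟨{u | u ∈ Icc 0 τ → |y u| ≤ max C D} ∩ Icc 0 τ, ?_, max C D, fun u hu => hu.1 hu.2⟩
    refine inter_mem (mem_nhdsWithin_of_mem_nhds ?_) self_mem_nhdsWithin
    have : ∀ᶠ u in nhds t, u ∈ Icc 0 τ → |y u| ≤ max C D := by
      rw [← nhdsLT_sup_nhdsGE t]
      exact eventually_sup.2 ⟨hD.mono fun u h hu => (h hu).trans (le_max_right _ _),
        hC.mono fun u h hu => (h hu).trans (le_max_left _ _)⟩
    exact this

lemma LL_bdd {τ : ℝ} {y : ℝ → ℝ} (hy : CadlagOn τ y) : ∃ C, ∀ u, |LL τ y u| ≤ C := by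
  obtain ⟨C, hC⟩ := cadlag_bdd hy
  refine ⟨|C|, fun u => ?_⟩
  by_cases hu : u ∈ Ioc 0 τ
  · rw [LL, indicator_of_mem hu]
    refine le_of_tendsto (ll_tendsto hy hu).abs ?_
    filter_upwards [self_mem_nhdsWithin, mem_nhdsWithin_of_mem_nhds (Ioi_mem_nhds hu.1)] with s hs hs'
    exact (hC s ⟨le_of_lt hs', (le_of_lt hs).trans hu.2⟩).trans (le_abs_self C)
  · rw [LL, indicator_of_notMem hu, abs_zero]; exact abs_nonneg C

/-- Signed integral over `(0,t]`. -/
noncomputable def J (z : ℝ → ℝ) (t : ℝ) : ℝ := (∫ u in Ioc 0 t, z u ∂p) - ∫ u in Ioc 0 t, z u ∂n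

lemma bd_int {ν : Measure ℝ} [IsFiniteMeasure ν] {z : ℝ → ℝ} (hz : Measurable z) {C : ℝ}
    (hC : ∀ u, |z u| ≤ C) : Integrable z ν :=
  Integrable.of_bound hz.aestronglyMeasurable C (Eventually.of_forall hC)

lemma J_left {z : ℝ → ℝ} (hz : Measurable z) {C : ℝ} (hC : ∀ u, |z u| ≤ C) (t : ℝ) :
    Tendsto (J p n z) (nhdsWithin t (Iio t)) (nhds (K p n z t)) :=
  (tendsto_left p z (bd_int hz hC) t).sub (tendsto_left n z (bd_int hz hC) t)

lemma J_right {z : ℝ → ℝ} (hz : Measurable z) {C : ℝ} (hC : ∀ u, |z u| ≤ C) (t : ℝ) :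
    Tendsto (J p n z) (nhdsWithin t (Ici t)) (nhds (J p n z t)) :=
  (tendsto_right p z (bd_int hz hC) t).sub (tendsto_right n z (bd_int hz hC) t)

lemma J_congr {z z' : ℝ → ℝ} {τ t : ℝ} (ht : t ≤ τ) (h : ∀ u ∈ Ioc 0 τ, z u = z' u) :
    J p n z t = J p n z' t := by
  unfold J
  have : EqOn z z' (Ioc 0 t) := fun u hu => h u ⟨hu.1, hu.2.trans ht⟩
  rw [setIntegral_congr_fun measurableSet_Ioc this, setIntegral_congr_fun measurableSet_Ioc this]

lemma LL_eq {τ : ℝ} {x : ℝ → ℝ} : ∀ u ∈ Ioc 0 τ, leftLim x u = LL τ x u := fun u hu => by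
  rw [LL, indicator_of_mem hu]

/-- A solution's left limit solves the left-limit equation. -/
lemma sol_left {τ : ℝ} {x y : ℝ → ℝ} (hx : CadlagOn τ x) (hy : CadlagOn τ y)
    (h : ∀ t ∈ Icc 0 τ, x t = y t + J p n (leftLim x) t) :
    ∀ u ∈ Ioc 0 τ, LL τ x u = leftLim y u + K p n (LL τ x) u := by
  intro u hu
  obtain ⟨C, hC⟩ := LL_bdd hx
  rw [← LL_eq u hu]
  apply leftLim_eq_of_tendsto
  refine ((ll_tendsto hy hu).add (J_left p n (LL_meas hx) hC u)).congr' ?_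
  filter_upwards [self_mem_nhdsWithin, mem_nhdsWithin_of_mem_nhds (Ioi_mem_nhds hu.1)] with s hs hs'
  have hs1 : s ≤ τ := (le_of_lt hs).trans hu.2
  rw [h s ⟨le_of_lt hs', hs1⟩, J_congr p n hs1 LL_eq]

lemma sol_unique {τ : ℝ} {x x' y : ℝ → ℝ} (hx : CadlagOn τ x) (hx' : CadlagOn τ x')
    (hy : CadlagOn τ y) (h : ∀ t ∈ Icc 0 τ, x t = y t + J p n (leftLim x) t)
    (h' : ∀ t ∈ Icc 0 τ, x' t = y t + J p n (leftLim x') t) : EqOn x x' (Icc 0 τ) := by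
  obtain ⟨C, hC⟩ := LL_bdd hx
  obtain ⟨C', hC'⟩ := LL_bdd hx'
  have m := LL_meas hx
  have m' := LL_meas hx'
  have hd := K_unique p n τ (fun u => LL τ x u - LL τ x' u) (m.sub m') (C + C')
    (fun u => (abs_sub _ _).trans (add_le_add (hC u) (hC' u)))
    (fun u hu => by simp [LL, indicator_of_notMem hu])
    (fun u hu => by
      beta_reduce
      rw [sol_left p n hx hy h u hu, sol_left p n hx' hy h' u hu]
      unfold K
      rw [integral_sub (bd_int m hC) (bd_int m' hC'), integral_sub (bd_int m hC) (bd_int m' hC')]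
      ring)
  intro t ht
  rw [h t ht, h' t ht, J_congr p n ht.2 (z' := leftLim x') (fun u hu => ?_)]
  rw [LL_eq u hu, LL_eq u hu]
  exact sub_eq_zero.1 (hd u)

lemma main (τ : ℝ) (y : ℝ → ℝ) (hy : CadlagOn τ y) :
    ∃ x : ℝ → ℝ, (CadlagOn τ x ∧ ∀ t ∈ Icc 0 τ, x t = y t + J p n (leftLim x) t) ∧
      ∀ x' : ℝ → ℝ, CadlagOn τ x' → (∀ t ∈ Icc 0 τ, x' t = y t + J p n (leftLim x') t) →
        EqOn x x' (Icc 0 τ) := by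
  obtain ⟨C, hC⟩ := LL_bdd hy
  obtain ⟨z, hz, ⟨D, hD⟩, hzK⟩ := K_exists p n (LL τ y) (LL_meas hy) C hC
  have hleft : ∀ t ∈ Ioc 0 τ, Tendsto (fun t => y t + J p n z t) (nhdsWithin t (Iio t)) (nhds (z t)) := by
    intro t ht
    rw [hzK t, ← LL_eq t ht]
    exact (ll_tendsto hy ht).add (J_left p n hz hD t)
  have hxc : CadlagOn τ (fun t => y t + J p n z t) :=
    ⟨fun t ht => (hy.1 t ht).add (J_right p n hz hD t), fun t ht => ⟨_, hleft t ht⟩⟩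
  have hxe : ∀ t ∈ Icc 0 τ, y t + J p n z t
      = y t + J p n (leftLim (fun t => y t + J p n z t)) t := by
    intro t ht
    rw [J_congr p n ht.2 (fun u hu => (leftLim_eq_of_tendsto (hleft u hu)).symm)]
  refine ⟨fun t => y t + J p n z t, ⟨hxc, hxe⟩, ?_⟩
  exact fun x' hx' h' => sol_unique p n hxc hx' hy hxe h'

end Volt

theorem linear_volterra_existence_uniqueness
    (τ : ℝ) (hτ : 0 < τ)
    (b : MeasureTheory.SignedMeasure ℝ) (hbsupp : b.totalVariation (Set.Ioc 0 τ)ᶜ = 0) :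
    ∀ y : ℝ → ℝ, CadlagOn τ y →
      ∃ x : ℝ → ℝ,
        (CadlagOn τ x ∧
          ∀ t ∈ Set.Icc 0 τ,
            x t = y t + signedIntegral b (Set.Ioc 0 t) (fun u => Function.leftLim x u)) ∧
        ∀ x' : ℝ → ℝ, CadlagOn τ x' →
          (∀ t ∈ Set.Icc 0 τ,
            x' t = y t + signedIntegral b (Set.Ioc 0 t) (fun u => Function.leftLim x' u)) →
          Set.EqOn x x' (Set.Icc 0 τ) := by
  intro y hy
  exact Volt.main b.toJordanDecomposition.posPart b.toJordanDecomposition.negPart τ y hy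
end
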